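/- arXiv:2409.02940 — 2 statements merged into one kernel-verified Lean document; each statement's English description precedes it below -/
import Mathlib

section
/- Fix integers r ≥ 2 and n ≥ 1. Let z = Σ_{j=1}^r c_j·x̂_j be a cycle of exterior degree 1 in K(𝔉; x_1 − y_1, …, x_r − y_r) whose image in K(ℚ ⊗ 𝔉; x_1 − y_1, …, x_r − y_r) is homologous to κ_n := (1/(n+1))·Σ_{j=1}^r (Σ_{i=0}^n x_j^i·y_j^{n−i})·x̂_j. Let J = (i_1, …, i_l) be any sequence with each i_t ∈ {1, …, r−1}, and let Φ(z) := Σ_{j=1}^r φ_J(c_j)·x̂_j ∈ K(R_J; x_1 − y_1, …, x_r − y_r), where φ_J : 𝔉 → R_J is the ring homomorphism with x_i ↦ x_i, y_i ↦ y_i. Then exterior multiplication by Φ(z) sends cycles to cycles and boundaries to boundaries, and for every q < r the induced sequence H_{q−1} → H_q → H_{q+1} of Koszul homology modules of K(R_J; x_1 − y_1, …, x_r − y_r), with both maps given by multiplication by the class of Φ(z), is exact at H_q. (The homology of Hochschild homology with respect to multiplication by β_n is concentrated in top Hochschild degree r.) -/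
noncomputable section
open MvPolynomial

/-- The `k`-th elementary symmetric function of a finite family of ring elements:
`e_k(v) = Σ_{S ⊆ ι, |S| = k} Π_{j ∈ S} v j`. -/
def esym {R : Type*} [CommRing R] {ι : Type*} [Fintype ι] [DecidableEq ι]
    (k : ℕ) (v : ι → R) : R :=
  ∑ S ∈ Finset.univ.powersetCard k, ∏ j ∈ S, v j

/-- The polynomial ring `ℤ[x_1,…,x_r,y_1,…,y_r]`: `Sum.inl` indexes the `x`'s and
`Sum.inr` indexes the `y`'s. -/
abbrev FPoly (r : ℕ) := MvPolynomial (Fin r ⊕ Fin r) ℤ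

/-- The relation `e_{j+1}(x) − e_{j+1}(y)` (so the degrees `1,…,r` occur as `j` runs
through `Fin r`). -/
def Frel (r : ℕ) (j : Fin r) : FPoly r :=
  esym ((j : ℕ) + 1) (fun i : Fin r => (X (Sum.inl i) : FPoly r)) -
    esym ((j : ℕ) + 1) (fun i : Fin r => (X (Sum.inr i) : FPoly r))

/-- The ring `𝔉 = ℤ[x,y]/(e_1(x) − e_1(y), …, e_r(x) − e_r(y))`. -/
abbrev FRing (r : ℕ) := FPoly r ⧸ Ideal.span (Set.range (Frel r))

/-- The rational version `ℚ ⊗ 𝔉`: the polynomial ring `ℚ[x,y]` modulo the images of the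
relations `e_j(x) − e_j(y)`. -/
abbrev FQRing (r : ℕ) :=
  MvPolynomial (Fin r ⊕ Fin r) ℚ ⧸
    Ideal.span (Set.range fun j => MvPolynomial.map (Int.castRingHom ℚ) (Frel r j))

/-- The canonical ring homomorphism `𝔉 → ℚ ⊗ 𝔉` at the level of representatives:
`ℤ[x,y] → ℚ ⊗ 𝔉`. -/
def toFQ (r : ℕ) : FPoly r →+* FQRing r :=
  (Ideal.Quotient.mk _).comp (MvPolynomial.map (Int.castRingHom ℚ))

/-- `x_j` in `𝔉`. -/
def xZ (r : ℕ) (j : Fin r) : FRing r := Ideal.Quotient.mk _ (X (Sum.inl j))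

/-- `y_j` in `𝔉`. -/
def yZ (r : ℕ) (j : Fin r) : FRing r := Ideal.Quotient.mk _ (X (Sum.inr j))

/-- `x_j` in `ℚ ⊗ 𝔉`. -/
def xQ (r : ℕ) (j : Fin r) : FQRing r := toFQ r (X (Sum.inl j))

/-- `y_j` in `ℚ ⊗ 𝔉`. -/
def yQ (r : ℕ) (j : Fin r) : FQRing r := toFQ r (X (Sum.inr j))

/-- The `j`-th coefficient of `κ_n = (1/(n+1))·Σ_j (Σ_{i=0}^n x_j^i·y_j^{n−i})·x̂_j`. -/
def kappa (r n : ℕ) (j : Fin r) : FQRing r :=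
  algebraMap ℚ (FQRing r) (1 / (n + 1)) *
    ∑ i ∈ Finset.range (n + 1), xQ r j ^ i * yQ r j ^ (n - i)


/-- The polynomial ring `ℤ[x_1,…,x_r,δ_1,…,δ_l]` with `r = m + 2` strands:
`Sum.inl` indexes the `x`'s and `Sum.inr` indexes the `δ`'s. -/
abbrev BSPoly (m l : ℕ) := MvPolynomial (Fin (m + 2) ⊕ Fin l) ℤ

/-- The Bott–Samelson relation attached to `t`:
`δ_t·(δ_t + x_{i_t} − x_{i_t+1} + 2·Σ_{s<t, i_s=i_t} δ_s − Σ_{s<t, |i_s−i_t|=1} δ_s)`.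
Crossing indices are zero-based: `i t : Fin (m+1)` encodes the simple reflection between
strands `i t` and `i t + 1` (zero-based), so `x_{i_t} = X (Sum.inl (i t).castSucc)` and
`x_{i_t+1} = X (Sum.inl (i t).succ)`. -/
def BSrel (m l : ℕ) (i : Fin l → Fin (m + 1)) (t : Fin l) : BSPoly m l :=
  X (Sum.inr t) *
    (X (Sum.inr t) + X (Sum.inl (i t).castSucc) - X (Sum.inl (i t).succ)
      + 2 * ∑ s ∈ Finset.univ.filter fun s => s < t ∧ i s = i t, X (Sum.inr s)
      - ∑ s ∈ Finset.univ.filter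
          fun s => s < t ∧ ((i s : ℕ) = (i t : ℕ) + 1 ∨ (i t : ℕ) = (i s : ℕ) + 1),
          X (Sum.inr s))

/-- The Bott–Samelson ring `R_J = ℤ[x,δ]/I_J`. -/
abbrev BSRing (m l : ℕ) (i : Fin l → Fin (m + 1)) :=
  BSPoly m l ⧸ Ideal.span (Set.range (BSrel m l i))

/-- `x_j ∈ R_J`. -/
def xB (m l : ℕ) (i : Fin l → Fin (m + 1)) (j : Fin (m + 2)) : BSRing m l i :=
  Ideal.Quotient.mk _ (X (Sum.inl j))

/-- `δ_t ∈ R_J`. -/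
def δB (m l : ℕ) (i : Fin l → Fin (m + 1)) (t : Fin l) : BSRing m l i :=
  Ideal.Quotient.mk _ (X (Sum.inr t))

/-- `δ̂_c = Σ_{t : i_t = c} δ_t ∈ R_J`, indexed by an integer `c` so that the conventions
`δ̂_0 = δ̂_r = 0` (one-based) hold automatically. -/
def δhat (m l : ℕ) (i : Fin l → Fin (m + 1)) (c : ℤ) : BSRing m l i :=
  ∑ t ∈ Finset.univ.filter fun t => ((i t : ℕ) : ℤ) = c, δB m l i t

/-- `y_j = x_j + δ̂_j − δ̂_{j−1} ∈ R_J` (zero-based `j`). -/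
def yB (m l : ℕ) (i : Fin l → Fin (m + 1)) (j : Fin (m + 2)) : BSRing m l i :=
  xB m l i j + δhat m l i (j : ℤ) - δhat m l i ((j : ℤ) - 1)

/-- The ring homomorphism `ℤ[x_1,…,x_r,y_1,…,y_r] → R_J`, `x_j ↦ x_j`, `y_j ↦ y_j`. -/
def toBS (m l : ℕ) (i : Fin l → Fin (m + 1)) :
    MvPolynomial (Fin (m + 2) ⊕ Fin (m + 2)) ℤ →+* BSRing m l i :=
  (MvPolynomial.aeval fun v => Sum.elim (xB m l i) (yB m l i) v).toRingHom

/-- The ring homomorphism `ℤ[x_1,…,x_r] → R_J`, `x_j ↦ x_j`. -/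
def ψBS (m l : ℕ) (i : Fin l → Fin (m + 1)) :
    MvPolynomial (Fin (m + 2)) ℤ →+* BSRing m l i :=
  (MvPolynomial.aeval fun j => xB m l i j).toRingHom


/-- The underlying module of the Koszul complex `B ⊗ Λ(x̂_1,…,x̂_r)`: a free `B`-module
with basis the square-free monomials `x̂_S = x̂_{s_1}∧⋯∧x̂_{s_q}` (`s_1 < ⋯ < s_q`)
indexed by finsets `S ⊆ Fin r`. -/
abbrev KModule (B : Type*) [CommRing B] (r : ℕ) := Finset (Fin r) → B

/-- The Koszul sign `(−1)^{#{j ∈ t | j < i}}` arising when moving `x̂_i` past the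
generators of `x̂_t` that precede it. -/
def ksign {B : Type*} [CommRing B] {r : ℕ} (i : Fin r) (t : Finset (Fin r)) : B :=
  (-1) ^ (t.filter fun j => j < i).card

/-- The Koszul differential of `K(B; z_1,…,z_r)`: the `B`-linear map of exterior
degree `−1` determined by the graded Leibniz rule and `d(x̂_i) = z i`; on basis
elements, `d(x̂_S) = Σ_{i ∈ S} ±(z i)·x̂_{S∖i}`. -/
def koszulD {B : Type*} [CommRing B] {r : ℕ} (z : Fin r → B) :
    KModule B r →ₗ[B] KModule B r where
  toFun f t := ∑ i ∈ tᶜ, ksign i t * z i * f (insert i t)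
  map_add' f g := by
    funext t
    simp [Pi.add_apply, mul_add, Finset.sum_add_distrib]
  map_smul' c f := by
    funext t
    simp only [Pi.smul_apply, smul_eq_mul, RingHom.id_apply, Finset.mul_sum]
    exact Finset.sum_congr rfl fun i _ => by ring

/-- Left exterior multiplication by the degree-1 element `Σ_i (c i)·x̂_i`: the
`B`-linear map of exterior degree `+1` with `x̂_S ↦ Σ_{i ∉ S} ±(c i)·x̂_{S∪i}`. -/
def extMul {B : Type*} [CommRing B] {r : ℕ} (c : Fin r → B) :
    KModule B r →ₗ[B] KModule B r where
  toFun f t := ∑ i ∈ t, ksign i (t.erase i) * c i * f (t.erase i)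
  map_add' f g := by
    funext t
    simp [Pi.add_apply, mul_add, Finset.sum_add_distrib]
  map_smul' a f := by
    funext t
    simp only [Pi.smul_apply, smul_eq_mul, RingHom.id_apply, Finset.mul_sum]
    exact Finset.sum_congr rfl fun i _ => by ring

/-- The exterior-degree-`q` summand of the Koszul complex (indexed by `q : ℤ`, so
negative degrees vanish automatically). -/
def kdeg (B : Type*) [CommRing B] (r : ℕ) (q : ℤ) : Submodule B (KModule B r) where
  carrier := {f | ∀ s : Finset (Fin r), (s.card : ℤ) ≠ q → f s = 0}
  add_mem' := by
    intro f g hf hg s hs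
    simp [Pi.add_apply, hf s hs, hg s hs]
  zero_mem' := by intro s _; rfl
  smul_mem' := by
    intro c f hf s hs
    simp [Pi.smul_apply, hf s hs]

/-- Degree-`q` cycles of the Koszul complex `K(B; z)`. -/
def kcycles {B : Type*} [CommRing B] {r : ℕ} (z : Fin r → B) (q : ℤ) :
    Submodule B (KModule B r) :=
  kdeg B r q ⊓ LinearMap.ker (koszulD z)

/-- Degree-`q` boundaries of the Koszul complex `K(B; z)`. -/
def kbdries {B : Type*} [CommRing B] {r : ℕ} (z : Fin r → B) (q : ℤ) :
    Submodule B (KModule B r) :=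
  Submodule.map (koszulD z) (kdeg B r (q + 1))

/-- The degree-`q` Koszul homology `H_q` of `K(B; z)`. -/
abbrev KH {B : Type*} [CommRing B] {r : ℕ} (z : Fin r → B) (q : ℤ) :=
  kcycles z q ⧸ (kbdries z q).comap (kcycles z q).subtype

universe u

section KoszulSplitting

/-- Every property of finsets of `Fin (r + 1)` may be checked on finsets avoiding `0` and on
finsets containing `0`. -/
theorem Fin.finset_succ_induction {r : ℕ} {p : Finset (Fin (r + 1)) → Prop}
    (h₀ : ∀ t : Finset (Fin r), p (t.map (Fin.succEmb r)))
    (h₁ : ∀ t : Finset (Fin r), p (insert 0 (t.map (Fin.succEmb r)))) (s) : p s := by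
  by_cases h : (0 : Fin (r + 1)) ∈ s
  · have : s = insert 0 ((Finset.univ.filter fun j : Fin r => j.succ ∈ s).map (Fin.succEmb r)) := by
      ext j
      refine Fin.cases ?_ (fun j => ?_) j <;> simp [h]
    rw [this]; exact h₁ _
  · have : s = (Finset.univ.filter fun j : Fin r => j.succ ∈ s).map (Fin.succEmb r) := by
      ext j
      refine Fin.cases ?_ (fun j => ?_) j <;> simp [h]
    rw [this]; exact h₀ _

variable {M : Type*}

/-- The components of a family indexed by finsets avoiding `0`. -/
def Koszul.fst {r : ℕ} (f : Finset (Fin (r + 1)) → M) (t : Finset (Fin r)) : M :=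
  f (t.map (Fin.succEmb r))

/-- The components of a family indexed by finsets containing `0`. -/
def Koszul.snd {r : ℕ} (f : Finset (Fin (r + 1)) → M) (t : Finset (Fin r)) : M :=
  f (insert 0 (t.map (Fin.succEmb r)))

open Koszul

theorem Koszul.ext {r : ℕ} {f g : Finset (Fin (r + 1)) → M} (h₀ : fst f = fst g)
    (h₁ : snd f = snd g) : f = g :=
  funext <| Fin.finset_succ_induction (congrFun h₀) (congrFun h₁)

theorem ksign_zero {B : Type*} [CommRing B] {r : ℕ} (t : Finset (Fin (r + 1))) :
    (ksign 0 t : B) = 1 := by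
  simp [ksign]

theorem ksign_succ_map {B : Type*} [CommRing B] {r : ℕ} (i : Fin r) (t : Finset (Fin r)) :
    (ksign i.succ (t.map (Fin.succEmb r)) : B) = ksign i t := by
  rw [ksign, ksign, Finset.filter_map, Finset.card_map]
  congr 2
  ext j
  rw [Finset.mem_filter, Finset.mem_filter]
  exact and_congr_right fun _ => Fin.succ_lt_succ_iff

theorem ksign_succ_insert {B : Type*} [CommRing B] {r : ℕ} (i : Fin r) (t : Finset (Fin r)) :
    (ksign i.succ (insert 0 (t.map (Fin.succEmb r))) : B) = -ksign i t := by
  rw [← ksign_succ_map i t, ksign, ksign, Finset.filter_insert, if_pos (Fin.succ_pos i),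
    Finset.card_insert_of_notMem (by simp), pow_succ]
  simp

theorem insert_succ_map {r : ℕ} (i : Fin r) (t : Finset (Fin r)) :
    insert i.succ (t.map (Fin.succEmb r)) = (insert i t).map (Fin.succEmb r) := by
  simp

theorem insert_succ_insert {r : ℕ} (i : Fin r) (t : Finset (Fin r)) :
    insert i.succ (insert 0 (t.map (Fin.succEmb r))) =
      insert 0 ((insert i t).map (Fin.succEmb r)) := by
  rw [Finset.insert_comm, insert_succ_map]

theorem sum_compl_eq {N : Type*} [AddCommMonoid N] {r : ℕ} (t : Finset (Fin r)) (g : Fin r → N) :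
    ∑ i ∈ tᶜ, g i = ∑ i, if i ∈ t then 0 else g i := by
  rw [Finset.sum_ite, Finset.sum_const_zero, zero_add]
  congr 1
  ext i
  simp

variable {k : Type*} [CommRing k] [AddCommGroup M] [Module k M]

/-- The Koszul differential of a family of endomorphisms of a module. -/
def kos {r : ℕ} (d : Fin r → Module.End k M) : Module.End k (Finset (Fin r) → M) where
  toFun f t := ∑ i ∈ tᶜ, (ksign i t : ℤ) • d i (f (insert i t))
  map_add' f g := by
    funext t
    simp [Finset.sum_add_distrib]
  map_smul' c f := by
    funext t
    simp [Finset.smul_sum, smul_comm c]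

theorem fst_kos {r : ℕ} (d : Fin (r + 1) → Module.End k M) (f : Finset (Fin (r + 1)) → M) :
    fst (kos d f) = kos (fun i => d i.succ) (fst f) + fun t => d 0 (snd f t) := by
  funext t
  simp only [fst, snd, kos, LinearMap.coe_mk, AddHom.coe_mk, Pi.add_apply, sum_compl_eq,
    Fin.sum_univ_succ, insert_succ_map, ksign_succ_map, ksign_zero]
  simp [add_comm]

theorem snd_kos {r : ℕ} (d : Fin (r + 1) → Module.End k M) (f : Finset (Fin (r + 1)) → M) :
    snd (kos d f) = -kos (fun i => d i.succ) (snd f) := by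
  funext t
  simp only [snd, kos, LinearMap.coe_mk, AddHom.coe_mk, Pi.neg_apply, sum_compl_eq,
    Fin.sum_univ_succ, insert_succ_insert, ksign_succ_insert, ← Finset.sum_neg_distrib]
  simp [apply_ite]

theorem kos_comp {r : ℕ} {N : Type*} [AddCommGroup N] [Module k N] {d : Fin r → Module.End k M}
    {d' : Fin r → Module.End k N} {g : M →ₗ[k] N} (h : ∀ i x, g (d i x) = d' i (g x))
    (f : Finset (Fin r) → M) : kos d' (fun t => g (f t)) = fun t => g (kos d f t) := by
  funext t
  simp [kos, h]

theorem kos_kos {r : ℕ} (d : Fin r → Module.End k M) (h : ∀ i j x, d i (d j x) = d j (d i x))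
    (f : Finset (Fin r) → M) : kos d (kos d f) = 0 := by
  induction r with
  | zero =>
    funext t
    have : tᶜ = ∅ := Subsingleton.elim _ _
    simp [kos, this]
  | succ r ih =>
    have ih' := ih (fun i => d i.succ) fun i j => h _ _
    refine Koszul.ext ?_ ?_
    · rw [fst_kos, fst_kos, snd_kos, map_add, ih', zero_add, kos_comp (h := fun i => h _ _)]
      funext t
      simp [fst]
    · rw [snd_kos, snd_kos, map_neg, ih']
      simp; rfl

end KoszulSplitting

section KoszulRing

open Koszul

variable {B : Type*} [CommRing B]

theorem koszulD_eq_kos {r : ℕ} (z : Fin r → B) (f : KModule B r) :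
    koszulD z f = kos (k := B) (fun i => LinearMap.mulLeft B (z i)) f := by
  funext t
  simp [koszulD, kos, ksign, mul_assoc]

theorem fst_koszulD {r : ℕ} (z : Fin (r + 1) → B) (f : KModule B (r + 1)) :
    fst (koszulD z f) = koszulD (fun i => z i.succ) (fst f) + z 0 • snd f := by
  simp only [koszulD_eq_kos, fst_kos]
  rfl

theorem snd_koszulD {r : ℕ} (z : Fin (r + 1) → B) (f : KModule B (r + 1)) :
    snd (koszulD z f) = -koszulD (fun i => z i.succ) (snd f) := by
  simp only [koszulD_eq_kos, snd_kos]

theorem fst_extMul {r : ℕ} (c : Fin (r + 1) → B) (f : KModule B (r + 1)) :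
    fst (extMul c f) = extMul (fun i => c i.succ) (fst f) := by
  funext t
  simp only [fst, extMul, LinearMap.coe_mk, AddHom.coe_mk, Finset.sum_map]
  refine Finset.sum_congr rfl fun i _ => ?_
  rw [Fin.coe_succEmb, ← Fin.coe_succEmb, ← Finset.map_erase, Fin.coe_succEmb, ksign_succ_map]

theorem snd_extMul {r : ℕ} (c : Fin (r + 1) → B) (f : KModule B (r + 1)) :
    snd (extMul c f) = c 0 • fst f - extMul (fun i => c i.succ) (snd f) := by
  funext t
  have h0 : (0 : Fin (r + 1)) ∉ t.map (Fin.succEmb r) := by simp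
  simp only [fst, snd, extMul, LinearMap.coe_mk, AddHom.coe_mk, Finset.sum_insert h0,
    Finset.sum_map, Pi.sub_apply, Pi.smul_apply, Finset.erase_insert h0, ksign_zero, one_mul,
    smul_eq_mul, sub_eq_add_neg, ← Finset.sum_neg_distrib]
  congr 1
  refine Finset.sum_congr rfl fun i _ => ?_
  rw [Finset.erase_insert_of_ne (by simpa using (Fin.succ_ne_zero i).symm), ← Finset.map_erase,
    Fin.coe_succEmb, ksign_succ_insert]
  ring

theorem Koszul.fst_add {r : ℕ} (f g : KModule B (r + 1)) : fst (f + g) = fst f + fst g := rfl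
theorem Koszul.snd_add {r : ℕ} (f g : KModule B (r + 1)) : snd (f + g) = snd f + snd g := rfl
theorem Koszul.fst_smul {r : ℕ} (b : B) (f : KModule B (r + 1)) : fst (b • f) = b • fst f := rfl
theorem Koszul.snd_smul {r : ℕ} (b : B) (f : KModule B (r + 1)) : snd (b • f) = b • snd f := rfl

theorem koszulD_koszulD {r : ℕ} (z : Fin r → B) (f : KModule B r) :
    koszulD z (koszulD z f) = 0 := by
  rw [koszulD_eq_kos, koszulD_eq_kos, kos_kos]
  intro i j x
  simp [mul_left_comm]

theorem koszulD_add_apply {r : ℕ} (z w : Fin r → B) (f : KModule B r) :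
    koszulD (z + w) f = koszulD z f + koszulD w f := by
  funext t
  simp [koszulD, mul_add, add_mul, Finset.sum_add_distrib]

theorem koszulD_anticomm {r : ℕ} (z w : Fin r → B) (f : KModule B r) :
    koszulD z (koszulD w f) = -koszulD w (koszulD z f) := by
  have h := koszulD_koszulD (z + w) f
  simp only [koszulD_add_apply, map_add, koszulD_koszulD, zero_add, add_zero] at h
  rw [add_comm] at h
  exact eq_neg_of_add_eq_zero_left (by rw [← h, add_comm])

/-- The graded Leibniz rule for the Koszul differential and exterior multiplication. -/
theorem koszulD_extMul {r : ℕ} (z c : Fin r → B) (f : KModule B r) :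
    koszulD z (extMul c f) + extMul c (koszulD z f) = (∑ i, c i * z i) • f := by
  induction r with
  | zero =>
    funext t
    have h : tᶜ = ∅ := Subsingleton.elim _ _
    have h' : t = ∅ := Subsingleton.elim _ _
    simp [koszulD, extMul, h']
  | succ r ih =>
    have ih' := ih (fun i => z i.succ) fun i => c i.succ
    refine Koszul.ext ?_ ?_
    · rw [fst_add, fst_koszulD, fst_extMul, snd_extMul, fst_extMul, fst_koszulD, fst_smul,
        Fin.sum_univ_succ, add_smul, ← ih', map_add, map_smul, smul_sub, smul_smul,
        mul_comm (c 0)]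
      abel
    · rw [snd_add, snd_koszulD, snd_extMul, snd_extMul, fst_koszulD, snd_koszulD, snd_smul,
        Fin.sum_univ_succ, add_smul, ← ih', map_sub, map_neg, map_smul, smul_add, smul_smul]
      abel

theorem extMul_extMul {r : ℕ} (c : Fin r → B) (f : KModule B r) :
    extMul c (extMul c f) = 0 := by
  induction r with
  | zero =>
    funext t
    have h' : t = ∅ := Subsingleton.elim _ _
    simp [extMul, h']
  | succ r ih =>
    refine Koszul.ext ?_ ?_
    · rw [fst_extMul, fst_extMul, ih]; rfl
    · rw [snd_extMul, fst_extMul, snd_extMul, map_sub, ih, map_smul]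
      simp; rfl

end KoszulRing

section DifferentialHomology

variable {k : Type*} [CommRing k]
variable {C C' Cl C₁ C₂ : Type*} [AddCommGroup C] [Module k C] [AddCommGroup C'] [Module k C']
  [AddCommGroup Cl] [Module k Cl] [AddCommGroup C₁] [Module k C₁] [AddCommGroup C₂] [Module k C₂]

/-- The homology of an endomorphism `D`, meaningful when `D ∘ D = 0`. -/
abbrev DHomology (D : Module.End k C) : Type _ :=
  LinearMap.ker D ⧸ (LinearMap.range D).comap (LinearMap.ker D).subtype

namespace DHomology

variable {D : Module.End k C} {D' : Module.End k C'}

/-- The class of a cycle. -/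
def mk (D : Module.End k C) (x : C) (hx : D x = 0) : DHomology D :=
  Submodule.Quotient.mk ⟨x, hx⟩

theorem mk_surjective (h : DHomology D) : ∃ x hx, mk D x hx = h := by
  obtain ⟨⟨x, hx⟩, rfl⟩ := Submodule.Quotient.mk_surjective _ h
  exact ⟨x, hx, rfl⟩

theorem mk_eq_mk {x y : C} {hx : D x = 0} {hy : D y = 0} :
    mk D x hx = mk D y hy ↔ ∃ v, D v = x - y :=
  Submodule.Quotient.eq _

theorem mk_eq_zero {x : C} {hx : D x = 0} : mk D x hx = 0 ↔ ∃ v, D v = x :=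
  Submodule.Quotient.mk_eq_zero _

theorem mk_add {x y : C} (hx : D x = 0) (hy : D y = 0) :
    mk D x hx + mk D y hy = mk D (x + y) (by rw [map_add, hx, hy, add_zero]) := rfl

/-- The map induced on homology by a linear map preserving cycles and boundaries. -/
def map (f : C →ₗ[k] C') (hz : ∀ x, D x = 0 → D' (f x) = 0)
    (hb : ∀ x, ∃ y, D' y = f (D x)) : DHomology D →ₗ[k] DHomology D' :=
  Submodule.mapQ _ _ (f.restrict (p := LinearMap.ker D) (q := LinearMap.ker D') hz) <| by
    rintro ⟨x, hx⟩ ⟨v, rfl⟩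
    exact hb v

@[simp]
theorem map_mk (f : C →ₗ[k] C') (hz : ∀ x, D x = 0 → D' (f x) = 0)
    (hb : ∀ x, ∃ y, D' y = f (D x)) (x : C) (hx : D x = 0) :
    map f hz hb (mk D x hx) = mk D' (f x) (hz x hx) := rfl

/-- Projectivity of homology passes to direct summands of a sum of two differential modules. -/
theorem projective_of_retract {D₁ : Module.End k C₁} {D₂ : Module.End k C₂}
    (i₁ : C →ₗ[k] C₁) (p₁ : C₁ →ₗ[k] C) (i₂ : C →ₗ[k] C₂) (p₂ : C₂ →ₗ[k] C)
    (hi₁ : ∀ x, D₁ (i₁ x) = i₁ (D x)) (hp₁ : ∀ x, D (p₁ x) = p₁ (D₁ x))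
    (hi₂ : ∀ x, D₂ (i₂ x) = i₂ (D x)) (hp₂ : ∀ x, D (p₂ x) = p₂ (D₂ x))
    (hid : ∀ x, p₁ (i₁ x) + p₂ (i₂ x) = x)
    [Module.Projective k (DHomology D₁)] [Module.Projective k (DHomology D₂)] :
    Module.Projective k (DHomology D) := by
  let I₁ : DHomology D →ₗ[k] DHomology D₁ :=
    map i₁ (fun x hx => by rw [hi₁, hx, map_zero]) fun x => ⟨_, hi₁ x⟩
  let I₂ : DHomology D →ₗ[k] DHomology D₂ :=
    map i₂ (fun x hx => by rw [hi₂, hx, map_zero]) fun x => ⟨_, hi₂ x⟩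
  let P₁ : DHomology D₁ →ₗ[k] DHomology D :=
    map p₁ (fun x hx => by rw [hp₁, hx, map_zero]) fun x => ⟨_, hp₁ x⟩
  let P₂ : DHomology D₂ →ₗ[k] DHomology D :=
    map p₂ (fun x hx => by rw [hp₂, hx, map_zero]) fun x => ⟨_, hp₂ x⟩
  refine Module.Projective.of_split (I₁.prod I₂) (P₁.coprod P₂) (LinearMap.ext fun h => ?_)
  obtain ⟨x, hx, rfl⟩ := mk_surjective h
  change P₁ (I₁ (mk D x hx)) + P₂ (I₂ (mk D x hx)) = mk D x hx
  simp only [I₁, I₂, P₁, P₂, map_mk, mk_add, hid]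

theorem projective_neg (D : Module.End k C) [Module.Projective k (DHomology D)] :
    Module.Projective k (DHomology (-D)) := by
  let I : DHomology (-D) →ₗ[k] DHomology D :=
    map .id (fun x hx => neg_eq_zero.1 hx) fun x => ⟨-x, map_neg D x⟩
  let P : DHomology D →ₗ[k] DHomology (-D) :=
    map .id (fun x hx => neg_eq_zero.2 hx) fun x => ⟨-x, by simp⟩
  refine Module.Projective.of_split I P (LinearMap.ext fun h => ?_)
  obtain ⟨x, hx, rfl⟩ := mk_surjective h
  rfl

/-- Suppose that `κ` and `π` identify the kernel and the cokernel of `δ` with one and the same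
differential module `C'`, and that `C'` is also the cokernel of an injective lift `δl` of `δ`.
Then the homology of the cone of `δ` is projective as soon as that of `C'` is. -/
theorem projective_cone {Dl δl : Module.End k Cl} {δ : Module.End k C}
    {E : Type*} [AddCommGroup E] [Module k E] {DE : Module.End k E}
    (e : E ≃ₗ[k] C × C)
    (he : ∀ x, e (DE x) = (D (e x).1 + δ (e x).2, -D (e x).2))
    (κ : C' →ₗ[k] C) (π : C →ₗ[k] C') (ρ : Cl →ₗ[k] C)
    (hD : ∀ x, D (D x) = 0) (hDl : ∀ x, Dl (Dl x) = 0)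
    (hδ : ∀ x, D (δ x) = δ (D x)) (hκ : ∀ x, D (κ x) = κ (D' x)) (hπ : ∀ x, D' (π x) = π (D x))
    (hδl : ∀ x, Dl (δl x) = δl (Dl x)) (hρ : ∀ x, D (ρ x) = ρ (Dl x))
    (hρδ : ∀ x, ρ (δl x) = δ (ρ x))
    (κ_inj : ∀ x, κ x = 0 → x = 0) (δκ : ∀ x, δ (κ x) = 0) (ker_δ : ∀ x, δ x = 0 → ∃ y, κ y = x)
    (πδ : ∀ x, π (δ x) = 0) (ker_π : ∀ x, π x = 0 → ∃ y, δ y = x)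
    (π_surj : ∀ x, ∃ y, π (ρ y) = x) (δl_inj : ∀ x, δl x = 0 → x = 0)
    (ker_πρ : ∀ x, π (ρ x) = 0 → ∃ y, δl y = x)
    [Module.Projective k (DHomology D')] : Module.Projective k (DHomology DE) := by
  have hE : ∀ u v, DE (e.symm (u, v)) = e.symm (D u + δ v, -D v) := fun u v => by
    rw [LinearEquiv.eq_symm_apply, he, LinearEquiv.apply_symm_apply]
  have lift : ∀ x, D' x = 0 → ∃ u v, π u = x ∧ D u + δ v = 0 ∧ D v = 0 := by
    intro x hx
    obtain ⟨zl, rfl⟩ := π_surj x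
    obtain ⟨wl, hw⟩ := ker_πρ (Dl zl) (by rw [← hρ, ← hπ, hx])
    refine ⟨ρ zl, -ρ wl, rfl, ?_, ?_⟩
    · rw [map_neg, ← hρδ, hw, hρ, add_neg_cancel]
    · rw [map_neg, hρ, δl_inj (Dl wl) (by rw [← hδl, hw, hDl]), map_zero, neg_zero]
  let α : DHomology D' →ₗ[k] DHomology DE :=
    map (e.symm.toLinearMap ∘ₗ LinearMap.inr k C C ∘ₗ κ)
      (fun x hx => by simp [hE, δκ, hκ, hx])
      (fun x => ⟨e.symm (0, -κ x), by simp [hE, δκ, hκ]⟩)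
  let β : DHomology DE →ₗ[k] DHomology D' :=
    map (π ∘ₗ LinearMap.fst k C C ∘ₗ e.toLinearMap)
      (fun x hx => by
        have h := congrArg Prod.fst ((he x).symm.trans (by rw [hx, map_zero]))
        simp only [Prod.fst_zero] at h
        simp only [LinearMap.comp_apply, LinearMap.fst_apply, LinearEquiv.coe_coe]
        rw [hπ, eq_neg_of_add_eq_zero_left h, map_neg, πδ, neg_zero])
      (fun x => ⟨π (e x).1, by simp [he, hπ, πδ]⟩)
  have α_inj : Function.Injective α := by
    refine (injective_iff_map_eq_zero α).2 fun h h0 => ?_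
    obtain ⟨z, hz, rfl⟩ := mk_surjective h
    obtain ⟨w, hw⟩ := mk_eq_zero.1 h0
    obtain ⟨⟨u, v⟩, rfl⟩ := e.symm.surjective w
    rw [hE] at hw
    have hw' := e.symm.injective hw
    obtain ⟨h1, h2⟩ := Prod.ext_iff.1 hw'
    simp only [LinearMap.comp_apply, LinearMap.inr_apply] at h1 h2
    obtain ⟨u', v', hu', h1', h2'⟩ := lift (π u) (by
      rw [hπ, eq_neg_of_add_eq_zero_left h1, map_neg, πδ, neg_zero])
    obtain ⟨c, hc⟩ := ker_π (u - u') (by rw [map_sub, hu', sub_self])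
    obtain ⟨b, hb⟩ := ker_δ (v - v' + D c) (by
      rw [map_add, map_sub, ← hδ, hc, map_sub, eq_neg_of_add_eq_zero_left h1,
        eq_neg_of_add_eq_zero_left h1']
      abel)
    refine mk_eq_zero.2 ⟨-b, ?_⟩
    rw [← sub_eq_zero]
    apply κ_inj
    replace h2 : -D v = κ z := h2
    rw [map_sub, ← h2, map_neg, map_neg, ← hκ, hb, map_add, map_sub, h2', hD]
    abel
  have hex : Function.Exact α β := by
    intro h
    constructor
    · intro h0
      obtain ⟨w, hw, rfl⟩ := mk_surjective h
      obtain ⟨b', hb'⟩ := mk_eq_zero.1 h0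
      obtain ⟨⟨u, v⟩, rfl⟩ := e.symm.surjective w
      obtain ⟨b, rfl⟩ : ∃ b, π b = b' := (π_surj b').imp' ρ fun _ => id
      replace hb' : D' (π b) = π (e (e.symm (u, v))).1 := hb'
      rw [LinearEquiv.apply_symm_apply, hπ] at hb'
      obtain ⟨c, hc⟩ := ker_π (u - D b) (by rw [map_sub, ← hb', sub_self])
      rw [hE, LinearEquiv.map_eq_zero_iff] at hw
      obtain ⟨h1, h2⟩ := Prod.ext_iff.1 hw
      simp only [Prod.fst_zero, Prod.snd_zero, neg_eq_zero] at h1 h2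
      obtain ⟨z, hz⟩ := ker_δ (v + D c) (by
        rw [map_add, ← hδ, hc, map_sub, hD, sub_zero, add_comm, h1])
      have hz' : D' z = 0 := κ_inj _ (by rw [← hκ, hz, map_add, h2, hD, add_zero])
      refine ⟨mk D' z hz', ?_⟩
      refine mk_eq_mk.2 ⟨e.symm (-b, -c), ?_⟩
      rw [hE]
      change _ = e.symm (0, κ z) - e.symm (u, v)
      rw [← map_sub]
      congr 1
      refine Prod.ext ?_ ?_
      · simp only [map_neg, hc, zero_sub, Prod.fst_sub]; abel
      · simp [hz]
    · rintro ⟨h, rfl⟩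
      obtain ⟨z, hz, rfl⟩ := mk_surjective h
      refine mk_eq_zero.2 ⟨0, ?_⟩
      change _ = π (e (e.symm (0, κ z))).1
      simp
  have β_surj : Function.Surjective β := by
    intro h
    obtain ⟨x, hx, rfl⟩ := mk_surjective h
    obtain ⟨u, v, rfl, h1, h2⟩ := lift x hx
    refine ⟨mk DE (e.symm (u, v)) (by rw [hE, h1, h2, neg_zero]; exact map_zero _), ?_⟩
    refine mk_eq_mk.2 ⟨0, ?_⟩
    simp
  obtain ⟨s, hs⟩ := Module.projective_lifting_property β LinearMap.id β_surj
  exact Module.Projective.of_equiv' (hex.splitSurjectiveEquiv α_inj ⟨s, hs⟩).1.symm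

end DHomology

end DifferentialHomology

section StrandModules

/-- A `k`-module with `r` commuting endomorphisms. -/
structure StrandModule (k : Type u) [CommRing k] (r : ℕ) where
  /-- The underlying module. -/
  carrier : Type u
  [grp : AddCommGroup carrier]
  [mod : Module k carrier]
  /-- The commuting endomorphisms. -/
  y : Fin r → Module.End k carrier
  comm : ∀ i j x, y i (y j x) = y j (y i x)

namespace StrandModule

variable {k : Type u} [CommRing k] {r m : ℕ}

instance : CoeSort (StrandModule k r) (Type u) := ⟨carrier⟩

instance (A : StrandModule k r) : AddCommGroup A := A.grp

instance (A : StrandModule k r) : Module k A := A.mod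

/-- Linear maps commuting with the distinguished endomorphisms. -/
structure Hom (A B : StrandModule k r) where
  /-- The underlying linear map. -/
  map : A →ₗ[k] B
  comm : ∀ j x, map (A.y j x) = B.y j (map x)

/-- `A` is a direct summand of `B ⊕ C`. -/
def IsSummand (A B C : StrandModule k r) : Prop :=
  ∃ (i₁ : Hom A B) (p₁ : Hom B A) (i₂ : Hom A C) (p₂ : Hom C A),
    ∀ x, p₁.map (i₁.map x) + p₂.map (i₂.map x) = x

/-- The differential module computing the Koszul homology of the operators `ξ j - y j`. -/
def koszul (ξ : Fin r → k) (A : StrandModule k r) : Module.End k (Finset (Fin r) → A) :=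
  kos fun j => ξ j • 1 - A.y j

theorem koszul_comp (ξ : Fin r → k) {A B : StrandModule k r} (g : Hom A B)
    (f : Finset (Fin r) → A) :
    koszul ξ B (g.map.compLeft _ f) = g.map.compLeft _ (koszul ξ A f) :=
  kos_comp (fun j x => by simp [g.comm]) f

/-- The Koszul homology of the operators `ξ j - y j` is projective. -/
def ProjectiveHomology (ξ : Fin r → k) (A : StrandModule k r) : Prop :=
  Module.Projective k (DHomology (A.koszul ξ))

theorem IsSummand.projectiveHomology {ξ : Fin r → k} {A B C : StrandModule k r}
    (h : IsSummand A B C) (hB : B.ProjectiveHomology ξ) (hC : C.ProjectiveHomology ξ) :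
    A.ProjectiveHomology ξ := by
  obtain ⟨i₁, p₁, i₂, p₂, hid⟩ := h
  have : Module.Projective k (DHomology (B.koszul ξ)) := hB
  have : Module.Projective k (DHomology (C.koszul ξ)) := hC
  refine DHomology.projective_of_retract (i₁.map.compLeft _) (p₁.map.compLeft _)
    (i₂.map.compLeft _) (p₂.map.compLeft _) (koszul_comp ξ i₁) (koszul_comp ξ p₁)
    (koszul_comp ξ i₂) (koszul_comp ξ p₂) fun x => funext fun t => hid _

/-- The difference of the operators on the strands `i` and `i + 1`. -/
def root (A : StrandModule k (m + 1)) (i : Fin m) : Module.End k A :=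
  A.y i.castSucc - A.y i.succ

theorem y_root (A : StrandModule k (m + 1)) (i : Fin m) (j : Fin (m + 1)) (x : A) :
    A.y j (A.root i x) = A.root i (A.y j x) := by
  simp [root, A.comm j]

theorem root_root (A : StrandModule k (m + 1)) (i j : Fin m) (x : A) :
    A.root i (A.root j x) = A.root j (A.root i x) := by
  rw [root, LinearMap.sub_apply, y_root, y_root, LinearMap.sub_apply, map_sub]

/-- The effect on the strand `j` of the crossing of the strands `i` and `i + 1`. -/
def coef (i : Fin m) (j : Fin (m + 1)) : ℤ :=
  (if j = i.castSucc then 1 else 0) - if j = i.succ then 1 else 0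

/-- Adjoining to `A` an element `δ` with `δ (δ + y i - y (i + 1)) = 0`, and replacing `y i` and
`y (i + 1)` by `y i + δ` and `y (i + 1) - δ`. The pair `(u, v)` stands for `u + v δ`. -/
def step (i : Fin m) (A : StrandModule k (m + 1)) : StrandModule k (m + 1) where
  carrier := A × A
  y j := (A.y j ∘ₗ LinearMap.fst k A A).prod (A.y j ∘ₗ LinearMap.snd k A A +
    coef i j • (LinearMap.fst k A A - A.root i ∘ₗ LinearMap.snd k A A))
  comm i' j x := by
    refine Prod.ext (A.comm i' j _) ?_
    simp only [LinearMap.prod_apply, Function.prod_apply, LinearMap.add_apply, LinearMap.smul_apply,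
      LinearMap.comp_apply, LinearMap.sub_apply, LinearMap.fst_apply, LinearMap.snd_apply,
      map_add, map_sub, map_zsmul, y_root, A.comm i' j, smul_add, smul_sub,
      smul_comm (coef i i') (coef i j)]
    abel

section Components

variable (i : Fin m) (A : StrandModule k (m + 1)) {N : Type*} [AddCommGroup N] [Module k N]

/-- The constant coefficient. -/
def lo : A.step i →ₗ[k] A := LinearMap.fst k A A

/-- The coefficient of `δ`. -/
def hi : A.step i →ₗ[k] A := LinearMap.snd k A A

variable {i A}

/-- The linear map with prescribed coefficients. -/
def pair (f g : N →ₗ[k] A) : N →ₗ[k] A.step i := f.prod g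

theorem step_ext {x y : A.step i} (h₀ : lo i A x = lo i A y) (h₁ : hi i A x = hi i A y) : x = y :=
  Prod.ext h₀ h₁

@[simp]
theorem lo_pair (f g : N →ₗ[k] A) (x : N) : lo i A (pair f g x) = f x := rfl

@[simp]
theorem hi_pair (f g : N →ₗ[k] A) (x : N) : hi i A (pair f g x) = g x := rfl

theorem lo_y (j : Fin (m + 1)) (x : A.step i) : lo i A ((A.step i).y j x) = A.y j (lo i A x) := rfl

theorem hi_y (j : Fin (m + 1)) (x : A.step i) : hi i A ((A.step i).y j x) =
    A.y j (hi i A x) + coef i j • (lo i A x - A.root i (hi i A x)) := rfl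

theorem lo_root (j : Fin m) (x : A.step i) :
    lo i A ((A.step i).root j x) = A.root j (lo i A x) := by
  simp [root, lo_y]

theorem hi_root (j : Fin m) (x : A.step i) : hi i A ((A.step i).root j x) =
    A.root j (hi i A x) +
      (coef i j.castSucc - coef i j.succ) • (lo i A x - A.root i (hi i A x)) := by
  rw [root, LinearMap.sub_apply, map_sub, hi_y, hi_y, sub_smul, root.eq_1 A j,
    LinearMap.sub_apply]
  abel

theorem hi_root_self (x : A.step i) : hi i A ((A.step i).root i x) =
    lo i A x + lo i A x - A.root i (hi i A x) := by
  have : coef i i.castSucc - coef i i.succ = 2 := by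
    simp [coef, Fin.ext_iff]
  rw [hi_root, this, two_smul]
  abel

theorem hi_root_adjacent {j : Fin m} (h : (i : ℕ) + 1 = j ∨ (j : ℕ) + 1 = i) (x : A.step i) :
    hi i A ((A.step i).root j x) =
      A.root j (hi i A x) + A.root i (hi i A x) - lo i A x := by
  have : coef i j.castSucc - coef i j.succ = -1 := by
    simp only [coef, Fin.ext_iff, Fin.val_castSucc, Fin.val_succ]
    split_ifs <;> omega
  rw [hi_root, this, neg_one_smul]
  abel

theorem hi_root_distant {j : Fin m} (h : (i : ℕ) + 1 < j ∨ (j : ℕ) + 1 < i) (x : A.step i) :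
    hi i A ((A.step i).root j x) = A.root j (hi i A x) := by
  have : coef i j.castSucc - coef i j.succ = 0 := by
    simp only [coef, Fin.ext_iff, Fin.val_castSucc, Fin.val_succ]
    split_ifs <;> omega
  rw [hi_root, this, zero_smul, add_zero]

end Components

/-- The functoriality of `step`. -/
def Hom.step (i : Fin m) {A B : StrandModule k (m + 1)} (f : Hom A B) :
    Hom (A.step i) (B.step i) where
  map := pair (f.map ∘ₗ lo i A) (f.map ∘ₗ hi i A)
  comm j x := by
    refine step_ext ?_ ?_ <;> simp [lo_y, hi_y, f.comm, root]

theorem IsSummand.step (i : Fin m) {A B C : StrandModule k (m + 1)} (h : IsSummand A B C) :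
    IsSummand (A.step i) (B.step i) (C.step i) := by
  obtain ⟨i₁, p₁, i₂, p₂, hid⟩ := h
  exact ⟨i₁.step i, p₁.step i, i₂.step i, p₂.step i, fun x => Prod.ext (hid _) (hid _)⟩

/-- The iteration of `step` along a word. -/
def act (W : List (Fin m)) (A : StrandModule k (m + 1)) : StrandModule k (m + 1) :=
  W.foldl (fun A i => A.step i) A

theorem act_append (V W : List (Fin m)) (A : StrandModule k (m + 1)) :
    act (V ++ W) A = act W (act V A) :=
  List.foldl_append

theorem IsSummand.act (W : List (Fin m)) {A B C : StrandModule k (m + 1)} (h : IsSummand A B C) :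
    IsSummand (A.act W) (B.act W) (C.act W) := by
  induction W generalizing A B C with
  | nil => exact h
  | cons i W ih => exact ih (h.step i)

/-- The zero morphism. -/
def Hom.zero (A B : StrandModule k r) : Hom A B := ⟨0, by simp⟩

theorem isSummand_step_step_self (i : Fin m) (A : StrandModule k (m + 1)) :
    IsSummand ((A.step i).step i) (A.step i) (A.step i) := by
  let a := A.root i
  let u₀ := lo i A ∘ₗ lo i (A.step i)
  let u₁ := hi i A ∘ₗ lo i (A.step i)
  let u₂ := lo i A ∘ₗ hi i (A.step i)
  let u₃ := hi i A ∘ₗ hi i (A.step i)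
  refine ⟨⟨pair u₀ u₂, fun j x => ?_⟩, ⟨pair .id (pair (hi i A) 0), fun j x => ?_⟩,
    ⟨pair (u₁ - u₂ + a ∘ₗ u₃) u₃, fun j x => ?_⟩,
    ⟨pair (pair 0 (lo i A - a ∘ₗ hi i A)) (pair 0 (hi i A)), fun j x => ?_⟩, fun x => ?_⟩
  all_goals
    refine step_ext ?_ ?_ <;> try refine step_ext ?_ ?_
  all_goals
    simp only [u₀, u₁, u₂, u₃, a, lo_pair, hi_pair, lo_y, hi_y, lo_root, hi_root_self, map_add,
      map_sub, map_zero, map_zsmul, LinearMap.comp_apply, LinearMap.add_apply, LinearMap.sub_apply,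
      LinearMap.id_apply, LinearMap.zero_apply, y_root, smul_add, smul_sub, smul_zero]
    try abel

theorem isSummand_step_step_distant {i j : Fin m} (h : (i : ℕ) + 1 < j ∨ (j : ℕ) + 1 < i)
    (A : StrandModule k (m + 1)) :
    IsSummand ((A.step i).step j) ((A.step j).step i) ((A.step j).step i) := by
  refine ⟨⟨pair (pair (lo i A ∘ₗ lo j (A.step i)) (lo i A ∘ₗ hi j (A.step i)))
      (pair (hi i A ∘ₗ lo j (A.step i)) (hi i A ∘ₗ hi j (A.step i))), fun t x => ?_⟩,
    ⟨pair (pair (lo j A ∘ₗ lo i (A.step j)) (lo j A ∘ₗ hi i (A.step j)))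
      (pair (hi j A ∘ₗ lo i (A.step j)) (hi j A ∘ₗ hi i (A.step j))), fun t x => ?_⟩,
    .zero _ _, .zero _ _, fun x => ?_⟩
  all_goals
    refine step_ext ?_ ?_ <;> refine step_ext ?_ ?_
  all_goals
    simp only [Hom.zero, lo_pair, hi_pair, lo_y, hi_y, lo_root, hi_root_distant h,
      hi_root_distant h.symm, map_add, map_sub, map_zero, map_zsmul, LinearMap.comp_apply,
      LinearMap.zero_apply, smul_sub, add_zero]
    try abel

set_option maxHeartbeats 1000000 in
theorem isSummand_step_step_step {s t : Fin m} (h : (s : ℕ) + 1 = t ∨ (t : ℕ) + 1 = s)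
    (A : StrandModule k (m + 1)) :
    IsSummand (((A.step s).step t).step s) (((A.step t).step s).step t) (A.step s) := by
  have braid : ∀ {s t : Fin m}, ((s : ℕ) + 1 = t ∨ (t : ℕ) + 1 = s) →
      ∃ f : Hom (((A.step s).step t).step s) (((A.step t).step s).step t), ∀ x,
        let a := A.root s
        let b := A.root t
        let u₀ := lo s A (lo t (A.step s) (lo s ((A.step s).step t) x))
        let u₁ := hi s A (lo t (A.step s) (lo s ((A.step s).step t) x))
        let u₂ := lo s A (hi t (A.step s) (lo s ((A.step s).step t) x))
        let u₃ := hi s A (hi t (A.step s) (lo s ((A.step s).step t) x))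
        let u₄ := lo s A (lo t (A.step s) (hi s ((A.step s).step t) x))
        let u₅ := hi s A (lo t (A.step s) (hi s ((A.step s).step t) x))
        let u₆ := lo s A (hi t (A.step s) (hi s ((A.step s).step t) x))
        let u₇ := hi s A (hi t (A.step s) (hi s ((A.step s).step t) x))
        lo t A (lo s (A.step t) (lo t ((A.step t).step s) (f.map x))) =
          u₀ + b u₁ - b u₄ + a (b u₅) ∧
        hi t A (lo s (A.step t) (lo t ((A.step t).step s) (f.map x))) = u₁ + u₂ - u₄ + a u₅ ∧
        lo t A (hi s (A.step t) (lo t ((A.step t).step s) (f.map x))) = u₄ + b u₅ ∧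
        hi t A (hi s (A.step t) (lo t ((A.step t).step s) (f.map x))) = u₅ + u₆ ∧
        lo t A (lo s (A.step t) (hi t ((A.step t).step s) (f.map x))) = u₁ + u₂ - u₄ + a u₅ ∧
        hi t A (lo s (A.step t) (hi t ((A.step t).step s) (f.map x))) = 0 ∧
        lo t A (hi s (A.step t) (hi t ((A.step t).step s) (f.map x))) = u₃ + u₅ ∧
        hi t A (hi s (A.step t) (hi t ((A.step t).step s) (f.map x))) = u₇ := by
    intro s t h
    let a := A.root s
    let b := A.root t
    let u₀ := lo s A ∘ₗ lo t (A.step s) ∘ₗ lo s ((A.step s).step t)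
    let u₁ := hi s A ∘ₗ lo t (A.step s) ∘ₗ lo s ((A.step s).step t)
    let u₂ := lo s A ∘ₗ hi t (A.step s) ∘ₗ lo s ((A.step s).step t)
    let u₃ := hi s A ∘ₗ hi t (A.step s) ∘ₗ lo s ((A.step s).step t)
    let u₄ := lo s A ∘ₗ lo t (A.step s) ∘ₗ hi s ((A.step s).step t)
    let u₅ := hi s A ∘ₗ lo t (A.step s) ∘ₗ hi s ((A.step s).step t)
    let u₆ := lo s A ∘ₗ hi t (A.step s) ∘ₗ hi s ((A.step s).step t)
    let u₇ := hi s A ∘ₗ hi t (A.step s) ∘ₗ hi s ((A.step s).step t)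
    refine ⟨⟨pair (pair (pair (u₀ + b ∘ₗ u₁ - b ∘ₗ u₄ + a ∘ₗ b ∘ₗ u₅) (u₁ + u₂ - u₄ + a ∘ₗ u₅))
      (pair (u₄ + b ∘ₗ u₅) (u₅ + u₆))) (pair (pair (u₁ + u₂ - u₄ + a ∘ₗ u₅) 0)
      (pair (u₃ + u₅) u₇)), fun j x => ?_⟩,
      fun x => ⟨rfl, rfl, rfl, rfl, rfl, rfl, rfl, rfl⟩⟩
    refine step_ext ?_ ?_ <;> refine step_ext ?_ ?_ <;> refine step_ext ?_ ?_
    all_goals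
      simp only [u₀, u₁, u₂, u₃, u₄, u₅, u₆, u₇, a, b, lo_pair, hi_pair, lo_y, hi_y, lo_root,
        hi_root_self, hi_root_adjacent h, hi_root_adjacent h.symm, map_add, map_sub, map_zero,
        map_zsmul, LinearMap.comp_apply, LinearMap.add_apply, LinearMap.sub_apply,
        LinearMap.zero_apply, y_root, smul_add, smul_sub, smul_zero, root_root A t s]
      abel
  obtain ⟨f, hf⟩ := braid h
  obtain ⟨g, hg⟩ := braid h.symm
  let a := A.root s
  let b := A.root t
  let u := lo s A
  let v := hi s A
  refine ⟨f, g, ⟨pair (v ∘ₗ lo t (A.step s) ∘ₗ lo s ((A.step s).step t)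
      - u ∘ₗ lo t (A.step s) ∘ₗ hi s ((A.step s).step t)
      + a ∘ₗ v ∘ₗ lo t (A.step s) ∘ₗ hi s ((A.step s).step t))
      (v ∘ₗ lo t (A.step s) ∘ₗ hi s ((A.step s).step t)), fun j x => ?_⟩,
    ⟨pair (pair (pair (-(b ∘ₗ u)) (u - b ∘ₗ v - a ∘ₗ v)) (pair (-u) (-v)))
       (pair (pair (-(b ∘ₗ v)) v) (pair (-v) 0)), fun j x => ?_⟩, fun x => ?_⟩
  · refine step_ext ?_ ?_
    all_goals
      simp only [u, v, a, lo_pair, hi_pair, lo_y, hi_y, lo_root, hi_root_self, map_add, map_sub,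
        map_zsmul, LinearMap.comp_apply, LinearMap.add_apply, LinearMap.sub_apply, y_root,
        smul_add, smul_sub]
      abel
  · refine step_ext ?_ ?_ <;> refine step_ext ?_ ?_ <;> refine step_ext ?_ ?_
    all_goals
      simp only [u, v, a, b, lo_pair, hi_pair, lo_y, hi_y, lo_root, LinearMap.neg_apply, map_neg,
        hi_root_self, hi_root_adjacent h, hi_root_adjacent h.symm, map_add, map_sub, map_zero,
        map_zsmul, LinearMap.comp_apply, LinearMap.sub_apply, smul_neg,
        LinearMap.zero_apply, y_root, smul_add, smul_sub, smul_zero, root_root A t s]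
      try abel
  · obtain ⟨g₀, g₁, g₂, g₃, g₄, g₅, g₆, g₇⟩ := hg (f.map x)
    obtain ⟨f₀, f₁, f₂, f₃, f₄, f₅, f₆, f₇⟩ := hf x
    refine step_ext ?_ ?_ <;> refine step_ext ?_ ?_ <;> refine step_ext ?_ ?_
    all_goals
      simp only [u, v, a, b, lo_pair, hi_pair, map_add, map_sub, map_zero, LinearMap.neg_apply,
        LinearMap.comp_apply, LinearMap.add_apply, LinearMap.sub_apply, LinearMap.zero_apply,
        g₀, g₁, g₂, g₃, g₄, g₅, g₆, g₇, f₀, f₁, f₂, f₃, f₄, f₅, f₆, f₇, root_root A t s]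
      abel

end StrandModule

end StrandModules

section Destabilization

namespace StrandModule

variable {k : Type u} [CommRing k] {r m : ℕ}

theorem coef_succ_succ (i : Fin m) (j : Fin (m + 1)) : coef i.succ j.succ = coef i j := by
  simp [coef, Fin.ext_iff]

theorem coef_succ_zero (i : Fin m) : coef i.succ 0 = 0 := by
  simp [coef, Fin.ext_iff]

/-- The module obtained by forgetting the strand `0`. -/
def tail (A : StrandModule k (r + 1)) : StrandModule k r where
  carrier := A
  y j := A.y j.succ
  comm _ _ := A.comm _ _

theorem tail_step (i : Fin m) (A : StrandModule k (m + 2)) :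
    (A.step i.succ).tail = A.tail.step i := by
  simp only [tail, step, coef_succ_succ]
  rfl

theorem tail_act (W : List (Fin m)) (A : StrandModule k (m + 2)) :
    (A.act (W.map Fin.succ)).tail = A.tail.act W := by
  induction W generalizing A with
  | nil => rfl
  | cons i W ih =>
    rw [← show (A.tail.step i).act W = A.tail.act (i :: W) from rfl, ← tail_step]
    exact ih _

theorem y_zero_step {ξ₀ : k} {A : StrandModule k (m + 2)} (h : ∀ x, A.y 0 x = ξ₀ • x) (i : Fin m)
    (x : A.step i.succ) : (A.step i.succ).y 0 x = ξ₀ • x := by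
  refine step_ext ?_ ?_
  · rw [lo_y, h, map_smul]
  · rw [hi_y, h, map_smul, coef_succ_zero, zero_smul, add_zero]

theorem y_zero_act {ξ₀ : k} {A : StrandModule k (m + 2)} (h : ∀ x, A.y 0 x = ξ₀ • x)
    (W : List (Fin m)) (x : A.act (W.map Fin.succ)) :
    (A.act (W.map Fin.succ)).y 0 x = ξ₀ • x := by
  induction W generalizing A with
  | nil => exact h x
  | cons i W ih => exact ih (y_zero_step h i) x

/-- Splitting the Koszul complex according to whether the generator `0` occurs. -/
def splitEquiv (M : Type*) [AddCommGroup M] [Module k M] (r : ℕ) :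
    (Finset (Fin (r + 1)) → M) ≃ₗ[k] (Finset (Fin r) → M) × (Finset (Fin r) → M) :=
  LinearEquiv.ofBijective
    { toFun f := (Koszul.fst f, Koszul.snd f)
      map_add' _ _ := rfl
      map_smul' _ _ := rfl } <| by
    refine ⟨fun f g h => Koszul.ext (congrArg Prod.fst h) (congrArg Prod.snd h), fun ⟨u, v⟩ => ?_⟩
    refine ⟨fun s => (if 0 ∈ s then v else u) (Finset.univ.filter fun j => j.succ ∈ s), ?_⟩
    refine Prod.ext (funext fun t => ?_) (funext fun t => ?_)
    · change (if _ then v else u) _ = u t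
      simp
    · change (if _ then v else u) _ = v t
      simp

theorem splitEquiv_koszul (ξ : Fin (r + 1) → k) (A : StrandModule k (r + 1))
    (f : Finset (Fin (r + 1)) → A) :
    letI D : Module.End k (Finset (Fin r) → A) := kos fun j => ξ j.succ • 1 - A.y j.succ
    splitEquiv (k := k) A r (A.koszul ξ f) =
      (D (splitEquiv (k := k) A r f).1 +
        (ξ 0 • (1 : Module.End k A) - A.y 0).compLeft _ (splitEquiv (k := k) A r f).2,
      -D (splitEquiv (k := k) A r f).2) :=
  Prod.ext (fst_kos _ _) (snd_kos _ _)

theorem koszul_koszul (ξ : Fin r → k) (A : StrandModule k r) (f : Finset (Fin r) → A) :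
    A.koszul ξ (A.koszul ξ f) = 0 :=
  kos_kos _ (fun i j x => by
    simp only [LinearMap.sub_apply, LinearMap.smul_apply, Module.End.one_apply, map_sub, map_smul,
      A.comm i j, smul_sub, smul_comm (ξ i) (ξ j)]
    abel) f

theorem projectiveHomology_of_tail {ξ : Fin (r + 1) → k} {A : StrandModule k (r + 1)}
    (h : ∀ x, A.y 0 x = ξ 0 • x) (hA : A.tail.ProjectiveHomology fun j => ξ j.succ) :
    A.ProjectiveHomology ξ := by
  let D : Module.End k (Finset (Fin r) → A) := kos fun j => ξ j.succ • 1 - A.y j.succ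
  let e := splitEquiv (k := k) A r
  have he : ∀ f, e (A.koszul ξ f) = (D (e f).1, -D (e f).2) := fun f => by
    rw [splitEquiv_koszul]
    refine Prod.ext ?_ rfl
    change D (e f).1 + _ = D (e f).1
    rw [add_eq_left]
    funext t
    simp [h]
  have he' : ∀ x y, A.koszul ξ (e.symm (x, y)) = e.symm (D x, -D y) := fun x y => by
    rw [LinearEquiv.eq_symm_apply, he, LinearEquiv.apply_symm_apply]
  have : Module.Projective k (DHomology D) := hA
  have : Module.Projective k (DHomology (-D)) :=
    DHomology.projective_neg D
  refine DHomology.projective_of_retract (D₁ := D) (D₂ := -D)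
    (LinearMap.fst k _ _ ∘ₗ e.toLinearMap) (e.symm.toLinearMap ∘ₗ LinearMap.inl k _ _)
    (LinearMap.snd k _ _ ∘ₗ e.toLinearMap) (e.symm.toLinearMap ∘ₗ LinearMap.inr k _ _)
    ?_ ?_ ?_ ?_ ?_
  · intro x; simp [he]
  · intro x; simp [he']
  · intro x; simp [he]
  · intro x; simp [he']
  · intro x
    simp [← map_add]

/-- The data identifying the cone of `ξ₀ - y 0` on `B` with an extension of `N` by itself, along
with an injective lift of that operator. -/
structure Destabilization (ξ₀ : k) (B : StrandModule k (r + 1)) (N : StrandModule k r) where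
  /-- A cover of `B`. -/
  lift : StrandModule k r
  /-- The lift of `ξ₀ - y 0`. -/
  δ : Hom lift lift
  /-- The projection of the cover. -/
  ρ : lift →ₗ[k] B
  /-- The kernel of `ξ₀ - y 0`. -/
  κ : N →ₗ[k] B
  /-- The cokernel of `ξ₀ - y 0`. -/
  π : B →ₗ[k] N
  ρ_y : ∀ j x, ρ (lift.y j x) = B.y j.succ (ρ x)
  κ_y : ∀ j x, κ (N.y j x) = B.y j.succ (κ x)
  π_y : ∀ j x, π (B.y j.succ x) = N.y j (π x)
  ρ_δ : ∀ x, ρ (δ.map x) = ξ₀ • ρ x - B.y 0 (ρ x)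
  κ_inj : ∀ x, κ x = 0 → x = 0
  κ_δ : ∀ x, ξ₀ • κ x - B.y 0 (κ x) = 0
  exists_κ : ∀ x, ξ₀ • x - B.y 0 x = 0 → ∃ z, κ z = x
  π_δ : ∀ x, π (ξ₀ • x - B.y 0 x) = 0
  exists_y : ∀ x, π x = 0 → ∃ z, ξ₀ • z - B.y 0 z = x
  exists_π : ∀ x, ∃ z, π (ρ z) = x
  δ_inj : ∀ x, δ.map x = 0 → x = 0
  exists_δ : ∀ x, π (ρ x) = 0 → ∃ z, δ.map z = x

namespace Destabilization

theorem projectiveHomology {ξ : Fin (r + 1) → k} {B : StrandModule k (r + 1)} {N : StrandModule k r}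
    (d : Destabilization (ξ 0) B N) (hN : N.ProjectiveHomology fun j => ξ j.succ) :
    B.ProjectiveHomology ξ := by
  have : Module.Projective k (DHomology (N.koszul fun j => ξ j.succ)) := hN
  let ρ : Hom d.lift B.tail := ⟨d.ρ, d.ρ_y⟩
  let κ : Hom N B.tail := ⟨d.κ, d.κ_y⟩
  let π : Hom B.tail N := ⟨d.π, d.π_y⟩
  let δ : Hom B.tail B.tail := ⟨ξ 0 • (1 : Module.End k B) - B.y 0, fun j (x : B) => by
    change (ξ 0 • (1 : Module.End k B) - B.y 0) (B.y j.succ x) =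
      B.y j.succ ((ξ 0 • (1 : Module.End k B) - B.y 0) x)
    simp [B.comm 0]⟩
  refine DHomology.projective_cone (Dl := d.lift.koszul fun j => ξ j.succ) (splitEquiv (k := k) B r)
    (splitEquiv_koszul ξ B) (D' := N.koszul fun j => ξ j.succ) (δl := d.δ.map.compLeft _)
    (κ.map.compLeft _) (π.map.compLeft _) (ρ.map.compLeft _)
    (koszul_koszul (fun j => ξ j.succ) B.tail) (koszul_koszul _ _)
    (koszul_comp _ δ) (koszul_comp _ κ) (koszul_comp _ π) (koszul_comp _ d.δ) (koszul_comp _ ρ)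
    ?_ ?_ ?_ ?_ ?_ ?_ ?_ ?_ ?_
  · exact fun x => funext fun t => d.ρ_δ _
  · exact fun x h => funext fun t => d.κ_inj _ (congrFun h t)
  · exact fun x => funext fun t => d.κ_δ _
  · intro x h
    choose z hz using fun t => d.exists_κ (x t) (congrFun h t)
    exact ⟨z, funext hz⟩
  · exact fun x => funext fun t => d.π_δ _
  · intro x h
    choose z hz using fun t => d.exists_y (x t) (congrFun h t)
    exact ⟨z, funext hz⟩
  · intro x
    choose z hz using fun t => d.exists_π (x t)
    exact ⟨z, funext hz⟩
  · exact fun x h => funext fun t => d.δ_inj _ (congrFun h t)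
  · intro x h
    choose z hz using fun t => d.exists_δ (x t) (congrFun h t)
    exact ⟨z, funext hz⟩

/-- Crossings away from the strand `0` preserve the data. -/
def step (i : Fin m) {ξ₀ : k} {B : StrandModule k (m + 2)} {N : StrandModule k (m + 1)}
    (d : Destabilization ξ₀ B N) : Destabilization ξ₀ (B.step i.succ) (N.step i) := by
  have hδ : ∀ x : B.step i.succ, ∀ y : B.step i.succ, ξ₀ • x - (B.step i.succ).y 0 x = y ↔
      ξ₀ • lo i.succ B x - B.y 0 (lo i.succ B x) = lo i.succ B y ∧
      ξ₀ • hi i.succ B x - B.y 0 (hi i.succ B x) = hi i.succ B y := fun x y => by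
    constructor
    · rintro rfl
      simp [lo_y, hi_y, coef_succ_zero]
    · rintro ⟨h₀, h₁⟩
      refine step_ext ?_ ?_
      · rw [← h₀, map_sub, map_smul, lo_y]
      · rw [← h₁, map_sub, map_smul, hi_y, coef_succ_zero, zero_smul, add_zero]
  exact
  { lift := d.lift.step i
    δ := d.δ.step i
    ρ := pair (d.ρ ∘ₗ lo i _) (d.ρ ∘ₗ hi i _)
    κ := pair (d.κ ∘ₗ lo i _) (d.κ ∘ₗ hi i _)
    π := pair (d.π ∘ₗ lo i.succ _) (d.π ∘ₗ hi i.succ _)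
    ρ_y j x := by
      refine step_ext ?_ ?_ <;> simp [lo_y, hi_y, d.ρ_y, root, coef_succ_succ]
    κ_y j x := by
      refine step_ext ?_ ?_ <;> simp [lo_y, hi_y, d.κ_y, root, coef_succ_succ]
    π_y j x := by
      refine step_ext ?_ ?_ <;> simp [lo_y, hi_y, d.π_y, root, coef_succ_succ]
    ρ_δ x := ((hδ _ _).2 ⟨(d.ρ_δ _).symm, (d.ρ_δ _).symm⟩).symm
    κ_inj x h := step_ext (d.κ_inj _ (congrArg (lo i.succ B) h))
      (d.κ_inj _ (congrArg (hi i.succ B) h))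
    κ_δ x := (hδ _ _).2 ⟨d.κ_δ _, d.κ_δ _⟩
    exists_κ x h := by
      obtain ⟨h₀, h₁⟩ := (hδ _ _).1 h
      obtain ⟨z₀, hz₀⟩ := d.exists_κ _ h₀
      obtain ⟨z₁, hz₁⟩ := d.exists_κ _ h₁
      exact ⟨(z₀, z₁), step_ext hz₀ hz₁⟩
    π_δ x := by
      obtain ⟨h₀, h₁⟩ := (hδ x _).1 rfl
      refine step_ext ?_ ?_
      · rw [lo_pair, LinearMap.comp_apply, ← h₀, d.π_δ, map_zero]
      · rw [hi_pair, LinearMap.comp_apply, ← h₁, d.π_δ, map_zero]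
    exists_y x h := by
      obtain ⟨z₀, hz₀⟩ := d.exists_y _ (congrArg (lo i N) h)
      obtain ⟨z₁, hz₁⟩ := d.exists_y _ (congrArg (hi i N) h)
      exact ⟨(z₀, z₁), (hδ _ _).2 ⟨hz₀, hz₁⟩⟩
    exists_π x := by
      obtain ⟨z₀, hz₀⟩ := d.exists_π (lo i N x)
      obtain ⟨z₁, hz₁⟩ := d.exists_π (hi i N x)
      exact ⟨(z₀, z₁), step_ext hz₀ hz₁⟩
    δ_inj x h := step_ext (d.δ_inj _ (congrArg (lo i d.lift) h))
      (d.δ_inj _ (congrArg (hi i d.lift) h))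
    exists_δ x h := by
      obtain ⟨z₀, hz₀⟩ := d.exists_δ _ (congrArg (lo i N) h)
      obtain ⟨z₁, hz₁⟩ := d.exists_δ _ (congrArg (hi i N) h)
      exact ⟨(z₀, z₁), step_ext hz₀ hz₁⟩ }

/-- Words in the crossings away from the strand `0` preserve the data. -/
def act {ξ₀ : k} {B : StrandModule k (m + 2)} {N : StrandModule k (m + 1)}
    (d : Destabilization ξ₀ B N) :
    (W : List (Fin m)) → Destabilization ξ₀ (B.act (W.map Fin.succ)) (N.act W)
  | [] => d
  | i :: W => (d.step i).act W

/-- The data for a single crossing involving the strand `0`. -/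
def ofScalar {ξ₀ : k} {A : StrandModule k (m + 2)} (h : ∀ x, A.y 0 x = ξ₀ • x) :
    Destabilization ξ₀ (A.step 0) A.tail := by
  let P (f : Module.End k A) : Module.End k (A.step 0) := pair (f ∘ₗ lo 0 A) (f ∘ₗ hi 0 A)
  let d : Module.End k (A.step 0) := pair 0 (lo 0 A - A.root 0 ∘ₗ hi 0 A)
  have hPd : ∀ j x, d (P (A.y j) x) = P (A.y j) (d x) := fun j x => by
    refine step_ext ?_ ?_ <;> simp [d, P, y_root]
  have hy : ∀ j x, (A.step 0).y j x = P (A.y j) x + coef 0 j • d x := fun j x => by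
    refine step_ext ?_ ?_ <;> simp [d, P, lo_y, hi_y]
  have hδ : ∀ x, ξ₀ • x - (A.step 0).y 0 x = -d x := fun x => by
    rw [hy]
    refine step_ext ?_ ?_ <;> simp [d, P, h, coef]
  let shift : Module.End k (ℕ →₀ A) := Finsupp.lmapDomain A k Nat.succ
  let ρ : (ℕ →₀ A) →ₗ[k] A.step 0 := Finsupp.lsum k fun n => (d ^ n) ∘ₗ pair .id 0
  let R (f : Module.End k A) : Module.End k (ℕ →₀ A) := Finsupp.mapRange.linearMap f
  have hpow : ∀ j n x, (d ^ n) (P (A.y j) x) = P (A.y j) ((d ^ n) x) := fun j n x => by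
    induction n with
    | zero => rfl
    | succ n ih => rw [pow_succ', Module.End.mul_apply, Module.End.mul_apply, ih, hPd]
  have hρ : ∀ x, ρ (shift x) = d (ρ x) := LinearMap.congr_fun (f := ρ ∘ₗ shift) (g := d ∘ₗ ρ) <|
    Finsupp.lhom_ext fun n b => by simp [ρ, shift, pow_succ']
  have hρR : ∀ j x, ρ (R (A.y j) x) = P (A.y j) (ρ x) := fun j =>
    LinearMap.congr_fun (f := ρ ∘ₗ R (A.y j)) (g := P (A.y j) ∘ₗ ρ) <|
    Finsupp.lhom_ext fun n b => by
      simp only [ρ, R, LinearMap.comp_apply, Finsupp.mapRange.linearMap_apply,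
        Finsupp.mapRange_single, Finsupp.lsum_single, ← hpow]
      congr 1
      refine step_ext ?_ ?_ <;> simp [P]
  have hRR : ∀ i j x, R (A.y i) (R (A.y j) x) = R (A.y j) (R (A.y i) x) := fun i j x => by
    ext n
    simp [R, A.comm i j]
  have hRs : ∀ j x, R (A.y j) (shift x) = shift (R (A.y j) x) := fun j =>
    LinearMap.congr_fun (f := R (A.y j) ∘ₗ shift) (g := shift ∘ₗ R (A.y j)) <|
    Finsupp.lhom_ext fun n b => by simp [R, shift]
  have hlo : ∀ x, lo 0 A (ρ x) = x 0 :=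
    LinearMap.congr_fun (f := lo 0 A ∘ₗ ρ) (g := Finsupp.lapply 0) <|
    Finsupp.lhom_ext fun n b => by
      cases n with
      | zero => simp [ρ]
      | succ n => simp [ρ, pow_succ', d]
  let κ : A →ₗ[k] A.step 0 := pair (A.root 0) .id
  have hκ : ∀ x, d (κ x) = 0 := fun x => by
    refine step_ext ?_ ?_ <;> simp [d, κ]
  have hκy : ∀ j (x : A), κ (A.y j x) = (A.step 0).y j (κ x) := fun j x => by
    rw [hy, hκ, smul_zero, add_zero]
    refine step_ext ?_ ?_ <;> simp [κ, P, y_root]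
  have hκδ : ∀ x : A, ξ₀ • κ x - (A.step 0).y 0 (κ x) = 0 := fun x => by rw [hδ, hκ, neg_zero]
  have hlod : ∀ x, lo 0 A (ξ₀ • x - (A.step 0).y 0 x) = 0 := fun x => by
    rw [hδ, map_neg]
    exact neg_zero
  exact
  { lift :=
    { carrier := ℕ →₀ A
      y j := R (A.y j.succ) + coef 0 j.succ • shift
      comm i j x := by
        simp only [LinearMap.add_apply, LinearMap.smul_apply, map_add, map_zsmul, smul_add, hRs,
          hRR i.succ, smul_comm (coef 0 i.succ)]
        abel }
    δ := ⟨-shift, fun j x => by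
      change (-shift) ((R (A.y j.succ) + coef 0 j.succ • shift) x) =
        (R (A.y j.succ) + coef 0 j.succ • shift) ((-shift) x)
      simp [hRs, add_comm]⟩
    ρ := ρ
    κ := κ
    π := lo 0 A
    ρ_y j x := by
      change ρ ((R (A.y j.succ) + coef 0 j.succ • shift) x) = (A.step 0).y j.succ (ρ x)
      rw [hy, LinearMap.add_apply, LinearMap.smul_apply, map_add, map_zsmul, hρ, hρR]
    κ_y j x := hκy j.succ x
    π_y j x := lo_y _ _
    ρ_δ x := by
      change ρ (-shift x) = _
      rw [hδ, map_neg, hρ]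
    κ_inj x h := congrArg (hi 0 A) h
    κ_δ x := hκδ x
    exists_κ x h := by
      rw [hδ, neg_eq_zero] at h
      exact ⟨hi 0 A x, step_ext (sub_eq_zero.1 (congrArg (hi 0 A) h)).symm rfl⟩
    π_δ x := hlod x
    exists_y x h := by
      refine ⟨pair (-.id) 0 (hi 0 A x), ?_⟩
      rw [hδ]
      refine step_ext ?_ ?_
      · refine Eq.trans ?_ h.symm
        exact neg_zero
      · simp [d]
    exists_π x := ⟨Finsupp.single 0 x, (hlo _).trans Finsupp.single_eq_same⟩
    δ_inj x h := by
      have h' : Finsupp.mapDomain Nat.succ x = Finsupp.mapDomain Nat.succ 0 :=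
        (neg_eq_zero.1 h).trans Finsupp.mapDomain_zero.symm
      exact Finsupp.mapDomain_injective Nat.succ_injective h'
    exists_δ x h := by
      replace h : x 0 = 0 := (hlo x).symm.trans h
      refine ⟨-Finsupp.comapDomain Nat.succ x Nat.succ_injective.injOn, ?_⟩
      change -shift (-_) = x
      rw [map_neg, neg_neg]
      refine Finsupp.mapDomain_comapDomain _ Nat.succ_injective _ fun n hn => ?_
      cases n with
      | zero => exact absurd h (Finsupp.mem_support_iff.1 hn)
      | succ n => exact ⟨n, rfl⟩ }

end Destabilization

end StrandModule

end Destabilization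

section Words

/-- The number of occurrences of the letter `0`. -/
def zeros {m : ℕ} (W : List (Fin m)) : ℕ := W.countP fun i : Fin m => (i : ℕ) = 0

theorem zeros_append {m : ℕ} (V W : List (Fin m)) : zeros (V ++ W) = zeros V + zeros W :=
  List.countP_append

theorem zeros_cons_of_eq {m : ℕ} {i : Fin m} (h : (i : ℕ) = 0) (W : List (Fin m)) :
    zeros (i :: W) = zeros W + 1 :=
  List.countP_cons_of_pos (by simpa using h)

theorem zeros_cons_of_ne {m : ℕ} {i : Fin m} (h : (i : ℕ) ≠ 0) (W : List (Fin m)) :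
    zeros (i :: W) = zeros W :=
  List.countP_cons_of_neg (by simpa using h)

theorem zeros_eq_zero {m : ℕ} {W : List (Fin m)} : zeros W = 0 ↔ ∀ i ∈ W, (i : ℕ) ≠ 0 := by
  simp [zeros]

theorem zeros_map_succ {m : ℕ} (W : List (Fin m)) : zeros (W.map Fin.succ) = 0 := by
  simp [zeros_eq_zero]

theorem exists_map_succ {m : ℕ} (W : List (Fin (m + 1))) :
    (∃ V : List (Fin m), W = V.map Fin.succ) ∨
      ∃ (V : List (Fin m)) (T : List (Fin (m + 1))), W = V.map Fin.succ ++ 0 :: T := by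
  induction W with
  | nil => exact .inl ⟨[], rfl⟩
  | cons i W ih =>
    obtain rfl | ⟨j, rfl⟩ := i.eq_zero_or_eq_succ
    · exact .inr ⟨[], W, rfl⟩
    · obtain ⟨V, rfl⟩ | ⟨V, T, rfl⟩ := ih
      · exact .inl ⟨j :: V, rfl⟩
      · exact .inr ⟨j :: V, T, rfl⟩

/-- Predicates on words compatible with the decompositions of the products of crossings. -/
structure WordClosed {m : ℕ} (G : List (Fin m) → Prop) : Prop where
  self : ∀ U T i, G (U ++ i :: T) → G (U ++ i :: i :: T)
  swap : ∀ U T (i j : Fin m), (i : ℕ) + 1 < j ∨ (j : ℕ) + 1 < i →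
    G (U ++ i :: j :: T) → G (U ++ j :: i :: T)
  braid : ∀ U T (i j : Fin m), (i : ℕ) + 1 = j ∨ (j : ℕ) + 1 = i →
    G (U ++ i :: j :: i :: T) → G (U ++ j :: T) → G (U ++ j :: i :: j :: T)

namespace WordClosed

variable {m : ℕ} {G : List (Fin m) → Prop}

theorem move_right (hG : WordClosed G) (i : Fin m) (U V T : List (Fin m))
    (hV : ∀ j ∈ V, (i : ℕ) + 1 < j) (h : G (U ++ i :: (V ++ T))) : G (U ++ (V ++ i :: T)) := by
  induction V generalizing U with
  | nil => exact h
  | cons j V ih =>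
    simpa using ih (U ++ [j]) (fun j hj => hV j (List.mem_cons_of_mem _ hj))
      (by simpa using hG.swap U (V ++ T) i j (.inl (hV j List.mem_cons_self)) h)

theorem move_left (hG : WordClosed G) (i : Fin m) (U V T : List (Fin m))
    (hV : ∀ j ∈ V, (i : ℕ) + 1 < j) (h : G (U ++ (V ++ i :: T))) : G (U ++ i :: (V ++ T)) := by
  induction V generalizing U with
  | nil => exact h
  | cons j V ih =>
    have := ih (U ++ [j]) (fun j hj => hV j (List.mem_cons_of_mem _ hj)) (by simpa using h)
    exact hG.swap U (V ++ T) j i (.inr (hV j List.mem_cons_self)) (by simpa using this)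

theorem between {G : List (Fin (m + 1)) → Prop} (hG : WordClosed G) (U T : List (Fin (m + 1))) :
    WordClosed fun V : List (Fin m) => G (U ++ (V.map Fin.succ ++ T)) where
  self U' T' i h := by
    simpa using hG.self (U ++ U'.map Fin.succ) (T'.map Fin.succ ++ T) i.succ (by simpa using h)
  swap U' T' i j hij h := by
    simpa using hG.swap (U ++ U'.map Fin.succ) (T'.map Fin.succ ++ T) i.succ j.succ
      (by simpa using hij) (by simpa using h)
  braid U' T' i j hij h h' := by
    simpa using hG.braid (U ++ U'.map Fin.succ) (T'.map Fin.succ ++ T) i.succ j.succ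
      (by simpa using hij) (by simpa using h) (by simpa using h')

theorem of_zeros_le_one (hG : WordClosed G) (h : ∀ W, zeros W ≤ 1 → G W) (W : List (Fin m)) :
    G W := by
  induction m with
  | zero =>
    refine h W ?_
    rw [zeros_eq_zero.2 fun i => i.elim0]
    exact zero_le_one
  | succ m ih =>
    induction hc : zeros W using Nat.strong_induction_on generalizing W with
    | _ c ihc =>
    subst hc
    obtain ⟨V, rfl⟩ | ⟨U, T, rfl⟩ := exists_map_succ W
    · exact h _ (by simp [zeros_map_succ])
    obtain ⟨V, rfl⟩ | ⟨V, T, rfl⟩ := exists_map_succ T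
    · exact h _ (by
        simp [zeros_append, zeros_map_succ, zeros_cons_of_eq (i := (0 : Fin (m + 1))) rfl])
    have h₀ : ((0 : Fin (m + 1)) : ℕ) = 0 := rfl
    replace ihc : ∀ W, zeros W < zeros T + 2 → G W := fun W hW =>
      ihc _ (by
        simpa [zeros_append, zeros_map_succ, zeros_cons_of_eq h₀] using Nat.lt_succ_iff.1 hW) W rfl
    have hU : zeros (U.map Fin.succ) = 0 := zeros_map_succ U
    generalize U.map Fin.succ = U at *
    rw [← List.singleton_append, ← List.append_assoc]
    refine ih (hG.between (U ++ [0]) (0 :: T)) (fun V hV => ?_) V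
    have hfar : ∀ V : List (Fin m), zeros V = 0 →
        ∀ j ∈ V.map Fin.succ, ((0 : Fin (m + 1)) : ℕ) + 1 < j := fun V hV j hj => by
      obtain ⟨j, hjV, rfl⟩ := List.mem_map.1 hj
      have := zeros_eq_zero.1 hV j hjV
      rw [Fin.val_succ, h₀]
      omega
    rw [List.append_assoc, List.singleton_append]
    by_cases hV₀ : zeros V = 0
    · refine hG.move_left 0 _ _ _ (hfar V hV₀) ?_
      rw [← List.append_assoc]
      refine hG.self _ _ _ (ihc _ ?_)
      simp [zeros_append, zeros_map_succ, zeros_cons_of_eq h₀, hU]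
    · obtain ⟨j, hj, hj₀⟩ : ∃ j ∈ V, (j : ℕ) = 0 := by
        simpa [zeros_eq_zero] using hV₀
      obtain ⟨V₁, V₂, rfl⟩ := List.append_of_mem hj
      rw [zeros_append, zeros_cons_of_eq hj₀] at hV
      have h₁ : zeros V₁ = 0 := by omega
      have h₂ : zeros V₂ = 0 := by omega
      have hj₁ : (j.succ : ℕ) ≠ 0 := by simp
      rw [List.map_append, List.map_cons, List.append_assoc]
      refine hG.move_left 0 _ _ _ (hfar V₁ h₁) ?_
      rw [← List.append_assoc]
      have := hG.move_right 0 ((U ++ V₁.map Fin.succ) ++ [0, j.succ]) (V₂.map Fin.succ) T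
        (hfar V₂ h₂)
      simp only [List.append_assoc, List.cons_append, List.nil_append] at this ⊢
      refine this ?_
      rw [← List.append_assoc]
      refine hG.braid _ _ j.succ 0 (.inr (by simp [hj₀])) (ihc _ ?_) (ihc _ ?_)
      all_goals
        simp [zeros_append, zeros_map_succ, zeros_cons_of_eq h₀, zeros_cons_of_ne hj₁, hU]

end WordClosed

end Words

theorem DHomology.projective_of_eq_zero {k : Type*} [CommRing k] {C : Type*} [AddCommGroup C]
    [Module k C] [Module.Projective k C] {D : Module.End k C} (hD : D = 0) :
    Module.Projective k (DHomology D) := by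
  subst hD
  have h : (LinearMap.range (0 : Module.End k C)).comap
      (LinearMap.ker (0 : Module.End k C)).subtype = ⊥ := by
    rw [LinearMap.range_zero]
    exact Submodule.ker_subtype _
  let e : DHomology (0 : Module.End k C) ≃ₗ[k] C := (Submodule.quotEquivOfEqBot _ h).trans
    ((LinearEquiv.ofEq _ ⊤ LinearMap.ker_zero).trans Submodule.topEquiv)
  exact Module.Projective.of_equiv e.symm

namespace StrandModule

variable {k : Type u} [CommRing k] {r m : ℕ}

/-- The ground ring, with scalar operators. -/
def scalar (ξ : Fin r → k) : StrandModule k r where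
  carrier := k
  y j := ξ j • 1
  comm i j x := smul_comm (ξ i) (ξ j) x

theorem projectiveHomology_scalar (ξ : Fin r → k) : (scalar ξ).ProjectiveHomology ξ := by
  have hD : (scalar ξ).koszul ξ = 0 := by
    refine LinearMap.ext fun f => funext fun t => ?_
    refine Finset.sum_eq_zero fun i _ => ?_
    have : (ξ i • (1 : Module.End k (scalar ξ)) - (scalar ξ).y i) (f (insert i t)) = 0 := sub_self _
    exact (congrArg _ this).trans (smul_zero _)
  have : Module.Free k (scalar ξ) := inferInstanceAs (Module.Free k k)
  exact DHomology.projective_of_eq_zero hD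

theorem projectiveHomology_act (ξ : Fin (m + 1) → k) (W : List (Fin m)) :
    ((scalar ξ).act W).ProjectiveHomology ξ := by
  induction m with
  | zero =>
    obtain rfl : W = [] := List.eq_nil_iff_forall_not_mem.2 fun i => i.elim0
    exact projectiveHomology_scalar ξ
  | succ m ih =>
    have hclosed : WordClosed fun W => ((scalar ξ).act W).ProjectiveHomology ξ := by
      refine ⟨fun U T i h => ?_, fun U T i j hij h => ?_, fun U T i j hij h h' => ?_⟩
      · rw [act_append] at h ⊢
        exact ((isSummand_step_step_self i _).act T).projectiveHomology h h
      · rw [act_append] at h ⊢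
        exact ((isSummand_step_step_distant hij.symm _).act T).projectiveHomology h h
      · rw [act_append] at h h' ⊢
        exact ((isSummand_step_step_step hij.symm _).act T).projectiveHomology h h'
    have h₀ : ∀ x, (scalar ξ).y 0 x = ξ 0 • x := fun x => rfl
    refine hclosed.of_zeros_le_one (fun W hW => ?_) W
    obtain ⟨V, rfl⟩ | ⟨V, T, rfl⟩ := exists_map_succ W
    · refine projectiveHomology_of_tail (y_zero_act h₀ V) ?_
      rw [tail_act]
      exact ih _ V
    obtain ⟨U, rfl⟩ | ⟨U, T, rfl⟩ := exists_map_succ T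
    · have d := (Destabilization.ofScalar (y_zero_act h₀ V)).act U
      rw [tail_act, ← act_append] at d
      rw [act_append]
      exact d.projectiveHomology (ih (fun j => ξ j.succ) (V ++ U))
    · simp [zeros_append, zeros_cons_of_eq (i := (0 : Fin (m + 1))) rfl, zeros_map_succ] at hW

end StrandModule

section Crossings

namespace Crossing

variable {m l : ℕ} {R S : Type*} [CommRing R] [CommRing S]

/-- The sum of the `δ`'s at the crossings of index `c`. -/
def hat (d : Fin l → R) (i : Fin l → Fin (m + 1)) (c : ℤ) : R :=
  ∑ t ∈ Finset.univ.filter fun t => ((i t : ℕ) : ℤ) = c, d t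

/-- The elements `y_j` attached to elements `a` and `d` playing the roles of `x` and `δ`. -/
def strand (a : Fin (m + 2) → R) (d : Fin l → R) (i : Fin l → Fin (m + 1)) (j : Fin (m + 2)) : R :=
  a j + hat d i (j : ℤ) - hat d i ((j : ℤ) - 1)

/-- The Bott–Samelson relations on elements `a` and `d` playing the roles of `x` and `δ`. -/
def rel (a : Fin (m + 2) → R) (d : Fin l → R) (i : Fin l → Fin (m + 1)) (t : Fin l) : R :=
  d t * (d t + a (i t).castSucc - a (i t).succ
    + 2 * ∑ s ∈ Finset.univ.filter fun s => s < t ∧ i s = i t, d s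
    - ∑ s ∈ Finset.univ.filter
        fun s => s < t ∧ ((i s : ℕ) = (i t : ℕ) + 1 ∨ (i t : ℕ) = (i s : ℕ) + 1), d s)

theorem map_hat (f : R →+* S) (d : Fin l → R) (i : Fin l → Fin (m + 1)) (c : ℤ) :
    f (hat d i c) = hat (fun t => f (d t)) i c :=
  map_sum f _ _

theorem map_strand (f : R →+* S) (a : Fin (m + 2) → R) (d : Fin l → R) (i : Fin l → Fin (m + 1))
    (j : Fin (m + 2)) :
    f (strand a d i j) = strand (fun j => f (a j)) (fun t => f (d t)) i j := by
  simp only [strand, map_sub, map_add, map_hat]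

theorem map_rel (f : R →+* S) (a : Fin (m + 2) → R) (d : Fin l → R) (i : Fin l → Fin (m + 1))
    (t : Fin l) :
    f (rel a d i t) = rel (fun j => f (a j)) (fun t => f (d t)) i t := by
  simp only [rel, map_mul, map_sub, map_add, map_sum, map_ofNat]

theorem hat_init (d : Fin (l + 1) → R) (i : Fin (l + 1) → Fin (m + 1)) (c : ℤ) :
    hat (Fin.init d) (Fin.init i) c =
      ∑ s : Fin l, if ((i s.castSucc : ℕ) : ℤ) = c then d s.castSucc else 0 := by
  rw [hat, Finset.sum_filter]
  rfl

theorem hat_succ (d : Fin (l + 1) → R) (i : Fin (l + 1) → Fin (m + 1)) (c : ℤ) :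
    hat d i c = hat (Fin.init d) (Fin.init i) c +
      if ((i (Fin.last l) : ℕ) : ℤ) = c then d (Fin.last l) else 0 := by
  rw [hat_init]
  simp only [hat, Finset.sum_filter, Fin.sum_univ_castSucc]

theorem strand_succ (a : Fin (m + 2) → R) (d : Fin (l + 1) → R) (i : Fin (l + 1) → Fin (m + 1))
    (j : Fin (m + 2)) :
    strand a d i j = strand a (Fin.init d) (Fin.init i) j +
      StrandModule.coef (i (Fin.last l)) j * d (Fin.last l) := by
  rw [strand, strand, hat_succ, hat_succ, StrandModule.coef]
  have h₁ : ((i (Fin.last l) : ℕ) : ℤ) = (j : ℤ) ↔ j = (i (Fin.last l)).castSucc := by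
    rw [Fin.ext_iff, Fin.val_castSucc]; omega
  have h₂ : ((i (Fin.last l) : ℕ) : ℤ) = (j : ℤ) - 1 ↔ j = (i (Fin.last l)).succ := by
    rw [Fin.ext_iff, Fin.val_succ]; omega
  simp only [h₁, h₂]
  push_cast
  split_ifs <;> ring

theorem rel_castSucc (a : Fin (m + 2) → R) (d : Fin (l + 1) → R)
    (i : Fin (l + 1) → Fin (m + 1)) (t : Fin l) :
    rel a d i t.castSucc = rel a (Fin.init d) (Fin.init i) t := by
  simp only [rel, Finset.sum_filter, Fin.sum_univ_castSucc, Fin.castSucc_lt_castSucc_iff,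
    (Fin.castSucc_lt_last t).not_gt, false_and, if_false, add_zero]
  rfl

theorem rel_last (a : Fin (m + 2) → R) (d : Fin (l + 1) → R) (i : Fin (l + 1) → Fin (m + 1)) :
    rel a d i (Fin.last l) = d (Fin.last l) * (d (Fin.last l) +
      (strand a (Fin.init d) (Fin.init i) (i (Fin.last l)).castSucc -
        strand a (Fin.init d) (Fin.init i) (i (Fin.last l)).succ)) := by
  simp only [rel, strand, hat_init, Finset.sum_filter, Fin.sum_univ_castSucc, lt_self_iff_false,
    false_and, if_false, add_zero, Fin.castSucc_lt_last, true_and, Fin.val_castSucc, Fin.val_succ]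
  have h : (∑ s : Fin l, if ((i s.castSucc : ℕ) = (i (Fin.last l) : ℕ) + 1 ∨
        (i (Fin.last l) : ℕ) = (i s.castSucc : ℕ) + 1) then d s.castSucc else 0) =
      (∑ s : Fin l, if ((i s.castSucc : ℕ) : ℤ) = ((i (Fin.last l) : ℕ) + 1 : ℕ) then d s.castSucc
        else 0) +
      ∑ s : Fin l, if ((i s.castSucc : ℕ) : ℤ) = (i (Fin.last l) : ℕ) - 1 then d s.castSucc
        else 0 := by
    rw [← Finset.sum_add_distrib]
    refine Finset.sum_congr rfl fun s _ => ?_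
    split_ifs <;> first | omega | simp
  have h' : (∑ s : Fin l, if i s.castSucc = i (Fin.last l) then d s.castSucc else 0) =
      ∑ s : Fin l, if ((i s.castSucc : ℕ) : ℤ) = (i (Fin.last l) : ℕ) then d s.castSucc else 0 := by
    simp only [Nat.cast_inj, Fin.ext_iff]
  have h'' : (∑ s : Fin l, if ((i s.castSucc : ℕ) : ℤ) = ((i (Fin.last l) : ℕ) + 1 : ℕ) - 1
        then d s.castSucc else 0) =
      ∑ s : Fin l, if ((i s.castSucc : ℕ) : ℤ) = (i (Fin.last l) : ℕ) then d s.castSucc else 0 :=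
    Finset.sum_congr rfl fun s _ => if_congr (by omega) rfl rfl
  rw [h, h', h'']
  ring

theorem prod_strand (a : Fin (m + 2) → R) (d : Fin l → R) (i : Fin l → Fin (m + 1))
    (h : ∀ t, rel a d i t = 0) (T : R) :
    ∏ j, (T + strand a d i j) = ∏ j, (T + a j) := by
  induction l with
  | zero => simp [strand, hat]
  | succ l ih =>
    rw [← ih (Fin.init d) (Fin.init i) fun t => (rel_castSucc a d i t).symm.trans (h _)]
    have hlast := h (Fin.last l)
    rw [rel_last] at hlast
    simp only [strand_succ a d i]
    generalize strand a (Fin.init d) (Fin.init i) = y at *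
    generalize i (Fin.last l) = s at *
    generalize d (Fin.last l) = δ at *
    have hne : s.castSucc ≠ s.succ := by simp [Fin.ext_iff]
    have hmem : s.succ ∈ Finset.univ.erase s.castSucc := by simp [hne.symm]
    have split : ∀ f : Fin (m + 2) → R, ∏ j, f j = f s.castSucc * (f s.succ *
        ∏ j ∈ (Finset.univ.erase s.castSucc).erase s.succ, f j) := fun f => by
      rw [Finset.mul_prod_erase _ _ hmem, Finset.mul_prod_erase _ _ (Finset.mem_univ _)]
    rw [split, split fun j => T + y j]
    have hrest : ∏ j ∈ (Finset.univ.erase s.castSucc).erase s.succ,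
        (T + (y j + StrandModule.coef s j * δ)) =
        ∏ j ∈ (Finset.univ.erase s.castSucc).erase s.succ, (T + y j) := by
      refine Finset.prod_congr rfl fun j hj => ?_
      simp only [Finset.mem_erase, Finset.mem_univ, and_true] at hj
      simp [StrandModule.coef, hj]
    have h₁ : StrandModule.coef s s.castSucc = 1 := by simp [StrandModule.coef, hne]
    have h₂ : StrandModule.coef s s.succ = -1 := by simp [StrandModule.coef, hne.symm]
    rw [hrest, h₁, h₂]
    push_cast
    linear_combination
      (-∏ j ∈ (Finset.univ.erase s.castSucc).erase s.succ, (T + y j)) * hlast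

theorem esym_strand (a : Fin (m + 2) → R) (d : Fin l → R) (i : Fin l → Fin (m + 1))
    (h : ∀ t, rel a d i t = 0) {p : ℕ} (hp : p ≤ m + 2) :
    esym p (strand a d i) = esym p a := by
  have key : ∀ v : Fin (m + 2) → R, esym p v =
      (∏ j, (Polynomial.X + Polynomial.C (v j))).coeff (m + 2 - p) := fun v => by
    rw [Finset.prod_X_add_C_coeff _ _ (by simp), Finset.card_univ, Fintype.card_fin,
      Nat.sub_sub_self hp]
    rfl
  rw [key, key, ← prod_strand (fun j => Polynomial.C (a j)) (fun t => Polynomial.C (d t)) i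
    (fun t => by rw [← map_rel Polynomial.C, h, map_zero])]
  simp only [map_strand]

end Crossing

end Crossings

section BottSamelson

namespace BSRing

variable {m l : ℕ} {S : Type*} [CommRing S]

theorem aeval_BSrel (i : Fin l → Fin (m + 1)) (a : Fin (m + 2) → S) (d : Fin l → S) (t : Fin l) :
    aeval (Sum.elim a d) (BSrel m l i t) = Crossing.rel a d i t := by
  simp [BSrel, Crossing.rel]

/-- The universal property of the Bott–Samelson ring. -/
def lift (i : Fin l → Fin (m + 1)) (a : Fin (m + 2) → S) (d : Fin l → S)
    (h : ∀ t, Crossing.rel a d i t = 0) : BSRing m l i →+* S :=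
  Ideal.Quotient.lift _ (aeval (R := ℤ) (Sum.elim a d)).toRingHom fun p hp => by
    have : Ideal.span (Set.range (BSrel m l i)) ≤
        RingHom.ker (aeval (R := ℤ) (Sum.elim a d)).toRingHom :=
      Ideal.span_le.2 <| by
        rintro _ ⟨t, rfl⟩
        exact (aeval_BSrel i a d t).trans (h t)
    exact this hp

variable {i : Fin l → Fin (m + 1)} {a : Fin (m + 2) → S} {d : Fin l → S}

theorem lift_xB (h : ∀ t, Crossing.rel a d i t = 0) (j : Fin (m + 2)) :
    lift i a d h (xB m l i j) = a j :=
  aeval_X (R := ℤ) (Sum.elim a d) (Sum.inl j)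

theorem lift_δB (h : ∀ t, Crossing.rel a d i t = 0) (t : Fin l) :
    lift i a d h (δB m l i t) = d t :=
  aeval_X (R := ℤ) (Sum.elim a d) (Sum.inr t)

theorem yB_eq_strand (i : Fin l → Fin (m + 1)) :
    yB m l i = Crossing.strand (xB m l i) (δB m l i) i := rfl

theorem lift_yB (h : ∀ t, Crossing.rel a d i t = 0) (j : Fin (m + 2)) :
    lift i a d h (yB m l i j) = Crossing.strand a d i j := by
  simp only [yB_eq_strand, Crossing.map_strand, lift_xB, lift_δB]

theorem rel_eq_zero (i : Fin l → Fin (m + 1)) (t : Fin l) :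
    Crossing.rel (xB m l i) (δB m l i) i t = 0 := by
  have : Crossing.rel (xB m l i) (δB m l i) i t = Ideal.Quotient.mk _ (BSrel m l i t) :=
    (Crossing.map_rel (Ideal.Quotient.mk _) (fun j => (X (Sum.inl j) : BSPoly m l))
      (fun t => X (Sum.inr t)) i t).symm
  rw [this, Ideal.Quotient.eq_zero_iff_mem]
  exact Ideal.subset_span ⟨t, rfl⟩

theorem ringHom_ext {f g : BSRing m l i →+* S} (hx : ∀ j, f (xB m l i j) = g (xB m l i j))
    (hδ : ∀ t, f (δB m l i t) = g (δB m l i t)) : f = g :=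
  Ideal.Quotient.ringHom_ext <| MvPolynomial.ringHom_ext
    (fun n => by simp) fun v => Sum.rec hx hδ v

theorem ψBS_X (i : Fin l → Fin (m + 1)) (j : Fin (m + 2)) : ψBS m l i (X j) = xB m l i j :=
  aeval_X (R := ℤ) _ j

theorem comp_ψBS (f : BSRing m l i →+* S) {l' : ℕ} {i' : Fin l' → Fin (m + 1)}
    (g : BSRing m l' i' →+* S) (h : ∀ j, f (xB m l i j) = g (xB m l' i' j))
    (p : MvPolynomial (Fin (m + 2)) ℤ) : f (ψBS m l i p) = g (ψBS m l' i' p) := by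
  have : f.comp (ψBS m l i) = g.comp (ψBS m l' i') :=
    MvPolynomial.ringHom_ext (fun n => by simp) fun j => by
      simpa only [RingHom.comp_apply, ψBS_X] using h j
  exact RingHom.congr_fun this p

end BSRing

namespace StrandModule

/-- A ring over `k` with multiplication operators. -/
def ofRingHom {k R : Type u} [CommRing k] [CommRing R] {r : ℕ} (ψ : k →+* R) (y : Fin r → R) :
    StrandModule k r where
  carrier := R
  mod := Module.compHom R ψ
  y j :=
    letI := Module.compHom R ψ
    { toFun x := y j * x
      map_add' := mul_add _
      map_smul' c x := mul_left_comm (y j) (ψ c) x }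
  comm i j x := mul_left_comm (y i) (y j) x

/-- `A` is a direct summand of `B`. -/
def IsRetract {k : Type u} [CommRing k] {r : ℕ} (A B : StrandModule k r) : Prop :=
  ∃ (f : Hom A B) (g : Hom B A), ∀ x, g.map (f.map x) = x

theorem IsRetract.trans {k : Type u} [CommRing k] {r : ℕ} {A B C : StrandModule k r}
    (h : IsRetract A B) (h' : IsRetract B C) : IsRetract A C := by
  obtain ⟨f, g, hgf⟩ := h
  obtain ⟨f', g', hgf'⟩ := h'
  exact ⟨⟨f'.map ∘ₗ f.map, fun j x => by simp [f.comm, f'.comm]⟩,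
    ⟨g.map ∘ₗ g'.map, fun j x => by simp [g.comm, g'.comm]⟩, fun x => by simp [hgf', hgf]⟩

theorem IsRetract.step {k : Type u} [CommRing k] {m : ℕ} {A B : StrandModule k (m + 1)}
    (h : IsRetract A B) (i : Fin m) : IsRetract (A.step i) (B.step i) := by
  obtain ⟨f, g, hgf⟩ := h
  exact ⟨f.step i, g.step i, fun x => Prod.ext (hgf _) (hgf _)⟩

theorem IsRetract.projectiveHomology {k : Type u} [CommRing k] {r : ℕ} {ξ : Fin r → k}
    {A B : StrandModule k r} (h : IsRetract A B) (hB : B.ProjectiveHomology ξ) :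
    A.ProjectiveHomology ξ := by
  obtain ⟨f, g, hgf⟩ := h
  exact IsSummand.projectiveHomology
    ⟨f, g, .zero _ _, .zero _ _, fun x => by rw [hgf]; exact add_zero x⟩ hB hB

/-- The Bott–Samelson ring with multiplication by the `y`'s. -/
def bottSamelson (m l : ℕ) (i : Fin l → Fin (m + 1)) :
    StrandModule (MvPolynomial (Fin (m + 2)) ℤ) (m + 2) :=
  ofRingHom (ψBS m l i) (yB m l i)

theorem isRetract_bottSamelson_zero {m : ℕ} (i : Fin 0 → Fin (m + 1)) :
    IsRetract (bottSamelson m 0 i) (scalar X) := by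
  let F : BSRing m 0 i →+* MvPolynomial (Fin (m + 2)) ℤ :=
    BSRing.lift i X Fin.elim0 fun t => t.elim0
  have hF : ∀ p, F (ψBS m 0 i p) = p := fun p => by
    have : F.comp (ψBS m 0 i) = RingHom.id _ := MvPolynomial.ringHom_ext (fun n => by simp)
      fun j => by rw [RingHom.comp_apply, BSRing.ψBS_X, BSRing.lift_xB]; rfl
    exact RingHom.congr_fun this p
  have hy : ∀ j, yB m 0 i j = xB m 0 i j := fun j => by simp [yB, δhat]
  refine ⟨⟨{ toFun := F, map_add' := map_add F, map_smul' := fun p x => ?_ }, fun j x => ?_⟩,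
    ⟨{ toFun := ψBS m 0 i, map_add' := map_add _, map_smul' := fun p x => ?_ }, fun j x => ?_⟩,
    fun x => ?_⟩
  · exact (map_mul F _ _).trans (congrArg (· * F x) (hF p))
  · refine (map_mul F (yB m 0 i j) x).trans (congrArg (· * F x) ?_)
    rw [hy, BSRing.lift_xB]
  · exact map_mul (ψBS m 0 i) p x
  · refine (map_mul (ψBS m 0 i) (X j) x).trans (congrArg (· * ψBS m 0 i x) ?_)
    rw [hy, BSRing.ψBS_X]
  · have : (ψBS m 0 i).comp F = RingHom.id _ := BSRing.ringHom_ext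
      (fun j => by rw [RingHom.comp_apply, BSRing.lift_xB, BSRing.ψBS_X]; rfl) fun t => t.elim0
    exact RingHom.congr_fun this x

/-- The ring homomorphism out of `R[δ]/(δ (δ + α))` given by an element satisfying the relation. -/
def quadraticLift {R B : Type*} [CommRing R] [CommRing B] {α : R} (ι : R →+* B) (δ : B)
    (hδ : δ * (δ + ι α) = 0) : QuadraticAlgebra R 0 (-α) →+* B where
  toFun q := ι q.re + ι q.im * δ
  map_one' := by simp [QuadraticAlgebra.re_one, QuadraticAlgebra.im_one]
  map_zero' := by simp
  map_add' p q := by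
    simp only [QuadraticAlgebra.re_add, QuadraticAlgebra.im_add, map_add]
    ring
  map_mul' p q := by
    simp only [QuadraticAlgebra.re_mul, QuadraticAlgebra.im_mul, map_add, map_mul, map_neg,
      map_zero]
    linear_combination (-ι p.im * ι q.im) * hδ

theorem isRetract_ofRingHom_step {k R B : Type u} [CommRing k] [CommRing R] [CommRing B]
    {ψ : k →+* R} {ψ' : k →+* B} {y : Fin (m + 1) → R} {y' : Fin (m + 1) → B} {s : Fin m}
    (ι : R →+* B) (δ : B) (hδ : δ * (δ + ι (y s.castSucc - y s.succ)) = 0)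
    (F : B →+* QuadraticAlgebra R 0 (-(y s.castSucc - y s.succ)))
    (hFι : ∀ x, F (ι x) = ⟨x, 0⟩) (hFδ : F δ = ⟨0, 1⟩) (hιψ : ∀ p, ι (ψ p) = ψ' p)
    (hy : ∀ j, y' j = ι (y j) + coef s j * δ)
    (hF : ∀ x, quadraticLift ι δ hδ (F x) = x) :
    IsRetract (ofRingHom ψ' y') ((ofRingHom ψ y).step s) := by
  have hFy : ∀ j, F (y' j) = ⟨y j, coef s j⟩ := fun j => by
    rw [hy, map_add, map_mul, hFι, hFδ, map_intCast]
    ext <;> simp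
  have hFψ : ∀ p, F (ψ' p) = ⟨ψ p, 0⟩ := fun p => by rw [← hιψ, hFι]
  have i_add : ∀ x x' : B, ((F (x + x')).re, (F (x + x')).im) =
      ((F x).re, (F x).im) + ((F x').re, (F x').im) := fun x x' => by
    simp
  have i_smul : ∀ p (x : B), ((F (ψ' p * x)).re, (F (ψ' p * x)).im) =
      (ψ p * (F x).re, ψ p * (F x).im) := fun p x => by
    simp [hFψ]
  have i_y : ∀ j (x : B), ((F (y' j * x)).re, (F (y' j * x)).im) = (y j * (F x).re,
      y j * (F x).im + coef s j • ((F x).re -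
        (y s.castSucc * (F x).im - y s.succ * (F x).im))) := fun j x => by
    rw [map_mul, hFy]
    refine Prod.ext (by simp) ?_
    simp only [QuadraticAlgebra.im_mul, zsmul_eq_mul]
    ring
  have p_add : ∀ u v : R × R,
      ι (u.1 + v.1) + ι (u.2 + v.2) * δ = ι u.1 + ι u.2 * δ + (ι v.1 + ι v.2 * δ) := fun u v => by
    simp only [map_add]
    ring
  have p_smul : ∀ p (u : R × R),
      ι (ψ p * u.1) + ι (ψ p * u.2) * δ = ψ' p * (ι u.1 + ι u.2 * δ) := fun p u => by
    simp only [map_mul, hιψ]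
    ring
  have p_y : ∀ j (u : R × R), ι (y j * u.1) + ι (y j * u.2 + coef s j • (u.1 -
      (y s.castSucc * u.2 - y s.succ * u.2))) * δ = y' j * (ι u.1 + ι u.2 * δ) := fun j u => by
    rw [map_sub] at hδ
    simp only [zsmul_eq_mul, map_mul, map_add, map_sub, map_intCast, hy]
    linear_combination (-coef s j * ι u.2) * hδ
  exact ⟨⟨{ toFun := fun x => ((F x).re, (F x).im), map_add' := i_add, map_smul' := i_smul }, i_y⟩,
    ⟨{ toFun := fun u => ι u.1 + ι u.2 * δ, map_add' := p_add, map_smul' := p_smul }, p_y⟩, hF⟩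

theorem isRetract_bottSamelson_succ {m l : ℕ} (i : Fin (l + 1) → Fin (m + 1)) :
    IsRetract (bottSamelson m (l + 1) i)
      ((bottSamelson m l (Fin.init i)).step (i (Fin.last l))) := by
  have hrel : ∀ t, Crossing.rel (xB m (l + 1) i) (Fin.init (δB m (l + 1) i)) (Fin.init i) t = 0 :=
    fun t => (Crossing.rel_castSucc _ _ _ _).symm.trans (BSRing.rel_eq_zero i t.castSucc)
  have hιy := BSRing.lift_yB hrel
  have hδ := BSRing.rel_eq_zero i (Fin.last l)
  rw [Crossing.rel_last, ← hιy, ← hιy, ← map_sub] at hδ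
  let a (j) : QuadraticAlgebra (BSRing m l (Fin.init i)) 0
      (-(yB m l (Fin.init i) (i (Fin.last l)).castSucc -
        yB m l (Fin.init i) (i (Fin.last l)).succ)) :=
    algebraMap _ _ (xB m l (Fin.init i) j)
  let d : Fin (l + 1) → QuadraticAlgebra (BSRing m l (Fin.init i)) 0
      (-(yB m l (Fin.init i) (i (Fin.last l)).castSucc -
        yB m l (Fin.init i) (i (Fin.last l)).succ)) :=
    Fin.snoc (fun t => algebraMap _ _ (δB m l (Fin.init i) t)) ⟨0, 1⟩
  have hinit : Fin.init d = fun t => algebraMap _ _ (δB m l (Fin.init i) t) := Fin.init_snoc _ _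
  have hlast : d (Fin.last l) = ⟨0, 1⟩ := Fin.snoc_last _ _
  have hstrand : Crossing.strand a (Fin.init d) (Fin.init i) =
      fun j => algebraMap _ _ (yB m l (Fin.init i) j) := by
    funext j
    rw [hinit]
    exact (Crossing.map_strand (algebraMap _ _) _ _ _ _).symm
  have hd : ∀ t, Crossing.rel a d i t = 0 := by
    refine Fin.lastCases ?_ fun t => ?_
    · rw [Crossing.rel_last, hstrand, hlast]
      ext <;> simp [QuadraticAlgebra.algebraMap_eq]
    · rw [Crossing.rel_castSucc, hinit]
      refine (Crossing.map_rel (algebraMap _ _) _ _ _ _).symm.trans ?_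
      rw [BSRing.rel_eq_zero, map_zero]
  refine isRetract_ofRingHom_step (BSRing.lift (Fin.init i) _ _ hrel) _ hδ (BSRing.lift i a d hd)
    (fun x => ?_) ((BSRing.lift_δB hd _).trans hlast)
    (BSRing.comp_ψBS _ (RingHom.id _) (BSRing.lift_xB hrel)) (fun j => ?_) (fun x => ?_)
  · refine RingHom.congr_fun (f := (BSRing.lift i a d hd).comp (BSRing.lift (Fin.init i) _ _ hrel))
      (g := algebraMap _ _) (BSRing.ringHom_ext (fun j => ?_) fun t => ?_) x
    · rw [RingHom.comp_apply, BSRing.lift_xB, BSRing.lift_xB]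
    · rw [RingHom.comp_apply, BSRing.lift_δB]
      exact (BSRing.lift_δB hd t.castSucc).trans (congrFun hinit t)
  · rw [hιy, BSRing.yB_eq_strand, Crossing.strand_succ]
  · refine RingHom.congr_fun (f := (quadraticLift _ _ hδ).comp (BSRing.lift i a d hd))
      (g := RingHom.id _) (BSRing.ringHom_ext (fun j => ?_) (Fin.lastCases ?_ fun t => ?_)) x
    · rw [RingHom.comp_apply, BSRing.lift_xB]
      simp [quadraticLift, a, QuadraticAlgebra.algebraMap_eq, BSRing.lift_xB]
    · rw [RingHom.comp_apply, BSRing.lift_δB, hlast]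
      simp [quadraticLift]
    · rw [RingHom.comp_apply, BSRing.lift_δB, show d t.castSucc = _ from congrFun hinit t]
      simp [quadraticLift, QuadraticAlgebra.algebraMap_eq, BSRing.lift_δB, Fin.init]

theorem isRetract_bottSamelson {m l : ℕ} (i : Fin l → Fin (m + 1)) :
    IsRetract (bottSamelson m l i) ((scalar X).act (List.ofFn i)) := by
  induction l with
  | zero => exact isRetract_bottSamelson_zero i
  | succ l ih =>
    rw [List.ofFn_succ', List.concat_eq_append, act_append]
    exact (isRetract_bottSamelson_succ i).trans ((ih _).step _)

theorem projectiveHomology_bottSamelson {m l : ℕ} (i : Fin l → Fin (m + 1)) :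
    (bottSamelson m l i).ProjectiveHomology X :=
  (isRetract_bottSamelson i).projectiveHomology (projectiveHomology_act X _)

end StrandModule

end BottSamelson

section Acyclicity

theorem Module.Projective.mem_smul_top_iff {k H : Type*} [CommRing k] [AddCommGroup H]
    [Module k H] [Module.Projective k H] (I : Ideal k) (u : H) :
    u ∈ I • (⊤ : Submodule k H) ↔ ∀ f : H →ₗ[k] k, f u ∈ I := by
  constructor
  · intro h f
    induction h using Submodule.smul_induction_on' with
    | smul c hc v _ => rw [map_smul]; exact I.mul_mem_right _ hc
    | add v _ w _ hv hw => rw [map_add]; exact add_mem hv hw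
  · intro h
    obtain ⟨s, hs⟩ := Module.projective_def.1 ‹Module.Projective k H›
    rw [← hs u, Finsupp.linearCombination_apply]
    exact Submodule.sum_mem _ fun v _ =>
      Submodule.smul_mem_smul (h (Finsupp.lapply v ∘ₗ s)) Submodule.mem_top

theorem MvPolynomial.mem_span_X_pow_of_X_pow_mul_mem {R σ : Type*} [CommRing R] {n : ℕ} {s : σ}
    {S : Set σ} (hs : s ∉ S) {p : MvPolynomial σ R}
    (h : X s ^ n * p ∈ Ideal.span ((fun j => (X j : MvPolynomial σ R) ^ n) '' S)) :
    p ∈ Ideal.span ((fun j => (X j : MvPolynomial σ R) ^ n) '' S) := by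
  have key : (fun j => (X j : MvPolynomial σ R) ^ n) '' S =
      (fun e => monomial e (1 : R)) '' ((fun j => Finsupp.single j n) '' S) := by
    rw [Set.image_image]
    simp only [X_pow_eq_monomial]
  rw [key, mem_ideal_span_monomial_image] at h ⊢
  intro e he
  obtain ⟨_, ⟨j, hj, rfl⟩, hle⟩ := h (Finsupp.single s n + e) (by
    rw [mem_support_iff, X_pow_eq_monomial, coeff_monomial_mul, one_mul]
    exact mem_support_iff.1 he)
  refine ⟨_, ⟨j, hj, rfl⟩, ?_⟩
  have hsj : s ≠ j := fun e => hs (e ▸ hj)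
  have := hle j
  rw [Finsupp.single_le_iff]
  simpa [Finsupp.single_apply, hsj] using this

/-- Let `a` be a regular sequence of length `r`, and let `D` be an endomorphism, raising the degree
by one, of a projective graded module such that every `a j` is homotopic to zero. Then every
`D`-cycle is a `D`-boundary up to terms of degree at least `r`. Here `τ p` is the projection onto
the part of degree less than `p`. -/
theorem exists_truncation_eq_zero {k : Type*} [CommRing k] {r : ℕ} {a : Fin r → k}
    {H : Type*} [AddCommGroup H] [Module k H] [Module.Projective k H] {D : Module.End k H}
    {ι : Fin r → Module.End k H} {τ : ℕ → Module.End k H}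
    (hD : ∀ u, D (D u) = 0)
    (hι : ∀ j u, D (ι j u) + ι j (D u) = a j • u)
    (ha : ∀ j p, a j * p ∈ Ideal.span (a '' {i | i < j}) → p ∈ Ideal.span (a '' {i | i < j}))
    (hτ₀ : τ 0 = 0) (hτ : ∀ p u, τ p (τ p u) = τ p u) (hτD : ∀ p u, τ (p + 1) (D u) = D (τ p u))
    {u : H} (hu : D u = 0) : ∃ w, τ r (u - D w) = 0 := by
  obtain ⟨I, hI⟩ : ∃ I : ℕ → Ideal k, ∀ s, I s = Ideal.span (a '' {j | (j : ℕ) < s}) :=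
    ⟨_, fun _ => rfl⟩
  have hI_succ (j : Fin r) : I (j + 1) = I j ⊔ Ideal.span {a j} := by
    have : {i : Fin r | (i : ℕ) < j + 1} = {i : Fin r | (i : ℕ) < j} ∪ {j} := by
      ext i
      simp [Fin.ext_iff]
      omega
    rw [hI, hI, this, Set.image_union, Set.image_singleton, Ideal.span_union]
  have stable (s) (g : Module.End k H) {v : H} (hv : v ∈ I s • (⊤ : Submodule k H)) :
      g v ∈ I s • (⊤ : Submodule k H) := by
    have h := Submodule.mem_map_of_mem (f := g) hv
    rw [Submodule.map_smul''] at h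
    exact Submodule.smul_mono le_rfl le_top h
  have claim : ∀ t s, s + t = r → ∀ u, D u ∈ I s • (⊤ : Submodule k H) →
      ∃ w, τ t (u - D w) ∈ I s • (⊤ : Submodule k H) := by
    intro t
    induction t with
    | zero => exact fun s _ u _ => ⟨0, by simp [hτ₀]⟩
    | succ t ih =>
      intro s hst u hu
      obtain ⟨j, rfl⟩ : ∃ j : Fin r, (j : ℕ) = s := ⟨⟨s, by omega⟩, rfl⟩
      have hDι : D (ι j u) = a j • u - ι j (D u) := eq_sub_of_add_eq (hι j u)
      obtain ⟨w, hw⟩ := ih (j + 1) (by omega) (ι j u) (by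
        rw [hDι, hI_succ, Submodule.sup_smul]
        exact sub_mem (Submodule.mem_sup_right (Submodule.smul_mem_smul
          (Ideal.mem_span_singleton_self _) Submodule.mem_top))
          (Submodule.mem_sup_left (stable _ _ hu)))
      rw [hI_succ, Submodule.sup_smul, Submodule.ideal_span_singleton_smul,
        Submodule.mem_sup] at hw
      obtain ⟨b, hb, _, ⟨v, -, rfl⟩, hbv⟩ := hw
      replace hbv : b + a j • v = τ t (ι j u - D w) := hbv
      have key : a j • τ (t + 1) (u - D v) = τ (t + 1) (D b + ι j (D u)) := by
        have h1 : τ (t + 1) (D (ι j u)) = τ (t + 1) (D (τ t (ι j u - D w))) := by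
          rw [hτD, hτD, hτ, map_sub, map_sub, ← hτD t (D w), hD, map_zero, sub_zero]
        rw [← hbv, hDι, map_add, map_smul] at h1
        simp only [map_sub, map_add, map_smul, smul_sub] at h1 ⊢
        rw [sub_eq_iff_eq_add] at h1 ⊢
        rw [h1]
        abel
      refine ⟨v, (Module.Projective.mem_smul_top_iff _ _).2 fun f => ?_⟩
      have hmem := (Module.Projective.mem_smul_top_iff _ _).1
        (key ▸ stable _ (τ (t + 1)) (add_mem (stable _ D hb) (stable _ (ι j) hu))) f
      rw [map_smul, smul_eq_mul] at hmem
      rw [hI] at hmem ⊢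
      exact ha j _ hmem
  obtain ⟨w, hw⟩ := claim r 0 (zero_add r) u (by rw [hu]; exact zero_mem _)
  refine ⟨w, ?_⟩
  have h0 : I 0 = ⊥ := by simp [hI]
  rwa [h0, Submodule.bot_smul, Submodule.mem_bot] at hw

end Acyclicity

section KoszulDegrees

variable {B : Type*} [CommRing B] {r : ℕ}

open scoped Classical in
/-- The projection onto the part of the Koszul complex in the exterior degrees satisfying `p`. -/
def KModule.part (p : ℤ → Prop) : KModule B r →ₗ[B] KModule B r where
  toFun f t := if p t.card then f t else 0
  map_add' f g := by
    funext t
    by_cases h : p t.card <;> simp [h]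
  map_smul' c f := by
    funext t
    by_cases h : p t.card <;> simp [h]

namespace KModule

theorem part_part (p q : ℤ → Prop) (f : KModule B r) :
    part p (part q f) = part (fun d => p d ∧ q d) f := by
  funext t
  by_cases h : p t.card <;> by_cases h' : q t.card <;> simp [part, h, h']

theorem koszulD_part (p : ℤ → Prop) (z : Fin r → B) (f : KModule B r) :
    koszulD z (part p f) = part (fun d => p (d + 1)) (koszulD z f) := by
  funext t
  have h : ∀ j ∈ tᶜ, ((insert j t).card : ℤ) = t.card + 1 := fun j hj => by
    rw [Finset.card_insert_of_notMem (Finset.mem_compl.1 hj), Nat.cast_succ]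
  by_cases hp : p (t.card + 1)
  · simp only [part, koszulD, LinearMap.coe_mk, AddHom.coe_mk, if_pos hp]
    exact Finset.sum_congr rfl fun j hj => by rw [h j hj, if_pos hp]
  · simp only [part, koszulD, LinearMap.coe_mk, AddHom.coe_mk, if_neg hp]
    exact Finset.sum_eq_zero fun j hj => by rw [h j hj, if_neg hp, mul_zero]

theorem extMul_part (p : ℤ → Prop) (c : Fin r → B) (f : KModule B r) :
    extMul c (part p f) = part (fun d => p (d - 1)) (extMul c f) := by
  funext t
  have h : ∀ j ∈ t, ((t.erase j).card : ℤ) = t.card - 1 := fun j hj => by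
    rw [← Finset.card_erase_add_one hj, Nat.cast_succ, add_sub_cancel_right]
  by_cases hp : p (t.card - 1)
  · simp only [part, extMul, LinearMap.coe_mk, AddHom.coe_mk, if_pos hp]
    exact Finset.sum_congr rfl fun j hj => by rw [h j hj, if_pos hp]
  · simp only [part, extMul, LinearMap.coe_mk, AddHom.coe_mk, if_neg hp]
    exact Finset.sum_eq_zero fun j hj => by rw [h j hj, if_neg hp, mul_zero]

theorem mem_kdeg {q : ℤ} {f : KModule B r} : f ∈ kdeg B r q ↔ part (· = q) f = f := by
  refine ⟨fun h => funext fun t => ?_, fun h t ht => ?_⟩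
  · by_cases ht : (t.card : ℤ) = q
    · simp [part, ht]
    · simp [part, ht, h t ht]
  · rw [← h]
    simp [part, ht]

theorem part_mem_kdeg (q : ℤ) (f : KModule B r) : part (· = q) f ∈ kdeg B r q :=
  fun _ ht => if_neg ht

theorem extMul_mem_kdeg {q : ℤ} (c : Fin r → B) {f : KModule B r} (hf : f ∈ kdeg B r q) :
    extMul c f ∈ kdeg B r (q + 1) := by
  rw [mem_kdeg] at hf ⊢
  conv_rhs => rw [← hf, extMul_part]
  simp only [sub_eq_iff_eq_add]

variable {z c : Fin r → B}

theorem koszulD_extMul_of_sum_eq_zero (h : ∑ j, c j * z j = 0) (f : KModule B r) :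
    koszulD z (extMul c f) = -extMul c (koszulD z f) :=
  eq_neg_of_add_eq_zero_left (by rw [koszulD_extMul, h, zero_smul])

theorem map_extMul_kcycles_le (h : ∑ j, c j * z j = 0) (q : ℤ) :
    Submodule.map (extMul c) (kcycles z q) ≤ kcycles z (q + 1) := by
  rintro _ ⟨f, ⟨hf, hf'⟩, rfl⟩
  refine ⟨extMul_mem_kdeg c hf, ?_⟩
  rw [SetLike.mem_coe, LinearMap.mem_ker] at hf' ⊢
  rw [koszulD_extMul_of_sum_eq_zero h, hf', map_zero, neg_zero]

theorem map_extMul_kbdries_le (h : ∑ j, c j * z j = 0) (q : ℤ) :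
    Submodule.map (extMul c) (kbdries z q) ≤ kbdries z (q + 1) := by
  rintro _ ⟨_, ⟨f, hf, rfl⟩, rfl⟩
  exact ⟨-extMul c f, neg_mem (extMul_mem_kdeg c hf), by
    rw [map_neg, koszulD_extMul_of_sum_eq_zero h, neg_neg]⟩

end KModule

end KoszulDegrees

section KoszulExactness

open KModule

variable {k B : Type*} [CommRing k] [CommRing B] [Algebra k B] {r : ℕ}

/-- Exactness of multiplication by a class of degree one on projective Koszul homology, below the
top degree. -/
theorem exists_extMul_sub_mem_kbdries {z c : Fin r → B} {a : Fin r → k}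
    [Module.Projective k (DHomology ((koszulD z).restrictScalars k))]
    (ha : ∀ j p, a j * p ∈ Ideal.span (a '' {i | i < j}) → p ∈ Ideal.span (a '' {i | i < j}))
    (hc : ∑ j, c j * z j = 0) (hca : ∀ j, c j - algebraMap k B (a j) ∈ Ideal.span (Set.range z))
    {q : ℤ} (hq : q < r) {f : KModule B r} (hf : f ∈ kcycles z q)
    (hcf : extMul c f ∈ kbdries z (q + 1)) :
    ∃ g ∈ kcycles z (q - 1), f - extMul c g ∈ kbdries z q := by
  obtain ⟨hf, hfz⟩ := hf
  rw [SetLike.mem_coe, LinearMap.mem_ker] at hfz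
  obtain ⟨v, -, hv⟩ := hcf
  let d : Module.End k (KModule B r) := (koszulD z).restrictScalars k
  let anticomm (g : KModule B r →ₗ[B] KModule B r)
      (h : ∀ f, koszulD z (g f) = -g (koszulD z f)) : Module.End k (DHomology d) :=
    DHomology.map (g.restrictScalars k)
      (fun x hx => (h x).trans (by rw [show koszulD z x = 0 from hx, map_zero, neg_zero]))
      fun x => ⟨-g x, (map_neg _ _).trans (neg_eq_iff_eq_neg.2 (h x))⟩
  have hD := koszulD_extMul_of_sum_eq_zero hc
  let D := anticomm (extMul c) hD
  let ι (j : Fin r) := anticomm (koszulD (Pi.single j 1)) (koszulD_anticomm z _)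
  let τ (p : ℕ) : Module.End k (DHomology d) :=
    DHomology.map ((part (· < (p : ℤ))).restrictScalars k)
      (fun x hx => (koszulD_part (· < (p : ℤ)) z x).trans (by
        rw [show koszulD z x = 0 from hx, map_zero]))
      fun x => ⟨part (fun e => e - 1 < p) x, (koszulD_part (fun e => e - 1 < p) z x).trans (by
        simp only [add_sub_cancel_right]; rfl)⟩
  obtain ⟨w, hw⟩ := exists_truncation_eq_zero (D := D) (ι := ι) (τ := τ) (a := a)
    (fun u => by
      obtain ⟨x, hx, rfl⟩ := DHomology.mk_surjective u
      exact DHomology.mk_eq_zero.2 ⟨0, by rw [map_zero]; exact (extMul_extMul c x).symm⟩)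
    (fun j u => by
      obtain ⟨x, hx, rfl⟩ := DHomology.mk_surjective u
      obtain ⟨b, hb⟩ := Ideal.mem_span_range_iff_exists_fun.1 (hca j)
      refine DHomology.mk_eq_mk.2 ⟨extMul b x, ?_⟩
      have h₁ := koszulD_extMul z b x
      have h₂ := koszulD_extMul (Pi.single j 1) c x
      rw [show koszulD z x = 0 from hx, map_zero, add_zero, hb, sub_smul, algebraMap_smul] at h₁
      rw [Finset.sum_eq_single j (fun i _ h => by rw [Pi.single_eq_of_ne h, mul_zero])
        (by simp), Pi.single_eq_same, mul_one] at h₂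
      rw [← h₂, add_comm] at h₁
      exact h₁)
    ha
    (LinearMap.ext fun u => by
      obtain ⟨x, hx, rfl⟩ := DHomology.mk_surjective u
      refine DHomology.mk_eq_zero.2 ⟨0, ?_⟩
      rw [map_zero]
      exact funext fun t => (if_neg (by simp)).symm)
    (fun p u => by
      obtain ⟨x, hx, rfl⟩ := DHomology.mk_surjective u
      refine DHomology.mk_eq_mk.2 ⟨0, ?_⟩
      rw [map_zero]
      have h := part_part (· < (p : ℤ)) (· < (p : ℤ)) x
      simp only [and_self] at h
      exact (sub_eq_zero.2 h).symm)
    (fun p u => by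
      obtain ⟨x, hx, rfl⟩ := DHomology.mk_surjective u
      refine DHomology.mk_eq_mk.2 ⟨0, ?_⟩
      rw [map_zero]
      have h := extMul_part (· < (p : ℤ)) c x
      simp only [sub_lt_iff_lt_add, ← Nat.cast_succ] at h
      exact (sub_eq_zero.2 h.symm).symm)
    (u := DHomology.mk d f hfz) (DHomology.mk_eq_zero.2 ⟨v, hv⟩)
  obtain ⟨g, hg, rfl⟩ := DHomology.mk_surjective w
  obtain ⟨x, hx⟩ := DHomology.mk_eq_zero.1 hw
  replace hg : koszulD z g = 0 := hg
  replace hx : koszulD z x = part (· < (r : ℤ)) (f - extMul c g) := hx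
  refine ⟨part (· = q - 1) g, ⟨part_mem_kdeg _ g, ?_⟩, part (· = q + 1) x, part_mem_kdeg _ x, ?_⟩
  · rw [SetLike.mem_coe, LinearMap.mem_ker, koszulD_part, hg, map_zero]
  · rw [koszulD_part, hx, part_part, extMul_part]
    simp only [sub_left_inj, add_left_inj]
    rw [show (fun e : ℤ => e = q ∧ e < r) = (· = q) from
      funext fun e => propext ⟨And.left, fun h => ⟨h, h ▸ hq⟩⟩, map_sub, mem_kdeg.1 hf]

theorem StrandModule.projective_koszulD {k B : Type u} [CommRing k] [CommRing B]
    [Algebra k B] {r : ℕ} {y : Fin r → B} {ξ : Fin r → k}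
    (h : (ofRingHom (algebraMap k B) y).ProjectiveHomology ξ) {z : Fin r → B}
    (hz : ∀ j, z j = algebraMap k B (ξ j) - y j) :
    Module.Projective k (DHomology ((koszulD z).restrictScalars k)) := by
  have e (f : KModule B r) : (ofRingHom (algebraMap k B) y).koszul ξ f = koszulD z f := by
    refine Eq.trans ?_ (koszulD_eq_kos z f).symm
    funext t
    refine Finset.sum_congr rfl fun j _ => congrArg ((ksign j t : ℤ) • ·) ?_
    exact (sub_mul (algebraMap k B (ξ j)) (y j) (f (insert j t))).symm.trans
      (congrArg (· * f (insert j t)) (hz j).symm)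
  have : Module.Projective k (DHomology ((ofRingHom (algebraMap k B) y).koszul ξ)) := h
  let g : (Finset (Fin r) → ofRingHom (algebraMap k B) y) →ₗ[k] KModule B r :=
    { toFun := fun f => f
      map_add' := fun _ _ => rfl
      map_smul' := fun p f => funext fun t => (Algebra.smul_def p (show B from f t)).symm }
  let g' : KModule B r →ₗ[k] (Finset (Fin r) → ofRingHom (algebraMap k B) y) :=
    { toFun := fun f => f
      map_add' := fun _ _ => rfl
      map_smul' := fun p f => funext fun t => Algebra.smul_def p (f t) }
  exact DHomology.projective_of_retract (D₁ := (ofRingHom (algebraMap k B) y).koszul ξ)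
    (D₂ := (ofRingHom (algebraMap k B) y).koszul ξ) g' g 0 0 e (fun x => (e x).symm)
    (fun x => by simp) (fun x => by simp) fun x => add_zero x

/-- Exactness below the top degree, in terms of the multiplication operators `y`. -/
theorem StrandModule.ProjectiveHomology.exists_extMul_sub_mem_kbdries {k B : Type u} [CommRing k]
    [CommRing B] {r : ℕ} {ψ : k →+* B} {y : Fin r → B} {ξ a : Fin r → k}
    (h : (ofRingHom ψ y).ProjectiveHomology ξ)
    (ha : ∀ j p, a j * p ∈ Ideal.span (a '' {i | i < j}) → p ∈ Ideal.span (a '' {i | i < j}))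
    {z c : Fin r → B} (hz : ∀ j, z j = ψ (ξ j) - y j) (hc : ∑ j, c j * z j = 0)
    (hca : ∀ j, c j - ψ (a j) ∈ Ideal.span (Set.range z)) {q : ℤ} (hq : q < r)
    {f : KModule B r} (hf : f ∈ kcycles z q) (hcf : extMul c f ∈ kbdries z (q + 1)) :
    ∃ g ∈ kcycles z (q - 1), f - extMul c g ∈ kbdries z q :=
  let := ψ.toAlgebra
  have := projective_koszulD h hz
  _root_.exists_extMul_sub_mem_kbdries ha hc hca hq hf hcf

end KoszulExactness

section Diagonal

theorem map_esym {R S : Type*} [CommRing R] [CommRing S] {ι : Type*} [Fintype ι] [DecidableEq ι]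
    (f : R →+* S) (k : ℕ) (v : ι → R) : f (esym k v) = esym k (fun j => f (v j)) := by
  simp [esym, map_sum, map_prod]

/-- The restriction of a polynomial in `x` and `y` to the diagonal `x = y`. -/
def diagonal (R : Type*) [CommRing R] (r : ℕ) :
    MvPolynomial (Fin r ⊕ Fin r) R →+* MvPolynomial (Fin r) R :=
  (rename (Sum.elim id id)).toRingHom

theorem diagonal_eq_X_pow {r n : ℕ} {c : Fin r → FPoly r} {a : Fin r → Fin r → FQRing r}
    (h : ∀ j, toFQ r (c j) - kappa r n j = ∑ i, (a i j - a j i) * (xQ r i - yQ r i)) (j : Fin r) :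
    diagonal ℤ r (c j) = X j ^ n := by
  let ev : FQRing r →+* MvPolynomial (Fin r) ℚ :=
    Ideal.Quotient.lift _ (diagonal ℚ r) fun p hp => by
      have : Ideal.span (Set.range fun j => MvPolynomial.map (Int.castRingHom ℚ) (Frel r j)) ≤
          RingHom.ker (diagonal ℚ r) := Ideal.span_le.2 <| by
        rintro _ ⟨j, rfl⟩
        rw [SetLike.mem_coe, RingHom.mem_ker]
        simp only [Frel, map_sub, map_esym, map_X]
        simp [diagonal]
      exact this hp
  have hev (p : FPoly r) :
      ev (toFQ r p) = MvPolynomial.map (Int.castRingHom ℚ) (diagonal ℤ r p) :=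
    (map_rename (Int.castRingHom ℚ) _ p).symm
  have hx (j : Fin r) : ev (xQ r j) = X j := (hev _).trans (by simp [diagonal])
  have hy (j : Fin r) : ev (yQ r j) = X j := (hev _).trans (by simp [diagonal])
  have hκ : ev (kappa r n j) = X j ^ n := by
    have hC : ev (algebraMap ℚ (FQRing r) (1 / (n + 1))) = C (1 / (n + 1) : ℚ) :=
      congrArg (fun g : ℚ →+* MvPolynomial (Fin r) ℚ => g (1 / (n + 1)))
        (Subsingleton.elim (ev.comp (algebraMap ℚ (FQRing r))) C)
    have hs : ∑ i ∈ Finset.range (n + 1), (X j : MvPolynomial (Fin r) ℚ) ^ i * X j ^ (n - i) =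
        C (n + 1 : ℚ) * X j ^ n := by
      refine (Finset.sum_congr rfl (g := fun _ => X j ^ n) fun i hi => ?_).trans (by simp)
      rw [← pow_add, Nat.add_sub_cancel' (Nat.lt_succ_iff.1 (Finset.mem_range.1 hi))]
    rw [kappa, map_mul, hC, map_sum]
    simp only [map_mul, map_pow, hx, hy]
    rw [hs, ← mul_assoc, ← C_mul, one_div_mul_cancel (by positivity), C_1, one_mul]
  apply MvPolynomial.map_injective (Int.castRingHom ℚ) Int.cast_injective
  have := congrArg ev (h j)
  rw [map_sub, hev, hκ, map_sum] at this
  simp only [map_mul, map_sub, hx, hy, sub_self, mul_zero, Finset.sum_const_zero] at this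
  rw [sub_eq_zero.1 this, map_pow, map_X]

variable {m l : ℕ}

theorem toBS_inl (i : Fin l → Fin (m + 1)) (j : Fin (m + 2)) :
    toBS m l i (X (Sum.inl j)) = xB m l i j :=
  aeval_X (R := ℤ) _ _

theorem toBS_inr (i : Fin l → Fin (m + 1)) (j : Fin (m + 2)) :
    toBS m l i (X (Sum.inr j)) = yB m l i j :=
  aeval_X (R := ℤ) _ _

theorem toBS_sub_ψBS_mem (i : Fin l → Fin (m + 1)) (p : FPoly (m + 2)) :
    toBS m l i p - ψBS m l i (diagonal ℤ (m + 2) p) ∈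
      Ideal.span (Set.range fun j => xB m l i j - yB m l i j) := by
  rw [← Ideal.Quotient.eq]
  refine RingHom.congr_fun (f := (Ideal.Quotient.mk _).comp (toBS m l i))
    (g := (Ideal.Quotient.mk _).comp ((ψBS m l i).comp (diagonal ℤ (m + 2))))
    (MvPolynomial.ringHom_ext (fun n => by simp) ?_) p
  rintro (j | j)
  · simp [toBS_inl, diagonal, BSRing.ψBS_X]
  · simp only [RingHom.comp_apply, toBS_inr, diagonal, AlgHom.toRingHom_eq_coe, RingHom.coe_coe,
      rename_X, Sum.elim_inr, id, BSRing.ψBS_X]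
    refine (Ideal.Quotient.eq.2 (Ideal.subset_span ?_)).symm
    exact Set.mem_range_self (f := fun j => xB m l i j - yB m l i j) j

theorem toBS_Frel (i : Fin l → Fin (m + 1)) (j : Fin (m + 2)) :
    toBS m l i (Frel (m + 2) j) = 0 := by
  rw [Frel, map_sub, map_esym, map_esym]
  simp only [toBS_inl, toBS_inr]
  exact sub_eq_zero.2
    (Crossing.esym_strand (xB m l i) (δB m l i) i (BSRing.rel_eq_zero i) j.isLt).symm

theorem sum_toBS_mul_eq_zero {c : Fin (m + 2) → FPoly (m + 2)}
    (h : ∑ j, Ideal.Quotient.mk _ (c j) * (xZ (m + 2) j - yZ (m + 2) j) = 0)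
    (i : Fin l → Fin (m + 1)) : ∑ j, toBS m l i (c j) * (xB m l i j - yB m l i j) = 0 := by
  have hker : Ideal.span (Set.range (Frel (m + 2))) ≤ RingHom.ker (toBS m l i) :=
    Ideal.span_le.2 <| by
      rintro _ ⟨j, rfl⟩
      exact toBS_Frel i j
  let φ : FRing (m + 2) →+* BSRing m l i := Ideal.Quotient.lift _ (toBS m l i) fun p hp => hker hp
  have hφ (p : FPoly (m + 2)) : φ (Ideal.Quotient.mk _ p) = toBS m l i p := rfl
  have := congrArg φ h
  rw [map_sum, map_zero] at this
  simpa only [map_mul, map_sub, xZ, yZ, hφ, toBS_inl, toBS_inr] using this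

end Diagonal

/-- Fix `r = m + 2 ≥ 2` and `n ≥ 1`.  Let `z = Σ_j c_j·x̂_j` be a
degree-1 cycle of `K(𝔉; x − y)` whose image in `K(ℚ ⊗ 𝔉; x − y)` is homologous to
`κ_n` (elements of `𝔉` are quantified via representatives `c j ∈ ℤ[x,y]`; the boundary
of the general degree-2 element `Σ_{i,j} a_{ij}·x̂_i∧x̂_j` has `j`-th coefficient
`Σ_i (a_{ij} − a_{ji})·(x_i − y_i)`).  Let `J = (i_1,…,i_l)` be any sequence of
crossing indices, and let `Φ(z) = Σ_j φ_J(c_j)·x̂_j` in `K(R_J; x − y)`.  Then exterior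
multiplication by `Φ(z)` sends cycles to cycles and boundaries to boundaries, and for
every `q < r` the induced sequence `H_{q−1} → H_q → H_{q+1}`, with both maps given by
multiplication by the class of `Φ(z)`, is exact at `H_q`: a degree-`q` cycle killed by
`Φ(z)` up to boundaries is, up to boundaries, the `Φ(z)`-multiple of a degree-`(q−1)`
cycle. -/
theorem stmt10 (m n l : ℕ) (hn : 1 ≤ n) (i : Fin l → Fin (m + 1))
    (c : Fin (m + 2) → FPoly (m + 2))
    (hcycle :
      ∑ j : Fin (m + 2), Ideal.Quotient.mk _ (c j) * (xZ (m + 2) j - yZ (m + 2) j) = 0)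
    (hhom : ∃ a : Fin (m + 2) → Fin (m + 2) → FQRing (m + 2),
      ∀ j : Fin (m + 2),
        toFQ (m + 2) (c j) - kappa (m + 2) n j
          = ∑ i' : Fin (m + 2), (a i' j - a j i') * (xQ (m + 2) i' - yQ (m + 2) i')) :
    let z : Fin (m + 2) → BSRing m l i := fun j => xB m l i j - yB m l i j
    let Φ : Fin (m + 2) → BSRing m l i := fun j => toBS m l i (c j)
    (∀ q : ℤ, Submodule.map (extMul Φ) (kcycles z q) ≤ kcycles z (q + 1)) ∧
    (∀ q : ℤ, Submodule.map (extMul Φ) (kbdries z q) ≤ kbdries z (q + 1)) ∧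
    (∀ q : ℤ, q < (m + 2 : ℤ) →
      ∀ f ∈ kcycles z q, extMul Φ f ∈ kbdries z (q + 1) →
        ∃ g ∈ kcycles z (q - 1), f - extMul Φ g ∈ kbdries z q) := by
  intro z Φ
  have hΦ : ∑ j, Φ j * z j = 0 := sum_toBS_mul_eq_zero hcycle i
  obtain ⟨a, ha⟩ := hhom
  refine ⟨KModule.map_extMul_kcycles_le hΦ, KModule.map_extMul_kbdries_le hΦ, fun q hq f hf hcf =>
    (StrandModule.projectiveHomology_bottSamelson i).exists_extMul_sub_mem_kbdries
      (a := fun j => X j ^ n) (fun j p => MvPolynomial.mem_span_X_pow_of_X_pow_mul_mem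
        (S := {i | i < j}) (lt_irrefl j))
      (fun j => congrArg (· - yB m l i j) (BSRing.ψBS_X i j).symm) hΦ (fun j => ?_)
      (by exact_mod_cast hq) hf hcf⟩
  have := toBS_sub_ψBS_mem i (c j)
  rwa [diagonal_eq_X_pow ha] at this
end
end

section
/- Let r ≥ 3, let 2 ≤ s ≤ r−1, let l ≥ 3, and let (i_1, …, i_{l−3}) be any (possibly empty) sequence with each i_t ∈ {1, …, r−1}. Set J := (i_1, …, i_{l−3}, s, s−1, s), J̃ := (i_1, …, i_{l−3}, s−1, s, s−1), J' := (i_1, …, i_{l−3}, s), and J̃' := (i_1, …, i_{l−3}, s−1). Then there is an isomorphism of graded P-modules R_J ⊕ R_{J̃'}{2} ≅ R_{J̃} ⊕ R_{J'}{2}, where P := ℤ[x_1, …, x_r, y_1, …, y_r]. -/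
noncomputable section
open MvPolynomial

/-- The (variable-)degree-`d` homogeneous component of `R_J`: the image of the
homogeneous polynomials of degree `d` under the quotient map.  (Each variable `x_j`,
`δ_t` has cohomological degree `2`, so cohomological degree `2d` corresponds to
polynomial degree `d`; the defining ideal is homogeneous.) -/
def compBS (m l : ℕ) (i : Fin l → Fin (m + 1)) (d : ℕ) : Set (BSRing m l i) :=
  (Ideal.Quotient.mk (Ideal.span (Set.range (BSrel m l i)))) ''
    {p : BSPoly m l | p.IsHomogeneous d}

/-- The grading of a shifted module `M{2}`: raising all cohomological degrees by `2`
shifts the variable-degree grading by one, so the component of `M{2}` in degree `0` is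
`{0}` and in degree `d + 1` it is the degree-`d` component of `M`. -/
def shiftSet {α : Type*} [Zero α] (C : ℕ → Set α) : ℕ → Set α :=
  fun d => match d with
    | 0 => {0}
    | d' + 1 => C d'

/-- The coefficient of the quadratic relation `q² = (p - α) q` adjoined to `A[p]/(p² + γ p)`. -/
abbrev tripleCoeff₂ {A : Type*} [CommRing A] (α γ : A) : QuadraticAlgebra A 0 (-γ) :=
  ⟨-α, 1⟩

/-- The coefficient of the quadratic relation `d² = (q - γ - 2 p) d` adjoined to
`A[p, q]/(p² + γ p, q² - (p - α) q)`. -/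
abbrev tripleCoeff₃ {A : Type*} [CommRing A] (α γ : A) :
    QuadraticAlgebra (QuadraticAlgebra A 0 (-γ)) 0 (tripleCoeff₂ α γ) :=
  ⟨⟨-γ, -2⟩, 1⟩

/-- The triple extension `A[p, q, d]` of `A` with
`p (p + γ) = 0`, `q (q + α - p) = 0` and `d (d + γ + 2 p - q) = 0`. -/
abbrev TripleExt (A : Type*) [CommRing A] (α γ : A) :=
  QuadraticAlgebra (QuadraticAlgebra (QuadraticAlgebra A 0 (-γ)) 0 (tripleCoeff₂ α γ)) 0
    (tripleCoeff₃ α γ)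

namespace TripleExt

variable {A : Type*} [CommRing A] {α γ : A}

/-- The element `q`. -/
def u : TripleExt A α γ := ⟨⟨0, 1⟩, 0⟩

/-- The element `p + d`. -/
def v : TripleExt A α γ := ⟨⟨⟨0, 1⟩, 0⟩, 1⟩

/-- The map between opposite triple extensions which fixes `1`, annihilates `q + α - p` and
exchanges the actions of `u` and `v`. -/
def cross (x : TripleExt A α γ) : TripleExt A γ α :=
  ⟨⟨⟨x.re.re.re + α * x.re.re.im - α * x.im.re.re + α * (γ * x.im.re.im),
      x.re.re.im + x.re.im.re - x.im.re.re + γ * x.im.re.im⟩,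
    ⟨x.im.re.re + α * x.im.re.im, x.im.re.im + x.im.im.re⟩⟩,
   ⟨⟨x.re.re.im + x.re.im.re - x.im.re.re + γ * x.im.re.im, 0⟩,
    ⟨x.re.im.im + x.im.re.im, x.im.im.im⟩⟩⟩

/-- The projection to the single extension annihilating `1` and sending `q + α - p` to `-1`. -/
def proj (x : TripleExt A α γ) : QuadraticAlgebra A 0 (-γ) :=
  ⟨x.re.re.im - x.im.re.re + γ * x.im.re.im, x.im.re.im⟩

/-- The inclusion of the single extension as the multiples of `q + α - p`. -/
def incl (h : QuadraticAlgebra A 0 (-γ)) : TripleExt A α γ :=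
  ⟨⟨⟨α * h.re, -h.re + α * h.im + γ * h.im⟩, ⟨h.re, h.im⟩⟩, ⟨⟨α * h.im, -h.im⟩, ⟨h.im, 0⟩⟩⟩

end TripleExt

open scoped QuadraticAlgebra

namespace TripleExt

variable {A : Type*} [CommRing A] {α γ : A}

theorem cross_incl (h : QuadraticAlgebra A 0 (-γ)) : cross (incl h : TripleExt A α γ) = 0 := by
  ext <;> simp [cross, incl] <;> ring

theorem proj_cross (x : TripleExt A α γ) : proj (cross x) = 0 := by
  ext <;> simp [cross, proj]

theorem proj_incl (h : QuadraticAlgebra A 0 (-γ)) : proj (incl h : TripleExt A α γ) = -h := by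
  ext <;> simp [proj, incl]
  ring

theorem cross_cross (x : TripleExt A α γ) : cross (cross x) = x + incl (proj x) := by
  ext <;> simp [cross, proj, incl] <;> ring

theorem cross_add (x y : TripleExt A α γ) : cross (x + y) = cross x + cross y := by
  ext <;> simp [cross] <;> ring

theorem proj_add (x y : TripleExt A α γ) : proj (x + y) = proj x + proj y := by
  ext <;> simp [proj]
  ring

theorem incl_add (x y : QuadraticAlgebra A 0 (-γ)) :
    (incl (x + y) : TripleExt A α γ) = incl x + incl y := by
  ext <;> simp [incl] <;> ring

theorem incl_zero : (incl (0 : QuadraticAlgebra A 0 (-γ)) : TripleExt A α γ) = 0 := by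
  ext <;> simp [incl]

theorem incl_neg (h : QuadraticAlgebra A 0 (-γ)) :
    (incl (-h) : TripleExt A α γ) = -incl h := by
  ext <;> simp [incl]
  ring

theorem cross_smul (t : A) (x : TripleExt A α γ) : cross (t • x) = t • cross x := by
  ext <;> simp [cross] <;> ring

theorem proj_smul (t : A) (x : TripleExt A α γ) : proj (t • x) = t • proj x := by
  ext <;> simp [proj]
  ring

theorem incl_smul (t : A) (h : QuadraticAlgebra A 0 (-γ)) :
    (incl (t • h) : TripleExt A α γ) = t • incl h := by
  ext <;> simp [incl] <;> ring

theorem cross_u_mul (x : TripleExt A α γ) : cross (u * x) = v * cross x := by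
  ext <;> simp [cross, u, v] <;> ring

theorem cross_v_mul (x : TripleExt A α γ) : cross (v * x) = u * cross x := by
  ext <;> simp [cross, u, v] <;> ring

theorem proj_u_mul (x : TripleExt A α γ) : proj (u * x) = 0 := by
  ext <;> simp [proj, u]

theorem proj_v_mul (x : TripleExt A α γ) : proj (v * x) = QuadraticAlgebra.omega * proj x := by
  ext <;> simp [proj, v] <;> ring

theorem u_mul_incl (h : QuadraticAlgebra A 0 (-γ)) :
    u * (incl h : TripleExt A α γ) = 0 := by
  ext <;> simp [incl, u]
  ring

theorem v_mul_incl (h : QuadraticAlgebra A 0 (-γ)) :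
    v * (incl h : TripleExt A α γ) = incl (QuadraticAlgebra.omega * h) := by
  ext <;> simp [incl, v] <;> ring
end TripleExt

/-- A family of subsets of a commutative ring which is compatible with the ring operations
as the homogeneous components of a grading are. -/
structure IsGradingFamily {A : Type*} [CommRing A] (G : ℕ → Set A) : Prop where
  zero_mem : ∀ d, 0 ∈ G d
  add_mem : ∀ {d x y}, x ∈ G d → y ∈ G d → x + y ∈ G d
  neg_mem : ∀ {d x}, x ∈ G d → -x ∈ G d
  one_mem : 1 ∈ G 0
  mul_mem : ∀ {d e x y}, x ∈ G d → y ∈ G e → x * y ∈ G (d + e)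

/-- The components of a quadratic extension in which the generator has degree one. -/
def quadComp {A : Type*} [CommRing A] {a b : A} (G : ℕ → Set A) (d : ℕ) :
    Set (QuadraticAlgebra A a b) :=
  {x | x.re ∈ G d ∧ x.im ∈ shiftSet G d}

/-- A family of subsets closed under addition and negation for which multiplication by
elements of `s` raises the index by one. -/
structure IsStableFamily {A : Type*} [CommRing A] (G : ℕ → Set A) (s : Set A) : Prop where
  zero_mem : ∀ d, 0 ∈ G d
  add_mem : ∀ {d x y}, x ∈ G d → y ∈ G d → x + y ∈ G d
  neg_mem : ∀ {d x}, x ∈ G d → -x ∈ G d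
  mul_mem : ∀ {d a x}, a ∈ s → x ∈ shiftSet G d → a * x ∈ G d

theorem IsStableFamily.sub_mem {A : Type*} [CommRing A] {G : ℕ → Set A} {s : Set A}
    (hG : IsStableFamily G s) {d : ℕ} {x y : A} (hx : x ∈ G d) (hy : y ∈ G d) :
    x - y ∈ G d := by
  rw [sub_eq_add_neg]
  exact hG.add_mem hx (hG.neg_mem hy)

theorem IsStableFamily.shift {A : Type*} [CommRing A] {G : ℕ → Set A} {s : Set A}
    (hG : IsStableFamily G s) : IsStableFamily (shiftSet G) s where
  zero_mem d := by
    cases d with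
    | zero => rfl
    | succ d => exact hG.zero_mem d
  add_mem {d x y} hx hy := by
    cases d with
    | zero =>
      obtain rfl : x = 0 := hx
      obtain rfl : y = 0 := hy
      exact add_zero 0
    | succ d => exact hG.add_mem hx hy
  neg_mem {d x} hx := by
    cases d with
    | zero =>
      obtain rfl : x = 0 := hx
      exact neg_zero
    | succ d => exact hG.neg_mem hx
  mul_mem {d a x} ha hx := by
    cases d with
    | zero =>
      obtain rfl : x = 0 := hx
      exact mul_zero a
    | succ d => exact hG.mul_mem ha hx

namespace IsGradingFamily

variable {A : Type*} [CommRing A] {G : ℕ → Set A}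

theorem stable (hG : IsGradingFamily G) : IsStableFamily G (G 1) where
  zero_mem := hG.zero_mem
  add_mem := hG.add_mem
  neg_mem := hG.neg_mem
  mul_mem {d a x} ha hx := by
    cases d with
    | zero =>
      obtain rfl : x = 0 := hx
      rw [mul_zero]
      exact hG.zero_mem 0
    | succ d =>
      rw [add_comm]
      exact hG.mul_mem ha hx

theorem mul_shift_mem (hG : IsGradingFamily G) {d e : ℕ} {x y : A} (hx : x ∈ G d)
    (hy : y ∈ shiftSet G e) : x * y ∈ shiftSet G (d + e) := by
  cases e with
  | zero =>
    obtain rfl : y = 0 := hy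
    rw [mul_zero]
    exact hG.stable.shift.zero_mem _
  | succ e => exact hG.mul_mem hx hy

theorem shift_mul_mem (hG : IsGradingFamily G) {d e : ℕ} {x y : A} (hx : x ∈ shiftSet G d)
    (hy : y ∈ G e) : x * y ∈ shiftSet G (d + e) := by
  rw [mul_comm, add_comm]
  exact hG.mul_shift_mem hy hx

theorem mul_shift_mul_shift_mem (hG : IsGradingFamily G) {d e : ℕ} {b x y : A} (hb : b ∈ G 1)
    (hx : x ∈ shiftSet G d) (hy : y ∈ shiftSet G e) : b * x * y ∈ shiftSet G (d + e) :=
  hG.mul_shift_mem (hG.stable.mul_mem hb hx) hy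

theorem quad (hG : IsGradingFamily G) {b : A} (hb : b ∈ G 1) :
    IsGradingFamily (quadComp G : ℕ → Set (QuadraticAlgebra A 0 b)) where
  zero_mem d := ⟨hG.zero_mem d, hG.stable.shift.zero_mem d⟩
  add_mem hx hy := ⟨hG.add_mem hx.1 hy.1, hG.stable.shift.add_mem hx.2 hy.2⟩
  neg_mem hx := ⟨hG.neg_mem hx.1, hG.stable.shift.neg_mem hx.2⟩
  one_mem := ⟨hG.one_mem, rfl⟩
  mul_mem {d e x y} hx hy := by
    refine ⟨?_, ?_⟩
    · rw [QuadraticAlgebra.re_mul, zero_mul, zero_mul, add_zero]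
      exact hG.mul_mem hx.1 hy.1
    · rw [QuadraticAlgebra.im_mul]
      exact hG.stable.shift.add_mem
        (hG.stable.shift.add_mem (hG.mul_shift_mem hx.1 hy.2) (hG.shift_mul_mem hx.2 hy.1))
        (hG.mul_shift_mul_shift_mem hb hx.2 hy.2)

theorem algebraMap_mem_quadComp (hG : IsGradingFamily G) {a b : A} {d : ℕ} {x : A}
    (hx : x ∈ G d) : algebraMap A (QuadraticAlgebra A a b) x ∈ quadComp G d :=
  ⟨hx, hG.stable.shift.zero_mem d⟩

theorem omega_mem_quadComp (hG : IsGradingFamily G) {a b : A} :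
    (QuadraticAlgebra.omega : QuadraticAlgebra A a b) ∈ quadComp G 1 :=
  ⟨hG.zero_mem 1, hG.one_mem⟩

theorem intCast_mem (hG : IsGradingFamily G) (n : ℤ) : (n : A) ∈ G 0 := by
  induction n with
  | zero => simpa using hG.zero_mem 0
  | succ n ih => simpa using hG.add_mem ih hG.one_mem
  | pred n ih => simpa [sub_eq_add_neg] using hG.add_mem ih (hG.neg_mem hG.one_mem)

theorem monomial_mem (hG : IsGradingFamily G) {σ : Type*} (F : MvPolynomial σ ℤ →+* A)
    (hF : ∀ i, F (X i) ∈ G 1) (s : σ →₀ ℕ) (n : ℤ) : F (monomial s n) ∈ G s.degree := by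
  classical
  induction s using Finsupp.induction_linear generalizing n with
  | zero => simpa using hG.intCast_mem n
  | add f g hf hg =>
    rw [← mul_one n, ← monomial_mul, map_mul, map_add]
    exact hG.mul_mem (hf n) (hg 1)
  | single i k =>
    rw [← mul_one n, ← smul_eq_mul, ← smul_monomial, ← X_pow_eq_monomial, map_zsmul, map_pow,
      zsmul_eq_mul, Finsupp.degree_single]
    have h : F (X i) ^ k ∈ G k := by
      induction k with
      | zero => simpa using hG.one_mem
      | succ k ih =>
        rw [pow_succ]
        exact hG.mul_mem ih (hF i)
    simpa using hG.mul_mem (hG.intCast_mem n) h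

theorem map_mem_of_isHomogeneous (hG : IsGradingFamily G) {σ : Type*}
    (F : MvPolynomial σ ℤ →+* A) (hF : ∀ i, F (X i) ∈ G 1) {p : MvPolynomial σ ℤ} {d : ℕ}
    (hp : p.IsHomogeneous d) : F p ∈ G d := by
  rw [p.as_sum, map_sum]
  refine Finset.sum_induction _ (· ∈ G d) (fun _ _ => hG.add_mem) (hG.zero_mem d)
    fun s hs => ?_
  have h : s.degree = d := by
    by_contra h
    exact (mem_support_iff.1 hs) (hp.coeff_eq_zero h)
  rw [← h]
  exact hG.monomial_mem F hF s _

end IsGradingFamily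

theorem mem_shiftSet_quadComp {A : Type*} [CommRing A] {a b : A} {G : ℕ → Set A} {d : ℕ}
    {x : QuadraticAlgebra A a b} :
    x ∈ shiftSet (quadComp G) d ↔ x.re ∈ shiftSet G d ∧ x.im ∈ shiftSet (shiftSet G) d := by
  cases d with
  | zero => exact QuadraticAlgebra.ext_iff
  | succ d => exact Iff.rfl

theorem mem_shiftSet_shiftSet_quadComp {A : Type*} [CommRing A] {a b : A} {G : ℕ → Set A}
    {d : ℕ} {x : QuadraticAlgebra A a b} :
    x ∈ shiftSet (shiftSet (quadComp G)) d ↔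
      x.re ∈ shiftSet (shiftSet G) d ∧ x.im ∈ shiftSet (shiftSet (shiftSet G)) d := by
  cases d with
  | zero => exact QuadraticAlgebra.ext_iff
  | succ d => exact mem_shiftSet_quadComp

namespace TripleExt

variable {A : Type*} [CommRing A] {α γ : A}

/-- The components of a triple extension in which all generators have degree one. -/
abbrev comp (G : ℕ → Set A) : ℕ → Set (TripleExt A α γ) := quadComp (quadComp (quadComp G))

theorem mem_comp {G : ℕ → Set A} {d : ℕ} {x : TripleExt A α γ} :
    x ∈ comp G d ↔
      ((x.re.re.re ∈ G d ∧ x.re.re.im ∈ shiftSet G d) ∧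
        x.re.im.re ∈ shiftSet G d ∧ x.re.im.im ∈ shiftSet (shiftSet G) d) ∧
      (x.im.re.re ∈ shiftSet G d ∧ x.im.re.im ∈ shiftSet (shiftSet G) d) ∧
        x.im.im.re ∈ shiftSet (shiftSet G) d ∧
          x.im.im.im ∈ shiftSet (shiftSet (shiftSet G)) d := by
  rw [← mem_shiftSet_shiftSet_quadComp, ← mem_shiftSet_quadComp, ← mem_shiftSet_quadComp,
    ← mem_shiftSet_quadComp]
  rfl

theorem cross_mem {G : ℕ → Set A} (hG : IsGradingFamily G) (hα : α ∈ G 1) (hγ : γ ∈ G 1)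
    {d : ℕ} {x : TripleExt A α γ} (hx : x ∈ comp G d) : cross x ∈ comp G d := by
  rw [mem_comp] at hx ⊢
  obtain ⟨⟨⟨h₀, hp⟩, hq, hpq⟩, ⟨hr, hpr⟩, hqr, hpqr⟩ := hx
  have s₀ := hG.stable
  have s₁ := s₀.shift
  have s₂ := s₁.shift
  have h := s₁.add_mem (s₁.sub_mem (s₁.add_mem hp hq) hr) (s₁.mul_mem hγ hpr)
  exact ⟨⟨⟨s₀.add_mem (s₀.sub_mem (s₀.add_mem h₀ (s₀.mul_mem hα hp)) (s₀.mul_mem hα hr))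
    (s₀.mul_mem hα (s₁.mul_mem hγ hpr)), h⟩, s₁.add_mem hr (s₁.mul_mem hα hpr),
    s₂.add_mem hpr hqr⟩, ⟨h, s₂.zero_mem d⟩, s₂.add_mem hpq hpr, hpqr⟩

theorem proj_mem {G : ℕ → Set A} (hG : IsGradingFamily G) (hγ : γ ∈ G 1)
    {d : ℕ} {x : TripleExt A α γ} (hx : x ∈ comp G d) :
    proj x ∈ shiftSet (quadComp G) d := by
  rw [mem_comp] at hx
  obtain ⟨⟨⟨-, hp⟩, -⟩, ⟨hr, hpr⟩, -⟩ := hx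
  have s₁ := hG.stable.shift
  exact mem_shiftSet_quadComp.2
    ⟨s₁.add_mem (s₁.sub_mem hp hr) (s₁.mul_mem hγ hpr), hpr⟩

theorem incl_mem {G : ℕ → Set A} (hG : IsGradingFamily G) (hα : α ∈ G 1) (hγ : γ ∈ G 1)
    {d : ℕ} {h : QuadraticAlgebra A 0 (-γ)} (hh : h ∈ shiftSet (quadComp G) d) :
    (incl h : TripleExt A α γ) ∈ comp G d := by
  rw [mem_shiftSet_quadComp] at hh
  obtain ⟨h₀, h₁⟩ := hh
  have s₀ := hG.stable
  have s₁ := s₀.shift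
  have s₂ := s₁.shift
  rw [mem_comp]
  exact ⟨⟨⟨s₀.mul_mem hα h₀, s₁.add_mem (s₁.add_mem (s₁.neg_mem h₀) (s₁.mul_mem hα h₁))
    (s₁.mul_mem hγ h₁)⟩, h₀, h₁⟩, ⟨s₁.mul_mem hα h₁, s₂.neg_mem h₁⟩, h₁, s₂.shift.zero_mem d⟩

/-- The isomorphism exchanging `α` and `γ` between triple extensions, up to single
extensions. -/
def swapEquiv (α γ : A) :
    (TripleExt A α γ × QuadraticAlgebra A 0 (-α)) ≃+
      (TripleExt A γ α × QuadraticAlgebra A 0 (-γ)) where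
  toFun x := (cross x.1 + incl x.2, proj x.1)
  invFun y := (cross y.1 + incl (-y.2), -proj y.1)
  left_inv := by
    rintro ⟨x, g⟩
    simp [cross_add, cross_cross, cross_incl, proj_add, proj_cross, proj_incl, incl_neg]
  right_inv := by
    rintro ⟨y, h⟩
    simp only [cross_add, cross_cross, cross_incl, proj_add, proj_cross, proj_incl]
    simp [incl_neg]
  map_add' x y := by
    ext1
    · simp only [Prod.fst_add, Prod.snd_add, cross_add, incl_add]
      abel
    · exact proj_add _ _

theorem isGradingFamily_comp {G : ℕ → Set A} (hG : IsGradingFamily G) (hα : α ∈ G 1)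
    (hγ : γ ∈ G 1) : IsGradingFamily (comp (α := α) (γ := γ) G) := by
  have hG₂ := (hG.quad (hG.neg_mem hγ)).quad (b := tripleCoeff₂ α γ)
    ⟨hG.neg_mem hα, hG.one_mem⟩
  refine hG₂.quad (b := tripleCoeff₃ α γ) ⟨⟨hG.neg_mem hγ, hG.neg_mem ?_⟩, hG.one_mem, rfl⟩
  rw [← one_add_one_eq_two]
  exact hG.add_mem hG.one_mem hG.one_mem

theorem swapEquiv_mem {G : ℕ → Set A} (hG : IsGradingFamily G) (hα : α ∈ G 1) (hγ : γ ∈ G 1)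
    {d : ℕ} {x : TripleExt A α γ × QuadraticAlgebra A 0 (-α)} (h₁ : x.1 ∈ comp G d)
    (h₂ : x.2 ∈ shiftSet (quadComp G) d) :
    (swapEquiv α γ x).1 ∈ comp G d ∧ (swapEquiv α γ x).2 ∈ shiftSet (quadComp G) d :=
  ⟨(isGradingFamily_comp hG hγ hα).add_mem (cross_mem hG hα hγ h₁) (incl_mem hG hγ hα h₂),
    proj_mem hG hγ h₁⟩

theorem swapEquiv_symm_mem {G : ℕ → Set A} (hG : IsGradingFamily G) (hα : α ∈ G 1)
    (hγ : γ ∈ G 1) {d : ℕ} {y : TripleExt A γ α × QuadraticAlgebra A 0 (-γ)}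
    (h₁ : y.1 ∈ comp G d) (h₂ : y.2 ∈ shiftSet (quadComp G) d) :
    ((swapEquiv α γ).symm y).1 ∈ comp G d ∧
      ((swapEquiv α γ).symm y).2 ∈ shiftSet (quadComp G) d :=
  ⟨(isGradingFamily_comp hG hα hγ).add_mem (cross_mem hG hγ hα h₁)
      (incl_mem hG hα hγ ((hG.quad (hG.neg_mem hγ)).stable.shift.neg_mem h₂)),
    (hG.quad (hG.neg_mem hα)).stable.shift.neg_mem (proj_mem hG hα h₁)⟩

end TripleExt

/-- A polynomial representing `yB m l i j`. -/
def yPoly (m l : ℕ) (i : Fin l → Fin (m + 1)) (j : Fin (m + 2)) : BSPoly m l :=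
  X (Sum.inl j) + ∑ t ∈ Finset.univ.filter fun t => ((i t : ℕ) : ℤ) = (j : ℤ), X (Sum.inr t)
    - ∑ t ∈ Finset.univ.filter fun t => ((i t : ℕ) : ℤ) = (j : ℤ) - 1, X (Sum.inr t)

theorem mk_yPoly (m l : ℕ) (i : Fin l → Fin (m + 1)) (j : Fin (m + 2)) :
    Ideal.Quotient.mk (Ideal.span (Set.range (BSrel m l i))) (yPoly m l i j) = yB m l i j := by
  simp only [yPoly, map_sub, map_add, map_sum]
  rfl

theorem isHomogeneous_yPoly (m l : ℕ) (i : Fin l → Fin (m + 1)) (j : Fin (m + 2)) :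
    (yPoly m l i j).IsHomogeneous 1 :=
  ((isHomogeneous_X _ _).add (IsHomogeneous.sum _ _ _ fun _ _ => isHomogeneous_X _ _)).sub
    (IsHomogeneous.sum _ _ _ fun _ _ => isHomogeneous_X _ _)

theorem isGradingFamily_compBS (m l : ℕ) (i : Fin l → Fin (m + 1)) :
    IsGradingFamily (compBS m l i) where
  zero_mem d := ⟨0, isHomogeneous_zero _ _ d, map_zero _⟩
  add_mem := by
    rintro d _ _ ⟨p, hp, rfl⟩ ⟨q, hq, rfl⟩
    exact ⟨p + q, IsHomogeneous.add hp hq, map_add _ _ _⟩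
  neg_mem := by
    rintro d _ ⟨p, hp, rfl⟩
    exact ⟨-p, IsHomogeneous.neg hp, map_neg _ _⟩
  one_mem := ⟨1, isHomogeneous_one _ _, map_one _⟩
  mul_mem := by
    rintro d e _ _ ⟨p, hp, rfl⟩ ⟨q, hq, rfl⟩
    exact ⟨p * q, IsHomogeneous.mul hp hq, map_mul _ _ _⟩

theorem yB_mem_compBS (m l : ℕ) (i : Fin l → Fin (m + 1)) (j : Fin (m + 2)) :
    yB m l i j ∈ compBS m l i 1 :=
  ⟨yPoly m l i j, isHomogeneous_yPoly m l i j, mk_yPoly m l i j⟩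

section Snoc

variable {m l : ℕ} (i : Fin l → Fin (m + 1)) (c : Fin (m + 1))

/-- The word `i` extended by the letter `c`. -/
abbrev snocWord : Fin (l + 1) → Fin (m + 1) := Fin.snoc (α := fun _ => Fin (m + 1)) i c

/-- The inclusion of polynomial rings for a word extended by one letter. -/
abbrev snocRename (m l : ℕ) : BSPoly m l →ₐ[ℤ] BSPoly m (l + 1) :=
  rename (Sum.map id Fin.castSucc)

theorem BSrel_snocWord_castSucc (t : Fin l) :
    BSrel m (l + 1) (snocWord i c) t.castSucc = snocRename m l (BSrel m l i t) := by
  have h : ¬ Fin.last l < t.castSucc := not_lt.2 (Fin.le_last _)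
  simp [BSrel, Finset.sum_filter, Fin.sum_univ_castSucc, h, apply_ite (snocRename m l)]
  exact Or.inl (map_ofNat _ 2).symm

theorem BSrel_snocWord_last :
    BSrel m (l + 1) (snocWord i c) (Fin.last l) =
      X (Sum.inr (Fin.last l)) * (X (Sum.inr (Fin.last l))
        + snocRename m l (yPoly m l i c.castSucc - yPoly m l i c.succ)) := by
  have h : (2 * ∑ s : Fin l, (if i s = c then X (Sum.inr s.castSucc) else 0)
        - ∑ s : Fin l, if (i s : ℕ) = (c : ℕ) + 1 ∨ (c : ℕ) = (i s : ℕ) + 1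
          then X (Sum.inr s.castSucc) else 0 : BSPoly m (l + 1))
      = (∑ s : Fin l, if ((i s : ℕ) : ℤ) = ((c : ℕ) : ℤ) then X (Sum.inr s.castSucc) else 0)
        - (∑ s : Fin l, if ((i s : ℕ) : ℤ) = ((c : ℕ) : ℤ) - 1
          then X (Sum.inr s.castSucc) else 0)
        - (∑ s : Fin l, if ((i s : ℕ) : ℤ) = (((c : ℕ) + 1 : ℕ) : ℤ)
          then X (Sum.inr s.castSucc) else 0)
        + ∑ s : Fin l, if ((i s : ℕ) : ℤ) = (((c : ℕ) + 1 : ℕ) : ℤ) - 1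
          then X (Sum.inr s.castSucc) else 0 := by
    simp only [Finset.mul_sum, ← Finset.sum_sub_distrib, ← Finset.sum_add_distrib, Fin.ext_iff]
    refine Finset.sum_congr rfl fun s _ => ?_
    split_ifs <;> first | omega | ring
  simp only [BSrel, yPoly, Finset.sum_filter, Fin.sum_univ_castSucc, Fin.castSucc_lt_last,
    snocWord, Fin.snoc_castSucc, Fin.snoc_last, lt_irrefl, true_and, false_and, if_false,
    add_zero, map_add, map_sub, map_sum, apply_ite (snocRename m l), map_zero, rename_X,
    Sum.map_inl, Sum.map_inr, id, Fin.val_castSucc, Fin.val_succ]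
  linear_combination X (Sum.inr (Fin.last l)) * h

theorem yPoly_snocWord (j : Fin (m + 2)) :
    yPoly m (l + 1) (snocWord i c) j = snocRename m l (yPoly m l i j)
      + (if j = c.castSucc then X (Sum.inr (Fin.last l)) else 0)
      - (if j = c.succ then X (Sum.inr (Fin.last l)) else 0) := by
  have h₁ : (c : ℕ) = (j : ℕ) ↔ j = c.castSucc := by
    rw [Fin.ext_iff, Fin.val_castSucc]; omega
  have h₂ : ((c : ℕ) : ℤ) = (j : ℤ) - 1 ↔ j = c.succ := by
    rw [Fin.ext_iff, Fin.val_succ]; omega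
  simp [yPoly, Finset.sum_filter, Fin.sum_univ_castSucc, h₁, h₂, apply_ite (snocRename m l)]
  ring

/-- The inclusion of Bott–Samelson rings for a word extended by one letter. -/
def snocIncl : BSRing m l i →+* BSRing m (l + 1) (snocWord i c) :=
  Ideal.quotientMap _ (snocRename m l).toRingHom <| by
    rw [Ideal.span_le]
    rintro _ ⟨t, rfl⟩
    exact Ideal.subset_span ⟨t.castSucc, BSrel_snocWord_castSucc i c t⟩

theorem snocIncl_mk (p : BSPoly m l) :
    snocIncl i c (Ideal.Quotient.mk _ p) = Ideal.Quotient.mk _ (snocRename m l p) :=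
  rfl

theorem snocIncl_mem_compBS {d : ℕ} {x : BSRing m l i} (hx : x ∈ compBS m l i d) :
    snocIncl i c x ∈ compBS m (l + 1) (snocWord i c) d := by
  obtain ⟨p, hp, rfl⟩ := hx
  exact ⟨_, IsHomogeneous.rename_isHomogeneous hp, (snocIncl_mk i c p).symm⟩

theorem δB_last_mul :
    δB m (l + 1) (snocWord i c) (Fin.last l) * (δB m (l + 1) (snocWord i c) (Fin.last l)
      + snocIncl i c (yB m l i c.castSucc - yB m l i c.succ)) = 0 := by
  rw [← mk_yPoly, ← mk_yPoly, ← map_sub, snocIncl_mk, δB, ← map_add, ← map_mul,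
    ← BSrel_snocWord_last, Ideal.Quotient.eq_zero_iff_mem]
  exact Ideal.subset_span ⟨Fin.last l, rfl⟩

theorem yB_snocWord (j : Fin (m + 2)) :
    yB m (l + 1) (snocWord i c) j = snocIncl i c (yB m l i j)
      + (if j = c.castSucc then δB m (l + 1) (snocWord i c) (Fin.last l) else 0)
      - (if j = c.succ then δB m (l + 1) (snocWord i c) (Fin.last l) else 0) := by
  rw [← mk_yPoly, ← mk_yPoly, yPoly_snocWord, snocIncl_mk, map_sub, map_add,
    apply_ite (Ideal.Quotient.mk _), apply_ite (Ideal.Quotient.mk _), map_zero]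
  rfl

theorem xB_snocWord (j : Fin (m + 2)) :
    xB m (l + 1) (snocWord i c) j = snocIncl i c (xB m l i j) := by
  simp [xB, snocIncl_mk]

theorem exists_eq_snocIncl_add (x : BSRing m (l + 1) (snocWord i c)) :
    ∃ p q, x = snocIncl i c p + snocIncl i c q * δB m (l + 1) (snocWord i c) (Fin.last l) := by
  obtain ⟨x, rfl⟩ := Ideal.Quotient.mk_surjective x
  induction x using MvPolynomial.induction_on with
  | C n => exact ⟨n, 0, by simp⟩
  | add x y hx hy =>
    obtain ⟨p, q, h⟩ := hx
    obtain ⟨p', q', h'⟩ := hy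
    exact ⟨p + p', q + q', by rw [map_add, h, h', map_add, map_add]; ring⟩
  | mul_X x v hx =>
    obtain ⟨p, q, h⟩ := hx
    have key (y : BSPoly m l) : ∃ p q, Ideal.Quotient.mk _ x *
        Ideal.Quotient.mk (Ideal.span (Set.range (BSrel m (l + 1) (snocWord i c))))
          (snocRename m l y) =
        snocIncl i c p + snocIncl i c q * δB m (l + 1) (snocWord i c) (Fin.last l) :=
      ⟨p * Ideal.Quotient.mk _ y, q * Ideal.Quotient.mk _ y, by
        rw [h, map_mul, map_mul, snocIncl_mk]; ring⟩
    rw [map_mul]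
    obtain j | t := v
    · simpa using key (X (Sum.inl j))
    · induction t using Fin.lastCases with
      | cast t => simpa using key (X (Sum.inr t))
      | last =>
        refine ⟨0, p - q * (yB m l i c.castSucc - yB m l i c.succ), ?_⟩
        have h' := δB_last_mul i c
        rw [h, map_sub, map_mul, map_zero]
        change _ * δB m (l + 1) (snocWord i c) (Fin.last l) = _
        linear_combination snocIncl i c q * h'

variable {B : Type} [CommRing B] (E₀ : BSRing m l i ≃+* B) {β : B}

/-- The homomorphism from the polynomial ring to a quadratic extension which sends the last
variable to its generator. -/
def snocPolyHom (β : B) : BSPoly m (l + 1) →+* QuadraticAlgebra B 0 β :=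
  (aeval (Sum.elim (fun j => algebraMap B _ (E₀ (xB m l i j)))
    (Fin.snoc (α := fun _ => QuadraticAlgebra B 0 β) (fun t => algebraMap B _ (E₀ (δB m l i t)))
      QuadraticAlgebra.omega))).toRingHom

theorem snocPolyHom_snocRename (p : BSPoly m l) :
    snocPolyHom i E₀ β (snocRename m l p) = algebraMap B _ (E₀ (Ideal.Quotient.mk _ p)) := by
  suffices h : (snocPolyHom i E₀ β).comp (snocRename m l).toRingHom =
      ((algebraMap B _).comp E₀.toRingHom).comp (Ideal.Quotient.mk _) from DFunLike.congr_fun h p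
  refine MvPolynomial.ringHom_ext (by simp) ?_
  rintro (j | t)
  · simp [snocPolyHom, xB]
  · simp [snocPolyHom, δB]

theorem snocPolyHom_X_last :
    snocPolyHom i E₀ β (X (Sum.inr (Fin.last l))) = QuadraticAlgebra.omega := by
  simp [snocPolyHom]

theorem snocPolyHom_BSrel (hβ : E₀ (yB m l i c.castSucc - yB m l i c.succ) = -β)
    (t : Fin (l + 1)) :
    snocPolyHom i E₀ β (BSrel m (l + 1) (snocWord i c) t) = 0 := by
  induction t using Fin.lastCases with
  | cast t =>
    rw [BSrel_snocWord_castSucc, snocPolyHom_snocRename,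
      Ideal.Quotient.eq_zero_iff_mem.2 (Ideal.subset_span (Set.mem_range_self t)), map_zero,
      map_zero]
  | last =>
    rw [BSrel_snocWord_last, map_mul, map_add, snocPolyHom_snocRename, snocPolyHom_X_last,
      map_sub, mk_yPoly, mk_yPoly, hβ]
    ext <;> simp

theorem exists_snocEquiv {G : ℕ → Set B} (hG : IsGradingFamily G)
    (hE₀ : ∀ d x, E₀ x ∈ G d ↔ x ∈ compBS m l i d)
    (hβ : E₀ (yB m l i c.castSucc - yB m l i c.succ) = -β) :
    ∃ E : BSRing m (l + 1) (snocWord i c) ≃+* QuadraticAlgebra B 0 β,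
      (∀ d x, E x ∈ quadComp G d ↔ x ∈ compBS m (l + 1) (snocWord i c) d) ∧
      (∀ j, E (xB m (l + 1) (snocWord i c) j) = algebraMap B _ (E₀ (xB m l i j))) ∧
      ∀ j, E (yB m (l + 1) (snocWord i c) j) = algebraMap B _ (E₀ (yB m l i j))
        + (if j = c.castSucc then QuadraticAlgebra.omega else 0)
        - (if j = c.succ then QuadraticAlgebra.omega else 0) := by
  have hker : ∀ p ∈ Ideal.span (Set.range (BSrel m (l + 1) (snocWord i c))),
      snocPolyHom i E₀ β p = 0 := fun p hp => by
    refine (Ideal.span_le (I := RingHom.ker (snocPolyHom i E₀ β))).2 ?_ hp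
    rintro _ ⟨t, rfl⟩
    exact snocPolyHom_BSrel i c E₀ hβ t
  let F : BSRing m (l + 1) (snocWord i c) →+* QuadraticAlgebra B 0 β :=
    Ideal.Quotient.lift _ (snocPolyHom i E₀ β) hker
  have hF (p : BSPoly m (l + 1)) : F (Ideal.Quotient.mk _ p) = snocPolyHom i E₀ β p :=
    Ideal.Quotient.lift_mk _ _ _
  have hincl (x : BSRing m l i) : F (snocIncl i c x) = algebraMap B _ (E₀ x) := by
    obtain ⟨p, rfl⟩ := Ideal.Quotient.mk_surjective x
    rw [snocIncl_mk, hF, snocPolyHom_snocRename]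
  have hlast : F (δB m (l + 1) (snocWord i c) (Fin.last l)) = QuadraticAlgebra.omega := by
    rw [δB, hF, snocPolyHom_X_last]
  have hFadd (p q : BSRing m l i) : F (snocIncl i c p
      + snocIncl i c q * δB m (l + 1) (snocWord i c) (Fin.last l)) = ⟨E₀ p, E₀ q⟩ := by
    rw [map_add, map_mul, hincl, hincl, hlast]
    ext <;> simp
  have hbij : Function.Bijective F := by
    refine ⟨(injective_iff_map_eq_zero F).2 fun x hx => ?_, fun ⟨p, q⟩ => ?_⟩
    · obtain ⟨p, q, rfl⟩ := exists_eq_snocIncl_add i c x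
      rw [hFadd, QuadraticAlgebra.ext_iff] at hx
      obtain rfl : p = 0 := (map_eq_zero_iff E₀ E₀.injective).1 hx.1
      obtain rfl : q = 0 := (map_eq_zero_iff E₀ E₀.injective).1 hx.2
      simp
    · exact ⟨_, (hFadd (E₀.symm p) (E₀.symm q)).trans (by simp)⟩
  have hβ₁ : β ∈ G 1 := by
    rw [← neg_neg β, ← hβ]
    refine hG.neg_mem ((hE₀ 1 _).2 ?_)
    have h := (isGradingFamily_compBS m l i)
    exact h.stable.sub_mem (yB_mem_compBS m l i _) (yB_mem_compBS m l i _)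
  refine ⟨RingEquiv.ofBijective F hbij, fun d x => ⟨fun hx => ?_, ?_⟩, fun j => ?_, fun j => ?_⟩
  · obtain ⟨p, q, rfl⟩ := exists_eq_snocIncl_add i c x
    rw [RingEquiv.coe_ofBijective, hFadd] at hx
    have h := isGradingFamily_compBS m (l + 1) (snocWord i c)
    refine h.add_mem (snocIncl_mem_compBS i c ((hE₀ d p).1 hx.1)) ?_
    cases d with
    | zero =>
      obtain rfl : q = 0 := (map_eq_zero_iff E₀ E₀.injective).1 hx.2
      simpa using h.zero_mem 0
    | succ d =>
      exact h.mul_mem (snocIncl_mem_compBS i c ((hE₀ d q).1 hx.2)) ⟨_, isHomogeneous_X _ _, rfl⟩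
  · rintro ⟨p, hp, rfl⟩
    refine (hG.quad hβ₁).map_mem_of_isHomogeneous (snocPolyHom i E₀ β) ?_ hp
    have hX (v : Fin (m + 2) ⊕ Fin l) : E₀ (Ideal.Quotient.mk _ (X v)) ∈ G 1 :=
      (hE₀ 1 _).2 ⟨_, isHomogeneous_X _ _, rfl⟩
    rintro (j | t)
    · simpa [snocPolyHom, xB] using hG.algebraMap_mem_quadComp (hX (Sum.inl j))
    · induction t using Fin.lastCases with
      | cast t => simpa [snocPolyHom, δB] using hG.algebraMap_mem_quadComp (hX (Sum.inr t))
      | last => simpa [snocPolyHom] using hG.omega_mem_quadComp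
  · rw [RingEquiv.coe_ofBijective, xB_snocWord, hincl]
  · rw [RingEquiv.coe_ofBijective, yB_snocWord, map_sub, map_add, apply_ite F, apply_ite F,
      hincl, hlast, map_zero]

end Snoc

theorem TripleExt.u_eq {A : Type*} [CommRing A] {α γ : A} :
    (u : TripleExt A α γ) = algebraMap
      (QuadraticAlgebra (QuadraticAlgebra A 0 (-γ)) 0 (tripleCoeff₂ α γ)) _
      QuadraticAlgebra.omega :=
  rfl

theorem TripleExt.v_eq {A : Type*} [CommRing A] {α γ : A} :
    (v : TripleExt A α γ) = algebraMap
      (QuadraticAlgebra (QuadraticAlgebra A 0 (-γ)) 0 (tripleCoeff₂ α γ)) _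
      (algebraMap (QuadraticAlgebra A 0 (-γ)) _ QuadraticAlgebra.omega)
      + QuadraticAlgebra.omega := by
  ext <;> simp [v]

theorem TripleExt.algebraMap_eq {A : Type*} [CommRing A] {α γ : A} (t : A) :
    algebraMap A (TripleExt A α γ) t = algebraMap
      (QuadraticAlgebra (QuadraticAlgebra A 0 (-γ)) 0 (tripleCoeff₂ α γ)) _
      (algebraMap (QuadraticAlgebra A 0 (-γ)) _ (algebraMap A _ t)) :=
  rfl

theorem neg_tripleCoeff₂_sub {A : Type*} [CommRing A] (a a' γ : A) :
    -tripleCoeff₂ (a - a') γ = algebraMap A _ a - algebraMap A _ a' - QuadraticAlgebra.omega := by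
  ext <;> simp

theorem neg_tripleCoeff₃_sub {A : Type*} [CommRing A] (α c c' : A) :
    -tripleCoeff₃ α (c - c') = algebraMap (QuadraticAlgebra A 0 (-(c - c'))) _
      (algebraMap A _ c - algebraMap A _ c' + (QuadraticAlgebra.omega + QuadraticAlgebra.omega))
      - QuadraticAlgebra.omega := by
  ext <;> simp
  norm_num

/-- The element `t + (δ_{jp} - δ_{jp'}) ω`. -/
def singleWeight {A ι : Type*} [CommRing A] [DecidableEq ι] {β : A} (t : A) (j p p' : ι) :
    QuadraticAlgebra A 0 β :=
  algebraMap A _ t + (if j = p then QuadraticAlgebra.omega else 0)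
    - (if j = p' then QuadraticAlgebra.omega else 0)

/-- The element `t + (δ_{jp} - δ_{jp'}) v + (δ_{jq} - δ_{jq'}) u`. -/
def TripleExt.weight {A ι : Type*} [CommRing A] [DecidableEq ι] {α γ : A} (t : A)
    (j p p' q q' : ι) : TripleExt A α γ :=
  algebraMap A _ t + (if j = p then v else 0) - (if j = p' then v else 0)
    + (if j = q then u else 0) - (if j = q' then u else 0)

theorem TripleExt.weight_eq {A ι : Type*} [CommRing A] [DecidableEq ι] {α γ : A} (t : A)
    (j p p' q q' : ι) :
    (weight t j p p' q q' : TripleExt A α γ) = algebraMap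
      (QuadraticAlgebra (QuadraticAlgebra A 0 (-γ)) 0 (tripleCoeff₂ α γ)) _
      (algebraMap (QuadraticAlgebra A 0 (-γ)) _ (singleWeight t j p p')
        + (if j = q then QuadraticAlgebra.omega else 0)
        - (if j = q' then QuadraticAlgebra.omega else 0))
      + (if j = p then QuadraticAlgebra.omega else 0)
      - (if j = p' then QuadraticAlgebra.omega else 0) := by
  simp only [weight, singleWeight, algebraMap_eq, u_eq, v_eq, map_sub, map_add,
    apply_ite (algebraMap _ _), map_zero, ite_add_zero]
  ring

/-- The difference `y_c - y_{c+1}` in a Bott–Samelson ring. -/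
abbrev rootB (m l : ℕ) (i : Fin l → Fin (m + 1)) (c : Fin (m + 1)) : BSRing m l i :=
  yB m l i c.castSucc - yB m l i c.succ

theorem rootB_mem_compBS (m l : ℕ) (i : Fin l → Fin (m + 1)) (c : Fin (m + 1)) :
    rootB m l i c ∈ compBS m l i 1 :=
  (isGradingFamily_compBS m l i).stable.sub_mem (yB_mem_compBS m l i _) (yB_mem_compBS m l i _)

theorem exists_singleEquiv {m l : ℕ} (i : Fin l → Fin (m + 1)) (p : Fin (m + 1)) :
    ∃ E : BSRing m (l + 1) (snocWord i p) ≃+*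
        QuadraticAlgebra (BSRing m l i) 0 (-rootB m l i p),
      (∀ d x, E x ∈ quadComp (compBS m l i) d ↔ x ∈ compBS m (l + 1) (snocWord i p) d) ∧
      (∀ j, E (xB m (l + 1) (snocWord i p) j) = algebraMap (BSRing m l i) _ (xB m l i j)) ∧
      ∀ j, E (yB m (l + 1) (snocWord i p) j) =
        singleWeight (yB m l i j) j p.castSucc p.succ :=
  exists_snocEquiv i p (RingEquiv.refl _) (isGradingFamily_compBS m l i) (fun _ _ => Iff.rfl)
    (neg_neg _).symm

theorem root_ite_self {m : ℕ} {S : Type*} [AddCommGroup S] (a : S) (p : Fin (m + 1)) :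
    ((if p.castSucc = p.castSucc then a else 0) - (if p.castSucc = p.succ then a else 0))
      - ((if p.succ = p.castSucc then a else 0) - (if p.succ = p.succ then a else 0)) = a + a := by
  simp [Fin.ext_iff]

theorem root_ite_adjacent {m : ℕ} {S : Type*} [AddCommGroup S] (a : S) {p q : Fin (m + 1)}
    (h : (p : ℕ) = q + 1 ∨ (q : ℕ) = p + 1) :
    ((if p.castSucc = q.castSucc then a else 0) - (if p.castSucc = q.succ then a else 0))
      - ((if p.succ = q.castSucc then a else 0) - (if p.succ = q.succ then a else 0)) = -a := by
  simp only [Fin.ext_iff, Fin.val_castSucc, Fin.val_succ]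
  split_ifs <;> first | omega | simp

theorem exists_tripleEquiv {m l : ℕ} (i : Fin l → Fin (m + 1)) (p q : Fin (m + 1))
    (h : (p : ℕ) = q + 1 ∨ (q : ℕ) = p + 1) :
    ∃ E : BSRing m (l + 3) (snocWord (snocWord (snocWord i p) q) p) ≃+*
        TripleExt (BSRing m l i) (rootB m l i q) (rootB m l i p),
      (∀ d x, E x ∈ TripleExt.comp (compBS m l i) d ↔
        x ∈ compBS m (l + 3) (snocWord (snocWord (snocWord i p) q) p) d) ∧
      (∀ j, E (xB m (l + 3) (snocWord (snocWord (snocWord i p) q) p) j) =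
        algebraMap (BSRing m l i) _ (xB m l i j)) ∧
      ∀ j, E (yB m (l + 3) (snocWord (snocWord (snocWord i p) q) p) j) =
        TripleExt.weight (yB m l i j) j p.castSucc p.succ q.castSucc q.succ := by
  have hG := isGradingFamily_compBS m l i
  obtain ⟨E₁, hE₁, hx₁, hy₁⟩ := exists_singleEquiv i p
  have hG₁ := hG.quad (hG.neg_mem (rootB_mem_compBS m l i p))
  have hβ₂ : E₁ (rootB m (l + 1) (snocWord i p) q)
      = -tripleCoeff₂ (rootB m l i q) (rootB m l i p) := by
    refine (map_sub E₁ _ _).trans ?_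
    rw [hy₁, hy₁, singleWeight, singleWeight]
    rw [neg_tripleCoeff₂_sub]
    linear_combination root_ite_adjacent (QuadraticAlgebra.omega :
      QuadraticAlgebra (BSRing m l i) 0 (-rootB m l i p)) h.symm
  obtain ⟨E₂, hE₂, hx₂, hy₂⟩ := exists_snocEquiv (snocWord i p) q E₁ hG₁ hE₁ hβ₂
  have hG₂ := hG₁.quad (b := tripleCoeff₂ (rootB m l i q) (rootB m l i p))
    ⟨hG.neg_mem (rootB_mem_compBS m l i q), hG.one_mem⟩
  have hβ₃ : E₂ (rootB m (l + 2) (snocWord (snocWord i p) q) p)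
      = -tripleCoeff₃ (rootB m l i q) (rootB m l i p) := by
    refine (map_sub E₂ _ _).trans ?_
    rw [hy₂, hy₂, hy₁, hy₁, singleWeight, singleWeight]
    rw [neg_tripleCoeff₃_sub, ← root_ite_self _ p]
    simp only [map_sub, map_add]
    linear_combination root_ite_adjacent (QuadraticAlgebra.omega :
      QuadraticAlgebra (QuadraticAlgebra (BSRing m l i) 0 (-rootB m l i p)) 0
        (tripleCoeff₂ (rootB m l i q) (rootB m l i p))) h
  obtain ⟨E₃, hE₃, hx₃, hy₃⟩ := exists_snocEquiv (snocWord (snocWord i p) q) p E₂ hG₂ hE₂ hβ₃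
  refine ⟨E₃, hE₃, fun j => ?_, fun j => ?_⟩
  · rw [hx₃, hx₂, hx₁, TripleExt.algebraMap_eq]
  · rw [hy₃, hy₂, hy₁, TripleExt.weight_eq]

/-- The pairs of elements whose multiplications are intertwined by an additive isomorphism. -/
def intertwiners {R S : Type*} [Ring R] [Ring S] (e : R ≃+ S) : Subring (R × S) where
  carrier := {t | ∀ x, e (t.1 * x) = t.2 * e x}
  zero_mem' x := by simp
  one_mem' x := by simp
  add_mem' ha hb x := by simp [add_mul, ha x, hb x]
  neg_mem' ha x := by simp [ha x]
  mul_mem' ha hb x := by simp [mul_assoc, ha _, hb x]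

theorem TripleExt.algebraMap_mem_intertwiners {A : Type*} [CommRing A] (α γ t : A) :
    ((algebraMap A _ t, algebraMap A _ t), (algebraMap A _ t, algebraMap A _ t)) ∈
      intertwiners (swapEquiv α γ) := by
  rintro ⟨x, g⟩
  simp [swapEquiv, ← Algebra.smul_def, cross_smul, proj_smul, incl_smul]

theorem TripleExt.u_mem_intertwiners {A : Type*} [CommRing A] (α γ : A) :
    ((u, QuadraticAlgebra.omega), (v, 0)) ∈ intertwiners (swapEquiv α γ) := by
  rintro ⟨x, g⟩
  simp [swapEquiv, cross_u_mul, proj_u_mul, ← v_mul_incl, mul_add]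

theorem TripleExt.v_mem_intertwiners {A : Type*} [CommRing A] (α γ : A) :
    ((v, 0), (u, QuadraticAlgebra.omega)) ∈ intertwiners (swapEquiv α γ) := by
  rintro ⟨x, g⟩
  simp [swapEquiv, cross_v_mul, proj_v_mul, u_mul_incl, mul_add, incl_zero]

theorem mem_shiftSet_ringEquiv_iff {R S : Type*} [CommRing R] [CommRing S] (E : R ≃+* S)
    {G : ℕ → Set R} {H : ℕ → Set S} (h : ∀ d x, E x ∈ H d ↔ x ∈ G d) (d : ℕ) (x : R) :
    E x ∈ shiftSet H d ↔ x ∈ shiftSet G d := by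
  cases d with
  | zero => exact map_eq_zero_iff E E.injective
  | succ d => exact h d x

theorem snocWord_eq_of_lt {m l : ℕ} (b : Fin l → Fin (m + 1)) (c : Fin (m + 1)) :
    (fun t : Fin (l + 1) => if h : (t : ℕ) < l then b ⟨t, h⟩ else c) = snocWord b c := by
  funext t
  induction t using Fin.lastCases <;> simp [snocWord]

theorem snocWord_snocWord_snocWord_eq {m l : ℕ} (b : Fin l → Fin (m + 1))
    (p q : Fin (m + 1)) :
    (fun t : Fin (l + 3) => if h : (t : ℕ) < l then b ⟨t, h⟩
      else if (t : ℕ) = l then p else if (t : ℕ) = l + 1 then q else p)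
      = snocWord (snocWord (snocWord b p) q) p := by
  funext t
  induction t using Fin.lastCases with
  | last => simp [snocWord]
  | cast t =>
    induction t using Fin.lastCases with
    | last => simp [snocWord]
    | cast t => induction t using Fin.lastCases <;> simp [snocWord]

theorem toBS_mem_subring {m l₁ l₂ l₃ l₄ : ℕ} {i₁ : Fin l₁ → Fin (m + 1)}
    {i₂ : Fin l₂ → Fin (m + 1)} {i₃ : Fin l₃ → Fin (m + 1)} {i₄ : Fin l₄ → Fin (m + 1)}
    (I : Subring ((BSRing m l₁ i₁ × BSRing m l₂ i₂) × (BSRing m l₃ i₃ × BSRing m l₄ i₄)))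
    (hx : ∀ j, ((xB m l₁ i₁ j, xB m l₂ i₂ j), (xB m l₃ i₃ j, xB m l₄ i₄ j)) ∈ I)
    (hy : ∀ j, ((yB m l₁ i₁ j, yB m l₂ i₂ j), (yB m l₃ i₃ j, yB m l₄ i₄ j)) ∈ I)
    (f : MvPolynomial (Fin (m + 2) ⊕ Fin (m + 2)) ℤ) :
    ((toBS m l₁ i₁ f, toBS m l₂ i₂ f), (toBS m l₃ i₃ f, toBS m l₄ i₄ f)) ∈ I := by
  let F := ((toBS m l₁ i₁).prod (toBS m l₂ i₂)).prod ((toBS m l₃ i₃).prod (toBS m l₄ i₄))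
  change F f ∈ I
  induction f using MvPolynomial.induction_on with
  | C n =>
    have hn : F (C n) = (n : _) := eq_intCast (F.comp C) n
    rw [hn]
    exact intCast_mem I n
  | add p q hp hq => rw [map_add]; exact add_mem hp hq
  | mul_X p v hp =>
    rw [map_mul]
    refine mul_mem hp ?_
    rcases v with j | j
    · convert hx j <;> simp [F, toBS]
    · convert hy j <;> simp [F, toBS]

theorem TripleExt.weight_mem_intertwiners {A ι : Type*} [CommRing A] [DecidableEq ι]
    (α γ t : A) (j p p' q q' : ι) :
    ((weight t j p p' q q', singleWeight t j q q'),
      (weight t j q q' p p', singleWeight t j p p')) ∈ intertwiners (swapEquiv α γ) := by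
  have h {P : Prop} [Decidable P] {t : (TripleExt A α γ × QuadraticAlgebra A 0 (-α)) ×
      (TripleExt A γ α × QuadraticAlgebra A 0 (-γ))} (ht : t ∈ intertwiners (swapEquiv α γ)) :
      (if P then t else 0) ∈ intertwiners (swapEquiv α γ) := by
    split_ifs
    exacts [ht, zero_mem _]
  convert sub_mem (add_mem (sub_mem (add_mem (algebraMap_mem_intertwiners α γ t)
    (h (P := j = p) (v_mem_intertwiners α γ))) (h (P := j = p') (v_mem_intertwiners α γ)))
    (h (P := j = q) (u_mem_intertwiners α γ))) (h (P := j = q') (u_mem_intertwiners α γ)) using 1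
  ext1 <;> ext1 <;> simp only [weight, singleWeight, Prod.fst_add, Prod.snd_add, Prod.fst_sub,
    Prod.snd_sub,
    apply_ite Prod.fst, apply_ite Prod.snd, Prod.fst_zero, Prod.snd_zero, ite_self]
  all_goals ring

/-- The graded `P`-module isomorphism for the braid move of adjacent crossings `p` and `q`. -/
theorem exists_braidEquiv {m l : ℕ} (b : Fin l → Fin (m + 1)) (p q : Fin (m + 1))
    (h : (p : ℕ) = q + 1 ∨ (q : ℕ) = p + 1) {iJ iJt : Fin (l + 3) → Fin (m + 1)}
    {iJ' iJt' : Fin (l + 1) → Fin (m + 1)}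
    (hJ : iJ = snocWord (snocWord (snocWord b p) q) p)
    (hJt : iJt = snocWord (snocWord (snocWord b q) p) q)
    (hJ' : iJ' = snocWord b p) (hJt' : iJt' = snocWord b q) :
    ∃ e : (BSRing m (l + 3) iJ × BSRing m (l + 1) iJt') ≃+
          (BSRing m (l + 3) iJt × BSRing m (l + 1) iJ'),
      (∀ (f : MvPolynomial (Fin (m + 2) ⊕ Fin (m + 2)) ℤ)
          (u : BSRing m (l + 3) iJ × BSRing m (l + 1) iJt'),
        e (toBS m (l + 3) iJ f * u.1, toBS m (l + 1) iJt' f * u.2)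
          = (toBS m (l + 3) iJt f * (e u).1, toBS m (l + 1) iJ' f * (e u).2)) ∧
      (∀ (d : ℕ) (u : BSRing m (l + 3) iJ × BSRing m (l + 1) iJt'),
        u.1 ∈ compBS m (l + 3) iJ d → u.2 ∈ shiftSet (compBS m (l + 1) iJt') d →
          (e u).1 ∈ compBS m (l + 3) iJt d ∧
            (e u).2 ∈ shiftSet (compBS m (l + 1) iJ') d) ∧
      (∀ (d : ℕ) (v : BSRing m (l + 3) iJt × BSRing m (l + 1) iJ'),
        v.1 ∈ compBS m (l + 3) iJt d → v.2 ∈ shiftSet (compBS m (l + 1) iJ') d →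
          (e.symm v).1 ∈ compBS m (l + 3) iJ d ∧
            (e.symm v).2 ∈ shiftSet (compBS m (l + 1) iJt') d) := by
  subst hJ hJt hJ' hJt'
  obtain ⟨E₁, hE₁, hx₁, hy₁⟩ := exists_tripleEquiv b p q h
  obtain ⟨E₂, hE₂, hx₂, hy₂⟩ := exists_singleEquiv b q
  obtain ⟨E₃, hE₃, hx₃, hy₃⟩ := exists_tripleEquiv b q p h.symm
  obtain ⟨E₄, hE₄, hx₄, hy₄⟩ := exists_singleEquiv b p
  have hG := isGradingFamily_compBS m l b
  have hp := rootB_mem_compBS m l b p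
  have hq := rootB_mem_compBS m l b q
  let S := TripleExt.swapEquiv (rootB m l b q) (rootB m l b p)
  let e := ((E₁.toAddEquiv.prodCongr E₂.toAddEquiv).trans S).trans
    (E₃.toAddEquiv.prodCongr E₄.toAddEquiv).symm
  have he (u) : e u = (E₃.symm (S (E₁ u.1, E₂ u.2)).1, E₄.symm (S (E₁ u.1, E₂ u.2)).2) := rfl
  have hes (v) : e.symm v =
      (E₁.symm (S.symm (E₃ v.1, E₄ v.2)).1, E₂.symm (S.symm (E₃ v.1, E₄ v.2)).2) := rfl
  have hmem {t} (ht : ((E₁ t.1.1, E₂ t.1.2), (E₃ t.2.1, E₄ t.2.2)) ∈ intertwiners S) :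
      t ∈ intertwiners e := fun u => by
    have := ht (E₁ u.1, E₂ u.2)
    rw [he, he, Prod.fst_mul, Prod.snd_mul, map_mul, map_mul]
    simp only [Prod.mk_mul_mk] at this
    rw [this]
    ext1 <;> simp
  refine ⟨e, fun f u => ?_, fun d u h₁ h₂ => ?_, fun d v h₁ h₂ => ?_⟩
  · refine toBS_mem_subring (intertwiners e) (fun j => hmem ?_) (fun j => hmem ?_) f u
    · dsimp only
      rw [hx₁, hx₂, hx₃, hx₄]
      exact TripleExt.algebraMap_mem_intertwiners _ _ _
    · dsimp only
      rw [hy₁, hy₂, hy₃, hy₄]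
      exact TripleExt.weight_mem_intertwiners _ _ _ _ _ _ _ _
  · rw [← hE₁] at h₁
    rw [← mem_shiftSet_ringEquiv_iff E₂ hE₂] at h₂
    rw [he, ← hE₃, ← mem_shiftSet_ringEquiv_iff E₄ hE₄, E₃.apply_symm_apply,
      E₄.apply_symm_apply]
    exact TripleExt.swapEquiv_mem hG hq hp h₁ h₂
  · rw [← hE₃] at h₁
    rw [← mem_shiftSet_ringEquiv_iff E₄ hE₄] at h₂
    rw [hes, ← hE₁, ← mem_shiftSet_ringEquiv_iff E₂ hE₂, E₁.apply_symm_apply,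
      E₂.apply_symm_apply]
    exact TripleExt.swapEquiv_symm_mem hG hq hp h₁ h₂

/-- Let `r = m + 2 ≥ 3`, let `s` be a crossing index with a
predecessor (zero-based: `c : Fin (m+1)` with `1 ≤ c`, and `c' = c − 1`), let
`(i_1,…,i_{l−3})` be any sequence of crossing indices, and set `J = (…, c, c', c)`,
`J̃ = (…, c', c, c')`, `J' = (…, c)`, `J̃' = (…, c')`.  Then there is an isomorphism
of graded `P`-modules `R_J ⊕ R_{J̃'}{2} ≅ R_{J̃} ⊕ R_{J'}{2}`, where
`P = ℤ[x_1,…,x_r,y_1,…,y_r]` acts through `x_j ↦ x_j`, `y_j ↦ x_j + δ̂_j − δ̂_{j−1}`: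
an additive isomorphism commuting with the `P`-action which, together with its
inverse, preserves the homogeneous components (with the shift `{2}` on the second
factors). -/
theorem stmt13 (m l0 : ℕ) (b : Fin l0 → Fin (m + 1)) (c : Fin (m + 1))
    (hc : 1 ≤ (c : ℕ)) :
    let c' : Fin (m + 1) := ⟨(c : ℕ) - 1, lt_of_le_of_lt (Nat.sub_le _ _) c.isLt⟩
    let iJ : Fin (l0 + 3) → Fin (m + 1) := fun t =>
      if h : (t : ℕ) < l0 then b ⟨t, h⟩
      else if (t : ℕ) = l0 then c else if (t : ℕ) = l0 + 1 then c' else c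
    let iJt : Fin (l0 + 3) → Fin (m + 1) := fun t =>
      if h : (t : ℕ) < l0 then b ⟨t, h⟩
      else if (t : ℕ) = l0 then c' else if (t : ℕ) = l0 + 1 then c else c'
    let iJ' : Fin (l0 + 1) → Fin (m + 1) := fun t =>
      if h : (t : ℕ) < l0 then b ⟨t, h⟩ else c
    let iJt' : Fin (l0 + 1) → Fin (m + 1) := fun t =>
      if h : (t : ℕ) < l0 then b ⟨t, h⟩ else c'
    ∃ e : (BSRing m (l0 + 3) iJ × BSRing m (l0 + 1) iJt') ≃+
          (BSRing m (l0 + 3) iJt × BSRing m (l0 + 1) iJ'),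
      (∀ (p : MvPolynomial (Fin (m + 2) ⊕ Fin (m + 2)) ℤ)
          (u : BSRing m (l0 + 3) iJ × BSRing m (l0 + 1) iJt'),
        e (toBS m (l0 + 3) iJ p * u.1, toBS m (l0 + 1) iJt' p * u.2)
          = (toBS m (l0 + 3) iJt p * (e u).1, toBS m (l0 + 1) iJ' p * (e u).2)) ∧
      (∀ (d : ℕ) (u : BSRing m (l0 + 3) iJ × BSRing m (l0 + 1) iJt'),
        u.1 ∈ compBS m (l0 + 3) iJ d → u.2 ∈ shiftSet (compBS m (l0 + 1) iJt') d →
          (e u).1 ∈ compBS m (l0 + 3) iJt d ∧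
            (e u).2 ∈ shiftSet (compBS m (l0 + 1) iJ') d) ∧
      (∀ (d : ℕ) (v : BSRing m (l0 + 3) iJt × BSRing m (l0 + 1) iJ'),
        v.1 ∈ compBS m (l0 + 3) iJt d → v.2 ∈ shiftSet (compBS m (l0 + 1) iJ') d →
          (e.symm v).1 ∈ compBS m (l0 + 3) iJ d ∧
            (e.symm v).2 ∈ shiftSet (compBS m (l0 + 1) iJt') d) := by
  intro c' iJ iJt iJ' iJt'
  exact exists_braidEquiv b c c' (Or.inl (Nat.sub_add_cancel hc).symm)
    (snocWord_snocWord_snocWord_eq b c c') (snocWord_snocWord_snocWord_eq b c' c)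
    (snocWord_eq_of_lt b c) (snocWord_eq_of_lt b c')
end
end
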